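/- For every integer k ≥ 1, every C₄-free k-planar finite simple graph on n ≥ 2 vertices whose number m of edges satisfies m ≥ 3.483·n also satisfies m ≤ √(114075·k/12544)·n; in particular m < 3.016·√k·n. -/

import Mathlib

open unitInterval

/-- A (good) drawing of a simple graph in the plane: vertices map to distinct
points, each edge is drawn as a simple continuous arc between its endpoints,
arcs avoid vertex points other than their endpoints, two arcs meet in finitely
many points, and no three arcs pass through a common interior point. -/
structure PlaneDrawing {V : Type*} (G : SimpleGraph V) where
  pos : V → ℝ × ℝ
  pos_inj : Function.Injective pos
  arc : ∀ ⦃u v : V⦄, G.Adj u v → Path (pos u) (pos v)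
  arc_symm : ∀ ⦃u v : V⦄ (h : G.Adj u v), arc h.symm = (arc h).symm
  arc_inj : ∀ ⦃u v : V⦄ (h : G.Adj u v), Function.Injective (arc h)
  no_vertex_mem : ∀ ⦃u v : V⦄ (h : G.Adj u v) (w : V) (t : I),
      arc h t = pos w → w = u ∨ w = v
  finite_inter : ∀ ⦃u v x y : V⦄ (h₁ : G.Adj u v) (h₂ : G.Adj x y),
      s(u, v) ≠ s(x, y) →
      (Set.range (arc h₁) ∩ Set.range (arc h₂)).Finite
  no_triple_point : ∀ ⦃u₁ v₁ u₂ v₂ u₃ v₃ : V⦄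
      (h₁ : G.Adj u₁ v₁) (h₂ : G.Adj u₂ v₂) (h₃ : G.Adj u₃ v₃),
      s(u₁, v₁) ≠ s(u₂, v₂) → s(u₁, v₁) ≠ s(u₃, v₃) → s(u₂, v₂) ≠ s(u₃, v₃) →
      ∀ t₁ t₂ t₃ : I, t₁ ≠ 0 → t₁ ≠ 1 → t₂ ≠ 0 → t₂ ≠ 1 → t₃ ≠ 0 → t₃ ≠ 1 →
      arc h₁ t₁ = arc h₂ t₂ → arc h₂ t₂ = arc h₃ t₃ → False

namespace PlaneDrawing

variable {V : Type*} {G : SimpleGraph V} (D : PlaneDrawing G)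

/-- `p` is an interior point of the arc of the edge `uv`. -/
def IsInteriorPoint {u v : V} (h : G.Adj u v) (p : ℝ × ℝ) : Prop :=
  ∃ t : I, t ≠ 0 ∧ t ≠ 1 ∧ D.arc h t = p

/-- The set of crossing points of the drawing: points where the interiors of
the arcs of two distinct edges meet. -/
def crossings : Set (ℝ × ℝ) :=
  {p | ∃ (u v x y : V) (h₁ : G.Adj u v) (h₂ : G.Adj x y),
    s(u, v) ≠ s(x, y) ∧ D.IsInteriorPoint h₁ p ∧ D.IsInteriorPoint h₂ p}

/-- The number of crossings of the drawing. -/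
noncomputable def crossingCount : ℕ := D.crossings.ncard

/-- The set of crossing points lying on the edge `uv`. -/
def edgeCrossings {u v : V} (h : G.Adj u v) : Set (ℝ × ℝ) :=
  {p | D.IsInteriorPoint h p ∧
    ∃ (x y : V) (h₂ : G.Adj x y), s(u, v) ≠ s(x, y) ∧ D.IsInteriorPoint h₂ p}

/-- A drawing is `k`-plane if every edge is involved in at most `k` crossings. -/
def IsKPlane (k : ℕ) : Prop :=
  ∀ ⦃u v : V⦄ (h : G.Adj u v), (D.edgeCrossings h).ncard ≤ k

end PlaneDrawing

/-- The crossing number of a graph: the minimum number of crossings over all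
drawings. -/
noncomputable def crossingNumber {V : Type*} (G : SimpleGraph V) : ℕ :=
  sInf {c : ℕ | ∃ D : PlaneDrawing G, D.crossingCount = c}

/-- A graph is `k`-planar if it admits a drawing in which every edge is
involved in at most `k` crossings. -/
def KPlanar {V : Type*} (G : SimpleGraph V) (k : ℕ) : Prop :=
  ∃ D : PlaneDrawing G, D.IsKPlane k

/-- `G` has no cycle of length `ℓ`. -/
def HasNoCycleOfLength {V : Type*} (G : SimpleGraph V) (ℓ : ℕ) : Prop :=
  ∀ (v : V) (c : G.Walk v v), c.IsCycle → c.length ≠ ℓ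

namespace PlanarHypermap

section Orbits

theorem injOn_pow_apply {D : Type*} (φ : Equiv.Perm D) (g : D) (p : ℕ)
    (h : ∀ i, 0 < i → i < p → (φ ^ i) g ≠ g) :
    Set.InjOn (fun i : ℕ => (φ ^ i) g) (Finset.range p : Set ℕ) := by
  have key : ∀ i j, i < j → j < p → (φ ^ i) g ≠ (φ ^ j) g := by
    intro i j hij hj he
    apply h (j - i) (by omega) (by omega)
    apply (φ ^ i).injective
    rw [← Equiv.Perm.mul_apply, ← pow_add, he]
    congr 2
    omega
  intro i hi j hj hij
  simp only [Finset.coe_range, Set.mem_Iio] at hi hj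
  rcases lt_trichotomy i j with hlt | heq | hgt
  · exact absurd hij (key i j hlt hj)
  · exact heq
  · exact absurd hij.symm (key j i hgt hi)

variable {D : Type*} [Fintype D]

/-- The number of cycles of a permutation is at most the total weight, provided every cycle
has weight at least one. -/
theorem card_cycles_le_sum (φ : Equiv.Perm D) (val : D → ℚ) (hval : ∀ g, 0 ≤ val g)
    (h : ∀ g, ∃ p : ℕ, (∀ i, 0 < i → i < p → (φ ^ i) g ≠ g) ∧
      1 ≤ ∑ i ∈ Finset.range p, val ((φ ^ i) g)) :
    (Nat.card (Quotient (Equiv.Perm.SameCycle.setoid φ)) : ℚ) ≤ ∑ g, val g := by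
  classical
  rw [Nat.card_eq_fintype_card]
  rw [← Finset.sum_fiberwise Finset.univ
    (fun g : D => (Quotient.mk (Equiv.Perm.SameCycle.setoid φ) g)) val]
  have : (Fintype.card (Quotient (Equiv.Perm.SameCycle.setoid φ)) : ℚ)
      = ∑ q : Quotient (Equiv.Perm.SameCycle.setoid φ), (1 : ℚ) := by simp
  rw [this]
  refine Finset.sum_le_sum fun q _ => ?_
  induction q using Quotient.inductionOn with
  | h g =>
    obtain ⟨p, hp, hs⟩ := h g
    refine hs.trans ?_
    rw [← Finset.sum_image (f := val) (g := fun i : ℕ => (φ ^ i) g)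
      (injOn_pow_apply φ g p hp)]
    refine Finset.sum_le_sum_of_subset_of_nonneg ?_ fun x _ _ => hval x
    intro x hx
    obtain ⟨i, _, rfl⟩ := Finset.mem_image.1 hx
    simp only [Finset.mem_filter, Finset.mem_univ, true_and]
    refine Quotient.sound ?_
    change Equiv.Perm.SameCycle φ ((φ ^ i) g) g
    exact (Equiv.Perm.sameCycle_pow_left).2 (Equiv.Perm.SameCycle.refl _ _)

/-- The algebraic form of Euler's inequality: if every chain satisfying the linear constraints
bounds a function on the faces, then `|D| ≤ #constraints + #faces`. -/
theorem card_le_card_constraints_add_card_faces {A : Type*} [Fintype A]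
    (L : A → (D → ZMod 2) →ₗ[ZMod 2] ZMod 2) (φ ρ : Equiv.Perm D)
    (h : ∀ c : D → ZMod 2, (∀ a, L a c = 0) →
      ∃ w : D → ZMod 2, ∀ g, w (φ g) = w g ∧ c g = w g + w (ρ g)) :
    Fintype.card D ≤ Fintype.card A + Nat.card (Quotient (Equiv.Perm.SameCycle.setoid φ)) := by
  classical
  let Q := Quotient (Equiv.Perm.SameCycle.setoid φ)
  have : Nat.card Q = Fintype.card Q := Nat.card_eq_fintype_card
  rw [this]
  let LL : (D → ZMod 2) →ₗ[ZMod 2] (A → ZMod 2) := LinearMap.pi L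
  let δ : (Q → ZMod 2) →ₗ[ZMod 2] (D → ZMod 2) :=
    LinearMap.pi fun g =>
      LinearMap.proj (R := ZMod 2) (φ := fun _ : Q => ZMod 2) (Quotient.mk _ g) +
      LinearMap.proj (R := ZMod 2) (φ := fun _ : Q => ZMod 2) (Quotient.mk _ (ρ g))
  have hker : LinearMap.ker LL ≤ LinearMap.range δ := by
    intro c hc
    obtain ⟨w, hw⟩ := h c (fun a => by
      have := congrFun (LinearMap.mem_ker.1 hc) a
      simpa [LL] using this)
    have hinv : ∀ x y, Equiv.Perm.SameCycle φ x y → w x = w y := by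
      intro x y hxy
      obtain ⟨i, _, rfl⟩ := hxy.exists_pow_eq'
      clear hxy
      induction i with
      | zero => simp
      | succ i ih => rw [pow_succ', Equiv.Perm.mul_apply, (hw _).1]; exact ih (by omega)
    refine ⟨fun q => Quotient.lift w hinv q, ?_⟩
    ext g
    simp [δ, (hw g).2]
  have h1 := LinearMap.finrank_range_add_finrank_ker LL
  have h2 := Submodule.finrank_mono hker
  have h3 := LinearMap.finrank_range_le δ
  have h4 := Submodule.finrank_le (LinearMap.range LL)
  simp only [Module.finrank_fintype_fun_eq_card] at h1 h3 h4
  omega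

end Orbits

end PlanarHypermap

/-- A rotation system for a drawing of `G` in which every edge is crossed at most once.
`ρ` rotates the darts around their initial vertices; `θ` reverses an uncrossed dart and sends a
crossed dart to the next dart around its crossing.  The field `planar` says that every
mod-2 cycle is a boundary, i.e. the drawing lives on the sphere. -/
structure OnePlaneMap {V : Type*} [Fintype V] [DecidableEq V] (G : SimpleGraph V)
    [DecidableRel G.Adj] where
  ρ : Equiv.Perm G.Dart
  θ : Equiv.Perm G.Dart
  crossed : G.Dart → Prop
  fst_ρ : ∀ g, (ρ g).fst = g.fst
  ρ_ne : ∀ g, ρ g ≠ g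
  ρ_ρ_ne : ∀ g, ρ (ρ g) ≠ g
  θ_uncrossed : ∀ g, ¬ crossed g → θ g = g.symm
  θ_crossed : ∀ g, crossed g → θ (θ g) = g.symm
  crossed_θ : ∀ g, crossed (θ g) ↔ crossed g
  fst_θ_ne : ∀ g, crossed g → (θ g).fst ≠ g.fst ∧ (θ g).fst ≠ g.snd
  planar : ∀ c : G.Dart → ZMod 2,
    (∀ v, ∑ g : G.Dart with g.fst = v, c g = 0) →
    (∀ g, ¬ crossed g → c g + c (θ g) = 0) →
    (∀ g, crossed g → c g + c (θ g) + c (θ (θ g)) + c (θ (θ (θ g))) = 0) →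
    ∃ w : G.Dart → ZMod 2, ∀ g, w (θ g) = w g + c g ∧ w (ρ g) = w g + c (ρ g)

/-- `G` has no 4-cycle, in terms of adjacency. -/
def NoFourCycle {V : Type*} (G : SimpleGraph V) : Prop :=
  ∀ a b c d, a ≠ c → b ≠ d → G.Adj a b → G.Adj b c → G.Adj c d → G.Adj d a → False

namespace OnePlaneMap

theorem adj_fst_snd {V : Type*} {G : SimpleGraph V} (g : G.Dart) : G.Adj g.fst g.snd := g.adj

variable {V : Type*} [Fintype V] [DecidableEq V] {G : SimpleGraph V} [DecidableRel G.Adj]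
  (M : OnePlaneMap G)

/-- The face permutation. -/
def φ : Equiv.Perm G.Dart := M.θ.trans M.ρ

theorem φ_apply (g : G.Dart) : M.φ g = M.ρ (M.θ g) := rfl

theorem fst_φ (g : G.Dart) : (M.φ g).fst = (M.θ g).fst := M.fst_ρ _

theorem fst_φ_uncrossed {g : G.Dart} (h : ¬ M.crossed g) : (M.φ g).fst = g.snd := by
  rw [fst_φ, M.θ_uncrossed g h]; rfl

theorem crossed_symm (g : G.Dart) : M.crossed g.symm ↔ M.crossed g := by
  by_cases h : M.crossed g
  · rw [← M.θ_crossed g h, M.crossed_θ, M.crossed_θ]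
  · rw [← M.θ_uncrossed g h, M.crossed_θ]

theorem θ_pow_four (g : G.Dart) : M.θ (M.θ (M.θ (M.θ g))) = g := by
  by_cases h : M.crossed g
  · have h2 : M.crossed (M.θ (M.θ g)) := by rwa [M.crossed_θ, M.crossed_θ]
    rw [M.θ_crossed _ h2, M.θ_crossed _ h]; simp
  · have h2 : ∀ g, ¬ M.crossed g → M.θ (M.θ g) = g := by
      intro g h
      rw [M.θ_uncrossed g h, M.θ_uncrossed _ (by rwa [M.crossed_symm])]; simp
    rw [h2 _ h, h2 _ h]

theorem φ_ne (g : G.Dart) : M.φ g ≠ g := by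
  intro h
  have h1 := congrArg (fun d : G.Dart => d.fst) h
  simp only [M.fst_φ] at h1
  by_cases hc : M.crossed g
  · exact (M.fst_θ_ne g hc).1 h1
  · rw [M.θ_uncrossed g hc] at h1
    exact g.snd_ne_fst h1

theorem snd_φ_ne {g : G.Dart} (h : ¬ M.crossed g) : (M.φ g).snd ≠ g.fst := by
  intro he
  apply M.ρ_ne g.symm
  have h1 := M.fst_φ_uncrossed h
  rw [M.φ_apply, M.θ_uncrossed g h] at he h1
  apply SimpleGraph.Dart.ext
  exact Prod.ext h1 he

theorem crossed_of_φ_φ {g : G.Dart} (h : M.φ (M.φ g) = g) : M.crossed g ∨ M.crossed (M.φ g) := by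
  by_contra! hc
  apply M.snd_φ_ne hc.1
  rw [← M.fst_φ_uncrossed hc.2, h]

/-- Triangular faces with one crossing, marked at the dart preceding the crossing. -/
def IsT (g : G.Dart) : Prop := M.crossed g ∧ ¬ M.crossed (M.φ g) ∧ M.φ (M.φ g) = g
/-- Quadrangular faces with two crossings. -/
def IsQ (g : G.Dart) : Prop := M.crossed g ∧ M.crossed (M.φ g) ∧ M.φ (M.φ g) = g
/-- Quadrangular faces with one crossing. -/
def IsS (g : G.Dart) : Prop := M.crossed g ∧ ¬ M.crossed (M.φ g) ∧ ¬ M.crossed (M.φ (M.φ g)) ∧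
  M.φ (M.φ (M.φ g)) = g
/-- Triangular faces without crossings. -/
def IsA (g : G.Dart) : Prop := ¬ M.crossed g ∧ ¬ M.crossed (M.φ g) ∧ ¬ M.crossed (M.φ (M.φ g)) ∧
  M.φ (M.φ (M.φ g)) = g
/-- Triangular faces with one crossing having a neighbouring such face at this crossing. -/
def IsTT (g : G.Dart) : Prop := M.IsT g ∧ (M.IsT (M.θ g) ∨ M.IsT (M.θ (M.θ (M.θ g))))

variable {M}

theorem IsT.adj {g : G.Dart} (h : M.IsT g) : G.Adj g.fst (M.θ g).fst := by
  have h1 := (M.φ g).adj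
  have h2 := M.fst_φ_uncrossed h.2.1
  rw [h.2.2] at h2
  change G.Adj (M.φ g).fst (M.φ g).snd at h1
  rw [← h2, M.fst_φ] at h1
  exact h1.symm

theorem fst_θ_θ {g : G.Dart} (h : M.crossed g) : (M.θ (M.θ g)).fst = g.snd := by
  rw [M.θ_crossed g h]; rfl

theorem crossed_of_dart {a b : V} {g g' : G.Dart} (ha : g.fst = a) (hb : g.snd = b)
    (h : g'.fst = a ∧ g'.snd = b ∨ g'.fst = b ∧ g'.snd = a) :
    M.crossed g ↔ M.crossed g' := by
  rcases h with h | h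
  · have : g = g' := SimpleGraph.Dart.ext _ _ (Prod.ext (ha.trans h.1.symm) (hb.trans h.2.symm))
    rw [this]
  · have : g = g'.symm :=
      SimpleGraph.Dart.ext _ _ (Prod.ext (ha.trans h.2.symm) (hb.trans h.1.symm))
    rw [this, M.crossed_symm]

/-- The third vertex of a face with exactly one crossing and three vertices. -/
theorem IsS.exists_vertex {g : G.Dart} (h : M.IsS g) : ∃ q, G.Adj (M.θ g).fst q ∧ G.Adj q g.fst ∧
    q ≠ g.snd ∧ q ≠ (M.θ g).snd := by
  obtain ⟨h0, h1, h2, h3⟩ := h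
  have e1 := M.fst_φ g
  have e2 := M.fst_φ_uncrossed h1
  have e3 := M.fst_φ_uncrossed h2
  rw [h3] at e3
  have a1 := adj_fst_snd (M.φ g)
  have a2 := adj_fst_snd (M.φ (M.φ g))
  refine ⟨(M.φ g).snd, e1 ▸ a1, ?_, ?_, ?_⟩
  · rw [e3, ← e2]; exact a2
  · intro hq
    refine h2 ((crossed_of_dart (a := g.snd) (b := g.fst) (e2.trans hq) e3.symm
      (Or.inr ⟨rfl, rfl⟩)).2 h0)
  · intro hq
    refine h1 ((crossed_of_dart (a := (M.θ g).fst) (b := (M.θ g).snd) e1 hq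
      (Or.inl ⟨rfl, rfl⟩)).2 ((M.crossed_θ g).2 h0))

section NoC4

theorem not_isT_opposite (hG : NoFourCycle G)
    {g : G.Dart} (h : M.IsT g) (h' : M.IsT (M.θ (M.θ g))) : False := by
  have hc := h.1
  have hc1 := (M.crossed_θ g).2 hc
  have a1 := h.adj
  have a2 := h'.adj
  rw [fst_θ_θ hc, fst_θ_θ hc1] at a2
  refine hG g.fst (M.θ g).fst (M.θ g).snd g.snd ?_ (M.fst_θ_ne g hc).2 a1
    (adj_fst_snd _) a2.symm (adj_fst_snd _).symm
  have := (M.fst_θ_ne _ hc1).2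
  rw [fst_θ_θ hc] at this
  have h2 := M.fst_θ_ne _ ((M.crossed_θ _).2 hc1)
  rw [fst_θ_θ hc1, M.θ_crossed _ hc] at h2
  exact h2.2.symm

theorem not_isS_isT (hG : NoFourCycle G)
    {g : G.Dart} (h : M.IsS g) (h' : M.IsT (M.θ g)) : False := by
  have hc := h.1
  obtain ⟨q, a1, a2, n1, n2⟩ := h.exists_vertex
  have a3 := h'.adj
  rw [fst_θ_θ hc] at a3
  exact hG g.fst q (M.θ g).fst g.snd (M.fst_θ_ne g hc).1.symm n1 a2.symm a1.symm a3
    (adj_fst_snd _).symm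

theorem not_isT_isS (hG : NoFourCycle G)
    {g : G.Dart} (h : M.IsT g) (h' : M.IsS (M.θ g)) : False := by
  have hc := h.1
  obtain ⟨q, a1, a2, n1, n2⟩ := h'.exists_vertex
  have a3 := h.adj
  rw [fst_θ_θ hc] at a1
  rw [M.θ_crossed g hc] at n2
  exact hG g.fst (M.θ g).fst q g.snd (Ne.symm n2) (M.fst_θ_ne g hc).2 a3 a2.symm a1.symm
    (adj_fst_snd _).symm

end NoC4

/-- The apex of an uncrossed triangular face. -/
theorem IsA.exists_apex {g : G.Dart} (h : M.IsA g) : ∃ c, (M.φ g).fst = g.snd ∧ (M.φ g).snd = c ∧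
    (M.φ (M.φ g)).fst = c ∧ (M.φ (M.φ g)).snd = g.fst := by
  obtain ⟨h0, h1, h2, h3⟩ := h
  have e1 := M.fst_φ_uncrossed h0
  have e2 := M.fst_φ_uncrossed h1
  have e3 := M.fst_φ_uncrossed h2
  rw [h3] at e3
  exact ⟨_, e1, rfl, e2, e3.symm⟩

/-- The apex of the triangle formed at a crossing with two neighbouring triangular faces. -/
theorem IsTT.exists_apex {g : G.Dart} (h : M.IsTT (M.φ g)) (hg : ¬ M.crossed g) :
    (M.φ g).fst = g.snd ∧ (M.θ (M.φ g)).fst = g.fst ∧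
    ∃ c, G.Adj g.fst c ∧ G.Adj g.snd c ∧
      (((M.φ g).snd = c ∧ ∃ d : G.Dart, d.fst = g.fst ∧ d.snd = c ∧ ¬ M.crossed d) ∨
        ((M.θ (M.φ g)).snd = c ∧ ∃ d : G.Dart, d.fst = g.snd ∧ d.snd = c ∧ ¬ M.crossed d)) := by
  obtain ⟨h0, hT⟩ := h
  have hgg : M.φ (M.φ g) = g := M.φ.injective h0.2.2
  have e1 := M.fst_φ_uncrossed hg
  have e2 : (M.θ (M.φ g)).fst = g.fst := by rw [← M.fst_φ, hgg]
  refine ⟨e1, e2, ?_⟩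
  rcases hT with hT | hT
  · refine ⟨(M.φ g).snd, ?_, ?_, Or.inl ⟨rfl, ?_⟩⟩
    · have := hT.adj
      rwa [e2, fst_θ_θ h0.1] at this
    · have := adj_fst_snd (M.φ g)
      rwa [e1] at this
    · refine ⟨(M.φ (M.θ (M.φ g))).symm, ?_, ?_, ?_⟩
      · have := M.fst_φ_uncrossed hT.2.1
        rw [hT.2.2, e2] at this
        exact this.symm
      · change (M.φ (M.θ (M.φ g))).fst = _
        rw [M.fst_φ, fst_θ_θ h0.1]
      · rw [M.crossed_symm]; exact hT.2.1
  · have h4 := M.θ_pow_four (M.φ g)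
    have hc1 := (M.crossed_θ _).2 h0.1
    refine ⟨(M.θ (M.φ g)).snd, ?_, ?_, Or.inr ⟨rfl, ?_⟩⟩
    · have := adj_fst_snd (M.θ (M.φ g))
      rwa [e2] at this
    · have := hT.adj
      rw [h4, e1, fst_θ_θ hc1] at this
      exact this.symm
    · refine ⟨(M.φ (M.θ (M.θ (M.θ (M.φ g))))), ?_, ?_, hT.2.1⟩
      · rw [M.fst_φ, h4, e1]
      · have := M.fst_φ_uncrossed hT.2.1
        rw [hT.2.2, fst_θ_θ hc1] at this
        exact this.symm

end OnePlaneMap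

namespace OnePlaneMap

open PlanarHypermap

variable {V : Type*} [Fintype V] [DecidableEq V] {G : SimpleGraph V} [DecidableRel G.Adj]
  (M : OnePlaneMap G)

/-- The sum of a chain around the uncrossed edge or the crossing containing a dart. -/
noncomputable def edgeSum (g : G.Dart) : (G.Dart → ZMod 2) →ₗ[ZMod 2] ZMod 2 :=
  open Classical in
  if M.crossed g then LinearMap.proj (R := ZMod 2) (φ := fun _ : G.Dart => ZMod 2) g +
    LinearMap.proj (R := ZMod 2) (φ := fun _ : G.Dart => ZMod 2) (M.θ g) +
    LinearMap.proj (R := ZMod 2) (φ := fun _ : G.Dart => ZMod 2) (M.θ (M.θ g)) +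
    LinearMap.proj (R := ZMod 2) (φ := fun _ : G.Dart => ZMod 2) (M.θ (M.θ (M.θ g)))
  else LinearMap.proj (R := ZMod 2) (φ := fun _ : G.Dart => ZMod 2) g +
    LinearMap.proj (R := ZMod 2) (φ := fun _ : G.Dart => ZMod 2) (M.θ g)

theorem edgeSum_θ (g : G.Dart) (c : G.Dart → ZMod 2) :
    M.edgeSum (M.θ g) c = M.edgeSum g c := by
  by_cases h : M.crossed g
  · have h' := (M.crossed_θ g).2 h
    simp only [edgeSum, if_pos h, if_pos h', LinearMap.add_apply, LinearMap.proj_apply,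
      M.θ_pow_four]
    ring
  · have h' := (M.crossed_θ g).not.2 h
    simp only [edgeSum, if_neg h, if_neg h', LinearMap.add_apply, LinearMap.proj_apply]
    rw [M.θ_uncrossed _ h', M.θ_uncrossed _ h, SimpleGraph.Dart.symm_symm, add_comm]

theorem card_darts_le (W : Finset V) (hW : ∀ g : G.Dart, g.fst ∈ W) :
    Fintype.card G.Dart ≤ W.card + Nat.card (Quotient (Equiv.Perm.SameCycle.setoid M.θ))
      + Nat.card (Quotient (Equiv.Perm.SameCycle.setoid M.φ)) := by
  classical
  have key := card_le_card_constraints_add_card_faces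
    (A := W ⊕ Quotient (Equiv.Perm.SameCycle.setoid M.θ))
    (Sum.elim
      (fun v => ∑ g : G.Dart with g.fst = (v : V),
        LinearMap.proj (R := ZMod 2) (φ := fun _ : G.Dart => ZMod 2) g)
      (fun q => M.edgeSum q.out)) M.φ M.ρ ?_
  · rw [Fintype.card_sum, Fintype.card_coe, ← Nat.card_eq_fintype_card
      (α := Quotient (Equiv.Perm.SameCycle.setoid M.θ))] at key
    exact key
  intro c hc
  have hs : ∀ g, M.edgeSum g c = 0 := by
    intro g
    have h1 := hc (Sum.inr (Quotient.mk _ g))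
    simp only [Sum.elim_inr] at h1
    have h2 : Equiv.Perm.SameCycle M.θ
        (Quotient.mk (Equiv.Perm.SameCycle.setoid M.θ) g).out g :=
      Quotient.mk_out (s := Equiv.Perm.SameCycle.setoid M.θ) g
    obtain ⟨i, -, hi⟩ := h2.exists_pow_eq'
    rw [← hi]
    clear hi h2
    induction i with
    | zero => simpa using h1
    | succ i ih => rw [pow_succ', Equiv.Perm.mul_apply, edgeSum_θ]; exact ih
  have hv : ∀ v, ∑ g : G.Dart with g.fst = v, c g = 0 := by
    intro v
    by_cases hv : v ∈ W
    · simpa using hc (Sum.inl ⟨v, hv⟩)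
    · rw [Finset.filter_false_of_mem, Finset.sum_empty]
      rintro g _ rfl
      exact hv (hW g)
  obtain ⟨w, hw⟩ := M.planar c hv (fun g hg => by simpa [edgeSum, hg] using hs g)
    fun g hg => by simpa [edgeSum, hg] using hs g
  refine ⟨fun g => w g + c g, fun g => ?_⟩
  have h1 := (hw g).1
  have h2 := (hw (M.θ g)).2
  have h3 := (hw g).2
  have two : ∀ x : ZMod 2, x + x = 0 := CharTwo.add_self_eq_zero
  constructor
  · change w (M.ρ (M.θ g)) + c (M.ρ (M.θ g)) = w g + c g
    rw [h2, h1, add_assoc, two, add_zero]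
  · change c g = w g + c g + (w (M.ρ g) + c (M.ρ g))
    linear_combination -h3 - two (w g) - two (c (M.ρ g))

end OnePlaneMap

namespace OnePlaneMap

open PlanarHypermap

theorem eq_apex {V : Type*} {G : SimpleGraph V} (hG : NoFourCycle G) {a b c c' : V}
    (hab : a ≠ b) (h1 : G.Adj a c) (h2 : G.Adj b c)
    (h1' : G.Adj a c') (h2' : G.Adj b c') : c = c' := by
  by_contra hne
  exact hG a c b c' hab hne h1 h2.symm h2' h1'.symm

section NoC4

variable {V : Type*} [Fintype V] [DecidableEq V] {G : SimpleGraph V} [DecidableRel G.Adj]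
  {M : OnePlaneMap G}

theorem IsA.uncrossed_symm {g : G.Dart} (h : M.IsA g.symm) : ¬ M.crossed g := by
  rw [← M.crossed_symm]; exact h.1

theorem IsT.uncrossed {g : G.Dart} (h : M.IsT (M.φ g)) : M.φ (M.φ g) = g ∧ ¬ M.crossed g := by
  have : M.φ (M.φ g) = g := M.φ.injective h.2.2
  exact ⟨this, this ▸ h.2.1⟩

theorem IsS.uncrossed {g : G.Dart} (h : M.IsS (M.φ g)) :
    M.φ (M.φ (M.φ g)) = g ∧ ¬ M.crossed g := by
  have : M.φ (M.φ (M.φ g)) = g := M.φ.injective h.2.2.2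
  exact ⟨this, this ▸ h.2.2.1⟩

theorem IsS.uncrossed' {g : G.Dart} (h : M.IsS (M.φ (M.φ g))) :
    ¬ M.crossed g ∧ ¬ M.crossed (M.φ g) := by
  have := IsS.uncrossed h
  exact ⟨M.φ.injective this.1 ▸ h.2.1, this.2⟩

theorem not_isA_isA_symm (hG : NoFourCycle G)
    {g : G.Dart} (h : M.IsA g) (h' : M.IsA g.symm) : False := by
  obtain ⟨c, a1, a2, a3, a4⟩ := h.exists_apex
  obtain ⟨c', b1, b2, b3, b4⟩ := h'.exists_apex
  have e1 := adj_fst_snd (M.φ g)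
  have e2 := adj_fst_snd (M.φ (M.φ g))
  have e3 := adj_fst_snd (M.φ g.symm)
  have e4 := adj_fst_snd (M.φ (M.φ g.symm))
  rw [a1, a2] at e1
  rw [a3, a4] at e2
  rw [b1, b2] at e3
  rw [b3, b4] at e4
  have hcc : c = c' := eq_apex hG (a := g.fst) (b := g.snd) g.fst_ne_snd e2.symm e1 e3 e4.symm
  subst hcc
  have k1 : M.φ g.symm = M.ρ g := by
    rw [M.φ_apply, M.θ_uncrossed _ h'.1, SimpleGraph.Dart.symm_symm]
  have k2 : (M.φ (M.φ g)).symm = M.φ g.symm :=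
    SimpleGraph.Dart.ext _ _ (Prod.ext (a4.trans b1.symm) (a3.trans b2.symm))
  apply M.ρ_ρ_ne g
  rw [← k1, ← k2, ← M.θ_uncrossed _ h.2.2.1, ← M.φ_apply, h.2.2.2]

theorem not_isA_isTT_symm (hG : NoFourCycle G)
    {g : G.Dart} (h : M.IsA g) (h' : M.IsTT (M.φ g.symm)) : False := by
  obtain ⟨c, a1, a2, a3, a4⟩ := h.exists_apex
  have hg : ¬ M.crossed g.symm := by rw [M.crossed_symm]; exact h.1
  obtain ⟨b1, b2, c', k1, k2, k3⟩ := h'.exists_apex hg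
  have e1 := adj_fst_snd (M.φ g)
  have e2 := adj_fst_snd (M.φ (M.φ g))
  rw [a1, a2] at e1
  rw [a3, a4] at e2
  have hcc : c = c' := eq_apex hG (a := g.fst) (b := g.snd) g.fst_ne_snd e2.symm e1 k2 k1
  subst hcc
  rcases k3 with ⟨k3, _⟩ | ⟨k3, _⟩
  · exact h.2.2.1 ((crossed_of_dart b1 k3 (Or.inr ⟨a3, a4⟩)).1 h'.1.1)
  · exact h.2.1 ((crossed_of_dart b2 k3 (Or.inl ⟨a1, a2⟩)).1 ((M.crossed_θ _).2 h'.1.1))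

theorem not_isTT_isTT_symm (hG : NoFourCycle G)
    {g : G.Dart} (h : M.IsTT (M.φ g)) (h' : M.IsTT (M.φ g.symm)) :
    False := by
  have hg := h.1.uncrossed.2
  have hg' := h'.1.uncrossed.2
  obtain ⟨a1, a2, c, k1, k2, k3⟩ := h.exists_apex hg
  obtain ⟨b1, b2, c', l1, l2, l3⟩ := h'.exists_apex hg'
  have hcc : c = c' := eq_apex hG (a := g.fst) (b := g.snd) g.fst_ne_snd k1 k2 l2 l1
  subst hcc
  have x1 := h.1.1
  have x2 := h'.1.1
  have y1 := (M.crossed_θ _).2 x1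
  have y2 := (M.crossed_θ _).2 x2
  rcases k3 with ⟨k3, d, d1, d2, d3⟩ | ⟨k3, d, d1, d2, d3⟩ <;>
    rcases l3 with ⟨l3, d', d1', d2', d3'⟩ | ⟨l3, d', d1', d2', d3'⟩
  · exact d3 ((crossed_of_dart b1 l3 (Or.inl ⟨d1, d2⟩)).1 x2)
  · have : M.θ (M.φ g.symm) = M.φ g :=
      SimpleGraph.Dart.ext _ _ (Prod.ext (b2.trans a1.symm) (l3.trans k3.symm))
    rw [← this, M.θ_crossed _ x2] at a2
    exact (M.φ g.symm).snd_ne_fst (a2.trans b1.symm)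
  · have : M.θ (M.φ g) = M.φ g.symm :=
      SimpleGraph.Dart.ext _ _ (Prod.ext (a2.trans b1.symm) (k3.trans l3.symm))
    rw [← this, M.θ_crossed _ x1] at b2
    exact (M.φ g).snd_ne_fst (b2.trans a1.symm)
  · exact d3 ((crossed_of_dart b2 l3 (Or.inl ⟨d1, d2⟩)).1 y2)

end NoC4

section Counting

variable {V : Type*} [Fintype V] [DecidableEq V] {G : SimpleGraph V} [DecidableRel G.Adj]
  (M : OnePlaneMap G)

/-- The rational-valued indicator of a proposition. -/
noncomputable def ind (p : Prop) : ℚ := open Classical in if p then 1 else 0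

theorem ind_pos {p : Prop} (h : p) : ind p = 1 := if_pos h

theorem ind_neg {p : Prop} (h : ¬ p) : ind p = 0 := if_neg h

theorem ind_nonneg (p : Prop) : 0 ≤ ind p := by unfold ind; split_ifs <;> norm_num

theorem ind_eq (p : Prop) : p ∧ ind p = 1 ∨ ¬ p ∧ ind p = 0 := by
  by_cases h : p
  · exact Or.inl ⟨h, ind_pos h⟩
  · exact Or.inr ⟨h, ind_neg h⟩

theorem ind_add_le {p q : Prop} (h : p → q → False) : ind p + ind q ≤ 1 := by
  rcases ind_eq p with ⟨h1, e1⟩ | ⟨h1, e1⟩ <;> rcases ind_eq q with ⟨h2, e2⟩ | ⟨h2, e2⟩ <;>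
    first | exact (h h1 h2).elim | (rw [e1, e2]; norm_num)

theorem ind_add_add_add_le {c p q r s : Prop} (hp : p → ¬ c) (hq : q → ¬ c) (hr : r → ¬ c)
    (hs : s → ¬ c) (hpq : p → q → False) (hpr : p → r → False) (hps : p → s → False)
    (hqr : q → r → False) (hqs : q → s → False) (hrs : r → s → False) :
    ind p + ind q + ind r + ind s ≤ 1 - ind c := by
  by_cases h : c
  · rw [ind_pos h, ind_neg fun x => hp x h, ind_neg fun x => hq x h, ind_neg fun x => hr x h,
      ind_neg fun x => hs x h]
    norm_num
  rw [ind_neg h]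
  by_cases p
  · rw [ind_pos ‹p›, ind_neg (hpq ‹p›), ind_neg (hpr ‹p›), ind_neg (hps ‹p›)]
    norm_num
  by_cases q
  · rw [ind_pos ‹q›, ind_neg ‹¬ p›, ind_neg (hqr ‹q›), ind_neg (hqs ‹q›)]
    norm_num
  rw [ind_neg ‹¬ p›, ind_neg ‹¬ q›]
  linarith [ind_add_le hrs]

theorem card_θ_orbits_le : (Nat.card (Quotient (Equiv.Perm.SameCycle.setoid M.θ)) : ℚ) ≤
    ∑ g, (1 / 2 - ind (M.crossed g) / 4) := by
  refine card_cycles_le_sum _ _ (fun g => ?_) fun g => ?_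
  · rcases ind_eq (M.crossed g) with ⟨_, e⟩ | ⟨_, e⟩ <;> rw [e] <;> norm_num
  by_cases hc : M.crossed g
  · refine ⟨4, fun i h0 h4 => ?_, ?_⟩
    · have hc1 := (M.crossed_θ _).2 hc
      have hc2 := (M.crossed_θ _).2 hc1
      interval_cases i
      · intro h
        exact (M.fst_θ_ne g hc).1 (congrArg (fun d : G.Dart => d.fst) h)
      · intro h
        have : M.θ (M.θ g) = g := h
        rw [M.θ_crossed g hc] at this
        exact g.symm_ne this
      · intro h
        have : M.θ (M.θ (M.θ g)) = g := h
        have h2 := M.θ_pow_four g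
        rw [this] at h2
        exact (M.fst_θ_ne g hc).1 (congrArg (fun d : G.Dart => d.fst) h2)
    · have : ∀ i : ℕ, ind (M.crossed ((M.θ ^ i) g)) = 1 := by
        intro i
        refine ind_pos ?_
        induction i with
        | zero => exact hc
        | succ i ih => rw [pow_succ', Equiv.Perm.mul_apply, M.crossed_θ]; exact ih
      simp only [this]
      norm_num
  · refine ⟨2, fun i h0 h2 => ?_, ?_⟩
    · interval_cases i
      intro h
      have : M.θ g = g := h
      rw [M.θ_uncrossed g hc] at this
      exact g.symm_ne this
    · rw [Finset.sum_range_succ, Finset.sum_range_one, ind_neg, ind_neg]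
      · norm_num
      · exact (M.crossed_θ g).not.2 hc
      · exact hc

/-- The weight of a dart in the count of faces. -/
noncomputable def faceWeight (g : G.Dart) : ℚ :=
  (1 + ind (M.crossed g) + 2 / 3 * ind (M.IsA g) + 2 * ind (M.IsT g) + ind (M.IsS g)
    + 1 / 2 * ind (M.IsQ g)) / 5

theorem faceWeight_ge (g : G.Dart) : (1 + ind (M.crossed g)) / 5 ≤ M.faceWeight g := by
  have h1 := ind_nonneg (M.IsA g)
  have h2 := ind_nonneg (M.IsT g)
  have h3 := ind_nonneg (M.IsS g)
  have h4 := ind_nonneg (M.IsQ g)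
  unfold faceWeight
  linarith

theorem faceWeight_isA {g : G.Dart} (h : M.IsA g) : 1 / 3 ≤ M.faceWeight g := by
  have h0 := ind_nonneg (M.crossed g)
  have h2 := ind_nonneg (M.IsT g)
  have h3 := ind_nonneg (M.IsS g)
  have h4 := ind_nonneg (M.IsQ g)
  unfold faceWeight
  rw [ind_pos h]
  linarith

theorem faceWeight_isT {g : G.Dart} (h : M.IsT g) : 4 / 5 ≤ M.faceWeight g := by
  have h2 := ind_nonneg (M.IsA g)
  have h3 := ind_nonneg (M.IsS g)
  have h4 := ind_nonneg (M.IsQ g)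
  unfold faceWeight
  rw [ind_pos h, ind_pos h.1]
  linarith

theorem faceWeight_isS {g : G.Dart} (h : M.IsS g) : 3 / 5 ≤ M.faceWeight g := by
  have h2 := ind_nonneg (M.IsA g)
  have h3 := ind_nonneg (M.IsT g)
  have h4 := ind_nonneg (M.IsQ g)
  unfold faceWeight
  rw [ind_pos h, ind_pos h.1]
  linarith

theorem faceWeight_isQ {g : G.Dart} (h : M.IsQ g) : 1 / 2 ≤ M.faceWeight g := by
  have h2 := ind_nonneg (M.IsA g)
  have h3 := ind_nonneg (M.IsT g)
  have h4 := ind_nonneg (M.IsS g)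
  unfold faceWeight
  rw [ind_pos h, ind_pos h.1]
  linarith

theorem exists_crossed_of_φ_pow_four (hG : NoFourCycle G) {g : G.Dart}
    (h : M.φ (M.φ (M.φ (M.φ g))) = g) : M.crossed g ∨ M.crossed (M.φ g) ∨
      M.crossed (M.φ (M.φ g)) ∨ M.crossed (M.φ (M.φ (M.φ g))) := by
  by_contra! hc
  obtain ⟨h0, h1, h2, h3⟩ := hc
  have e1 := M.fst_φ_uncrossed h0
  have e2 := M.fst_φ_uncrossed h1
  have e3 := M.fst_φ_uncrossed h2
  have e4 := M.fst_φ_uncrossed h3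
  have n1 := M.snd_φ_ne h0
  have n2 := M.snd_φ_ne h1
  have a0 := adj_fst_snd g
  have a1 := adj_fst_snd (M.φ g)
  have a2 := adj_fst_snd (M.φ (M.φ g))
  have a3 := adj_fst_snd (M.φ (M.φ (M.φ g)))
  rw [h] at e4
  rw [← e2] at n1 a1
  rw [← e3] at n2 a2
  rw [← e1] at a0
  rw [← e4] at a3
  exact hG _ _ _ _ n1.symm n2.symm a0 a1 a2 a3

theorem card_faces_le (hG : NoFourCycle G) :
    (Nat.card (Quotient (Equiv.Perm.SameCycle.setoid M.φ)) : ℚ) ≤ ∑ g, M.faceWeight g := by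
  have hbase : ∀ g, 1 / 5 ≤ M.faceWeight g := fun g => by
    have h1 := M.faceWeight_ge g
    have h2 := ind_nonneg (M.crossed g)
    linarith
  have hcr : ∀ g, M.crossed g → 2 / 5 ≤ M.faceWeight g := fun g h => by
    have h1 := M.faceWeight_ge g
    rw [ind_pos h] at h1
    linarith
  refine card_cycles_le_sum _ _ (fun g => (by norm_num : (0 : ℚ) ≤ 1 / 5).trans (hbase g))
    fun g => ?_
  have p1 : ¬ M.φ g = g := M.φ_ne g
  by_cases p2 : M.φ (M.φ g) = g
  · refine ⟨2, fun i h0 h2 => ?_, ?_⟩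
    · interval_cases i
      exact p1
    · rw [Finset.sum_range_succ, Finset.sum_range_one]
      change 1 ≤ M.faceWeight g + M.faceWeight (M.φ g)
      have p2' : M.φ (M.φ (M.φ g)) = M.φ g := by rw [p2]
      by_cases c0 : M.crossed g <;> by_cases c1 : M.crossed (M.φ g)
      · have := M.faceWeight_isQ ⟨c0, c1, p2⟩
        have := M.faceWeight_isQ (g := M.φ g) ⟨c1, by rwa [p2], p2'⟩
        linarith
      · have := M.faceWeight_isT ⟨c0, c1, p2⟩
        have := hbase (M.φ g)
        linarith
      · have := M.faceWeight_isT (g := M.φ g) ⟨c1, by rwa [p2], p2'⟩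
        have := hbase g
        linarith
      · exact ((M.crossed_of_φ_φ p2).elim c0 c1).elim
  by_cases p3 : M.φ (M.φ (M.φ g)) = g
  · refine ⟨3, fun i h0 h2 => ?_, ?_⟩
    · interval_cases i
      · exact p1
      · exact p2
    · rw [Finset.sum_range_succ, Finset.sum_range_succ, Finset.sum_range_one]
      change 1 ≤ M.faceWeight g + M.faceWeight (M.φ g) + M.faceWeight (M.φ (M.φ g))
      have b0 := hbase g
      have b1 := hbase (M.φ g)
      have b2 := hbase (M.φ (M.φ g))
      by_cases c0 : M.crossed g <;> by_cases c1 : M.crossed (M.φ g) <;>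
        by_cases c2 : M.crossed (M.φ (M.φ g))
      · linarith [hcr _ c0, hcr _ c1]
      · linarith [hcr _ c0, hcr _ c1]
      · linarith [hcr _ c0, hcr _ c2]
      · linarith [M.faceWeight_isS ⟨c0, c1, c2, p3⟩]
      · linarith [hcr _ c1, hcr _ c2]
      · linarith [M.faceWeight_isS (g := M.φ g) ⟨c1, c2, by rwa [p3], by rw [p3]⟩]
      · linarith [M.faceWeight_isS (g := M.φ (M.φ g)) ⟨c2, by rwa [p3], by rwa [p3], by rw [p3]⟩]
      · linarith [M.faceWeight_isA ⟨c0, c1, c2, p3⟩,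
          M.faceWeight_isA (g := M.φ g) ⟨c1, c2, by rwa [p3], by rw [p3]⟩,
          M.faceWeight_isA (g := M.φ (M.φ g)) ⟨c2, by rwa [p3], by rwa [p3], by rw [p3]⟩]
  by_cases p4 : M.φ (M.φ (M.φ (M.φ g))) = g
  · refine ⟨4, fun i h0 h2 => ?_, ?_⟩
    · interval_cases i
      · exact p1
      · exact p2
      · exact p3
    · rw [Finset.sum_range_succ, Finset.sum_range_succ, Finset.sum_range_succ,
        Finset.sum_range_one]
      change 1 ≤ M.faceWeight g + M.faceWeight (M.φ g) + M.faceWeight (M.φ (M.φ g)) +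
        M.faceWeight (M.φ (M.φ (M.φ g)))
      have b0 := hbase g
      have b1 := hbase (M.φ g)
      have b2 := hbase (M.φ (M.φ g))
      have b3 := hbase (M.φ (M.φ (M.φ g)))
      rcases M.exists_crossed_of_φ_pow_four hG p4 with c | c | c | c <;>
        linarith [hcr _ c]
  · refine ⟨5, fun i h0 h2 => ?_, ?_⟩
    · interval_cases i
      · exact p1
      · exact p2
      · exact p3
      · exact p4
    · calc (1 : ℚ) = ∑ i ∈ Finset.range 5, (1 / 5 : ℚ) := by norm_num
        _ ≤ _ := Finset.sum_le_sum fun i _ => hbase _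

theorem two_mul_sum_le (hG : NoFourCycle G) :
    2 * ∑ g, ind (M.IsA g) + 2 * ∑ g, ind (M.IsTT g) ≤ ∑ g, (1 - ind (M.crossed g)) := by
  have hs : ∀ f : G.Dart → ℚ, ∑ g : G.Dart, f g.symm = ∑ g, f g := fun f =>
    Equiv.sum_comp (SimpleGraph.Dart.symm_involutive (G := G)).toPerm f
  have h1 : ∑ g : G.Dart, ind (M.IsTT (M.φ g)) = ∑ g, ind (M.IsTT g) :=
    Equiv.sum_comp M.φ fun g => ind (M.IsTT g)
  have h2 : ∑ g : G.Dart, ind (M.IsTT (M.φ g.symm)) = ∑ g, ind (M.IsTT g) :=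
    (hs fun g => ind (M.IsTT (M.φ g))).trans h1
  have h3 : ∑ g : G.Dart, ind (M.IsA g.symm) = ∑ g, ind (M.IsA g) :=
    hs fun g => ind (M.IsA g)
  calc _ = ∑ g : G.Dart, (ind (M.IsA g) + ind (M.IsA g.symm) + ind (M.IsTT (M.φ g)) +
        ind (M.IsTT (M.φ g.symm))) := by
        simp only [Finset.sum_add_distrib, h1, h2, h3]; ring
    _ ≤ _ := Finset.sum_le_sum fun g _ => by
      have x1 : M.IsA g → ¬ M.crossed g := fun h => h.1
      have x2 : M.IsA g.symm → ¬ M.crossed g := fun h => h.uncrossed_symm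
      have x3 : M.IsTT (M.φ g) → ¬ M.crossed g := fun h => h.1.uncrossed.2
      have x4 : M.IsTT (M.φ g.symm) → ¬ M.crossed g := fun h => by
        rw [← M.crossed_symm]; exact h.1.uncrossed.2
      have y1 : M.IsA g → M.IsA g.symm → False := not_isA_isA_symm hG
      have y2 : M.IsA g → M.IsTT (M.φ g) → False := fun h h' => h.2.1 h'.1.1
      have y3 : M.IsA g → M.IsTT (M.φ g.symm) → False := not_isA_isTT_symm hG
      have y4 : M.IsA g.symm → M.IsTT (M.φ g) → False := fun h h' =>
        not_isA_isTT_symm hG h (by simpa using h')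
      have y5 : M.IsA g.symm → M.IsTT (M.φ g.symm) → False := fun h h' => h.2.1 h'.1.1
      have y6 : M.IsTT (M.φ g) → M.IsTT (M.φ g.symm) → False := not_isTT_isTT_symm hG
      exact ind_add_add_add_le x1 x2 x3 x4 y1 y2 y3 y4 y5 y6

theorem sum_add_sum_add_two_mul_sum_le :
    ∑ g, ind (M.IsA g) + ∑ g, ind (M.IsT g) + 2 * ∑ g, ind (M.IsS g) ≤
      ∑ g, (1 - ind (M.crossed g)) := by
  have h1 : ∑ g : G.Dart, ind (M.IsT (M.φ g)) = ∑ g, ind (M.IsT g) :=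
    Equiv.sum_comp M.φ fun g => ind (M.IsT g)
  have h2 : ∑ g : G.Dart, ind (M.IsS (M.φ g)) = ∑ g, ind (M.IsS g) :=
    Equiv.sum_comp M.φ fun g => ind (M.IsS g)
  have h3 : ∑ g : G.Dart, ind (M.IsS (M.φ (M.φ g))) = ∑ g, ind (M.IsS g) :=
    (Equiv.sum_comp M.φ fun g => ind (M.IsS (M.φ g))).trans h2
  calc _ = ∑ g : G.Dart, (ind (M.IsA g) + ind (M.IsT (M.φ g)) + ind (M.IsS (M.φ g)) +
        ind (M.IsS (M.φ (M.φ g)))) := by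
        simp only [Finset.sum_add_distrib, h1, h2, h3]; ring
    _ ≤ _ := Finset.sum_le_sum fun g _ => by
      refine ind_add_add_add_le (fun h => h.1) (fun h => h.uncrossed.2) (fun h => h.uncrossed.2)
        (fun h => h.uncrossed'.1) (fun h h' => h.2.1 h'.1) (fun h h' => h.2.1 h'.1)
        (fun h h' => h.2.2.1 h'.1) (fun h h' => ?_) (fun h h' => h'.uncrossed'.2 h.1)
        fun h h' => h'.uncrossed'.2 h.1
      have h2 := h'.uncrossed.1
      rw [h.uncrossed.1] at h2
      exact M.φ_ne g h2

/-- The combined weight of the small faces at a crossing. -/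
noncomputable def crossingWeight (g : G.Dart) : ℚ :=
  71 * ind (M.IsT g) - 19 * ind (M.IsTT g) + 25 * ind (M.IsS g) + 39 / 2 * ind (M.IsQ g)

theorem crossingWeight_sum_le (hG : NoFourCycle G) (g : G.Dart) :
    M.crossingWeight g + M.crossingWeight (M.θ g) + M.crossingWeight (M.θ (M.θ g)) +
      M.crossingWeight (M.θ (M.θ (M.θ g))) ≤ 147 * ind (M.crossed g) := by
  have hbound : ∀ g, ind (M.IsT g) + ind (M.IsS g) + ind (M.IsQ g) ≤ ind (M.crossed g) := by
    intro g
    have x1 : M.IsT g → M.crossed g ∧ ¬ M.crossed (M.φ g) ∧ M.φ (M.φ g) = g := id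
    have x2 : M.IsS g → M.crossed g ∧ ¬ M.crossed (M.φ g) ∧ M.φ (M.φ g) ≠ g := fun h =>
      ⟨h.1, h.2.1, fun he => h.2.2.1 (he.symm ▸ h.1)⟩
    have x3 : M.IsQ g → M.crossed g ∧ M.crossed (M.φ g) := fun h => ⟨h.1, h.2.1⟩
    rcases ind_eq (M.crossed g) with ⟨c0, e0⟩ | ⟨c0, e0⟩ <;>
    rcases ind_eq (M.IsT g) with ⟨c1, e1⟩ | ⟨c1, e1⟩ <;>
    rcases ind_eq (M.IsS g) with ⟨c2, e2⟩ | ⟨c2, e2⟩ <;>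
    rcases ind_eq (M.IsQ g) with ⟨c3, e3⟩ | ⟨c3, e3⟩ <;>
    first
      | (rw [e0, e1, e2, e3]; norm_num; done)
      | (exfalso; tauto)
  have hTT : ∀ g, M.IsT g → M.IsT (M.θ g) → ind (M.IsTT g) = 1 ∧ ind (M.IsTT (M.θ g)) = 1 := by
    intro g h h'
    exact ⟨ind_pos ⟨h, Or.inl h'⟩, ind_pos ⟨h', Or.inr (by rwa [M.θ_pow_four])⟩⟩
  have h4 := M.θ_pow_four g
  set g1 := M.θ g with hg1
  set g2 := M.θ g1 with hg2
  set g3 := M.θ g2 with hg3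
  have c1 : ind (M.crossed g1) = ind (M.crossed g) := by rw [hg1, M.crossed_θ]
  have c2 : ind (M.crossed g2) = ind (M.crossed g) := by rw [hg2, M.crossed_θ, c1]
  have c3 : ind (M.crossed g3) = ind (M.crossed g) := by rw [hg3, M.crossed_θ, c2]
  have b0 := hbound g
  have b1 := hbound g1
  have b2 := hbound g2
  have b3 := hbound g3
  rw [c1] at b1
  rw [c2] at b2
  rw [c3] at b3
  have t01 := hTT g
  have t12 := hTT g1
  have t23 := hTT g2
  have t30 := hTT g3
  rw [← hg1] at t01
  rw [← hg2] at t12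
  rw [← hg3] at t23
  rw [h4] at t30
  have s01 : ind (M.IsS g) + ind (M.IsT g1) ≤ 1 := ind_add_le (not_isS_isT hG)
  have s12 : ind (M.IsS g1) + ind (M.IsT g2) ≤ 1 := ind_add_le (not_isS_isT hG)
  have s23 : ind (M.IsS g2) + ind (M.IsT g3) ≤ 1 := ind_add_le (not_isS_isT hG)
  have s30 : ind (M.IsS g3) + ind (M.IsT g) ≤ 1 :=
    ind_add_le fun h h' => not_isS_isT hG h (h4.symm ▸ h')
  have r01 : ind (M.IsT g) + ind (M.IsS g1) ≤ 1 := ind_add_le (not_isT_isS hG)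
  have r12 : ind (M.IsT g1) + ind (M.IsS g2) ≤ 1 := ind_add_le (not_isT_isS hG)
  have r23 : ind (M.IsT g2) + ind (M.IsS g3) ≤ 1 := ind_add_le (not_isT_isS hG)
  have r30 : ind (M.IsT g3) + ind (M.IsS g) ≤ 1 :=
    ind_add_le fun h h' => not_isT_isS hG h (h4.symm ▸ h')
  have o02 : M.IsT g → M.IsT g2 → False := not_isT_opposite hG
  have o13 : M.IsT g1 → M.IsT g3 → False := not_isT_opposite hG
  have n (g) := ind_nonneg (M.IsS g)
  have m (g) := ind_nonneg (M.IsQ g)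
  have l (g) := ind_nonneg (M.IsTT g)
  have n0 := n g
  have n1 := n g1
  have n2 := n g2
  have n3 := n g3
  have m0 := m g
  have m1 := m g1
  have m2 := m g2
  have m3 := m g3
  have l0 := l g
  have l1 := l g1
  have l2 := l g2
  have l3 := l g3
  have hone : ind (M.crossed g) = 1 ∨ ind (M.crossed g) = 0 := by
    rcases ind_eq (M.crossed g) with h | h
    · exact Or.inl h.2
    · exact Or.inr h.2
  unfold crossingWeight
  clear hbound hTT
  rcases ind_eq (M.IsT g) with ⟨p0, e0⟩ | ⟨p0, e0⟩ <;>
  rcases ind_eq (M.IsT g1) with ⟨p1, e1⟩ | ⟨p1, e1⟩ <;>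
  rcases ind_eq (M.IsT g2) with ⟨p2, e2⟩ | ⟨p2, e2⟩ <;>
  rcases ind_eq (M.IsT g3) with ⟨p3, e3⟩ | ⟨p3, e3⟩ <;>
  first
    | exact (o02 p0 p2).elim
    | exact (o13 p1 p3).elim
    | (have t := t01 p0 p1; rcases hone with h | h <;> linarith [t.1, t.2])
    | (have t := t12 p1 p2; rcases hone with h | h <;> linarith [t.1, t.2])
    | (have t := t23 p2 p3; rcases hone with h | h <;> linarith [t.1, t.2])
    | (have t := t30 p3 p0; rcases hone with h | h <;> linarith [t.1, t.2])
    | (rcases hone with h | h <;> linarith)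

theorem four_mul_sum_crossingWeight_le (hG : NoFourCycle G) :
    4 * ∑ g, M.crossingWeight g ≤ 147 * ∑ g, ind (M.crossed g) := by
  have hs : ∀ f : G.Dart → ℚ, ∑ g : G.Dart, f (M.θ g) = ∑ g, f g := fun f =>
    Equiv.sum_comp M.θ f
  have h1 := hs M.crossingWeight
  have h2 := (hs fun g => M.crossingWeight (M.θ g)).trans h1
  have h3 := (hs fun g => M.crossingWeight (M.θ (M.θ g))).trans h2
  have := Finset.sum_le_sum (s := Finset.univ) fun g (_ : g ∈ Finset.univ) =>
    M.crossingWeight_sum_le hG g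
  rw [← Finset.mul_sum] at this
  simp only [Finset.sum_add_distrib, h1, h2, h3] at this
  linarith

/-- The key linear inequality for drawings in which every edge is crossed at most once. -/
theorem card_dart_bound (hG : NoFourCycle G) (W : Finset V) (hW : ∀ g : G.Dart, g.fst ∈ W) :
    28 * (Fintype.card G.Dart : ℚ) ≤ 130 * W.card + 7 * ∑ g, ind (M.crossed g) := by
  have h0 : (Fintype.card G.Dart : ℚ) ≤ W.card +
      Nat.card (Quotient (Equiv.Perm.SameCycle.setoid M.θ))
      + Nat.card (Quotient (Equiv.Perm.SameCycle.setoid M.φ)) := by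
    exact_mod_cast M.card_darts_le W hW
  have h1 := M.card_θ_orbits_le
  have h2 := M.card_faces_le hG
  have h3 := M.two_mul_sum_le hG
  have h4 := M.sum_add_sum_add_two_mul_sum_le
  have h5 := M.four_mul_sum_crossingWeight_le hG
  simp only [faceWeight, crossingWeight, Finset.sum_add_distrib, Finset.sum_sub_distrib,
    ← Finset.sum_div, ← Finset.mul_sum, Finset.sum_const, Finset.card_univ, nsmul_eq_mul,
    mul_one] at h1 h2 h3 h4 h5
  linarith

end Counting

end OnePlaneMap

namespace PlanarHypermap

section FirstReturn

variable {E : Type*}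

theorem exists_pow_eq_of_sameCycle (κ : Equiv.Perm E) {x y : E} {p : ℕ} (hp : 0 < p)
    (hx : (κ ^ p) x = x) (h : κ.SameCycle x y) : ∃ n : ℕ, (κ ^ n) x = y := by
  obtain ⟨z, rfl⟩ := h
  have hp' : (p : ℤ) ≠ 0 := by exact_mod_cast hp.ne'
  refine ⟨(z % p).toNat, ?_⟩
  have h1 : ((z % p).toNat : ℤ) = z % p := Int.toNat_of_nonneg (Int.emod_nonneg _ hp')
  rw [← zpow_natCast, h1]
  conv_rhs => rw [← Int.emod_add_mul_ediv z p]
  rw [zpow_add, Equiv.Perm.mul_apply, zpow_mul, zpow_natCast,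
    Equiv.Perm.zpow_apply_eq_self_of_apply_eq_self hx]

/-- The first return map of a permutation to the image of an injective map. -/
theorem exists_firstReturn {D : Type*} [Finite D] (κ : Equiv.Perm E) (f : D → E)
    (hf : Function.Injective f) (hrec : ∀ d, ∃ n : ℕ, 0 < n ∧ (κ ^ n) (f d) = f d) :
    ∃ ρ : Equiv.Perm D, (∀ d, ∃ k : ℕ, 0 < k ∧ (κ ^ k) (f d) = f (ρ d) ∧
      ∀ i, 0 < i → i < k → (κ ^ i) (f d) ∉ Set.range f) ∧
      ∀ d d', κ.SameCycle (f d) (f d') → ρ.SameCycle d d' := by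
  classical
  have hex : ∀ d, ∃ n : ℕ, 0 < n ∧ (κ ^ n) (f d) ∈ Set.range f := fun d =>
    let ⟨n, h1, h2⟩ := hrec d
    ⟨n, h1, d, h2.symm⟩
  have hfr : ∀ d, ∃ (k : ℕ) (d' : D), 0 < k ∧ (κ ^ k) (f d) = f d' ∧
      ∀ i, 0 < i → i < k → (κ ^ i) (f d) ∉ Set.range f := by
    intro d
    obtain ⟨d', hd'⟩ := (Nat.find_spec (hex d)).2
    exact ⟨Nat.find (hex d), d', (Nat.find_spec (hex d)).1, hd'.symm,
      fun i h0 h1 h2 => Nat.find_min (hex d) h1 ⟨h0, h2⟩⟩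
  choose k ρ hk hρ hmin using hfr
  have hle : ∀ d d', ρ d = ρ d' → k d ≤ k d' → d = d' := by
    intro d d' he hkk
    have h1 : (κ ^ (k d' - k d)) (f d') = f d := by
      apply (κ ^ (k d)).injective
      rw [← Equiv.Perm.mul_apply, ← pow_add, Nat.add_sub_cancel' hkk, hρ, hρ, he]
    rcases Nat.eq_zero_or_pos (k d' - k d) with h0 | h0
    · rw [h0] at h1
      exact hf h1.symm
    · exact (hmin d' _ h0 (by have := hk d; omega) ⟨d, h1.symm⟩).elim
  have hinj : Function.Injective ρ := fun d d' he =>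
    (le_total (k d) (k d')).elim (hle d d' he) fun h => (hle d' d he.symm h).symm
  refine ⟨Equiv.ofBijective ρ (Finite.injective_iff_bijective.1 hinj),
    fun d => ⟨k d, hk d, hρ d, hmin d⟩, fun d d' h => ?_⟩
  obtain ⟨p, hp, hpd⟩ := hrec d
  obtain ⟨n, hn⟩ := exists_pow_eq_of_sameCycle κ hp hpd h
  clear h p hp hpd
  induction n using Nat.strong_induction_on generalizing d with
  | _ n ih =>
    rcases Nat.eq_zero_or_pos n with h0 | h0
    · subst h0
      rw [hf hn]
    · have hkn : k d ≤ n := by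
        by_contra! hlt
        exact hmin d n h0 hlt ⟨d', hn.symm⟩
      have h1 : (κ ^ (n - k d)) (f (ρ d)) = f d' := by
        rw [← hρ, ← Equiv.Perm.mul_apply, ← pow_add, Nat.sub_add_cancel hkn, hn]
      have h2 := ih (n - k d) (by have := hk d; omega) (ρ d) h1
      rw [← Equiv.Perm.sameCycle_apply_left]
      exact h2

end FirstReturn

section Contraction

variable {E : Type*}

/-- A possibly infinite planar rotation system in which the edges of `T` have been contracted:
`κ` rotates darts around the contracted vertices, which are labelled by `β`. -/
structure ContractedSystem (E Z : Type*) [DecidableEq Z] (α : Equiv.Perm E) where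
  κ : Equiv.Perm E
  β : E → Z
  T : Set E
  β_κ : ∀ d, β (κ d) = β d
  sameCycle : ∀ d d', β d = β d' → κ.SameCycle d d'
  finite_fiber : ∀ z, {d | β d = z}.Finite
  β_T : ∀ d ∈ T, β (α d) = β d
  planar : ∀ (s : Finset E) (c : E → ZMod 2), (∀ d ∉ s, c d = 0) → (∀ d, c (α d) = c d) →
    (∀ d ∈ T, c d = 0) → (∀ z, ∑ d ∈ s with β d = z, c d = 0) →
    ∃ w : E → ZMod 2, (∀ d ∉ T, w (α d) = w d + c d) ∧ ∀ d, w (κ d) = w d + c (κ d)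

namespace ContractedSystem

variable {Z : Type*} [DecidableEq Z] {α : Equiv.Perm E} (M : ContractedSystem E Z α)

theorem recurrent (d : E) : ∃ n : ℕ, 0 < n ∧ (M.κ ^ n) d = d := by
  have hβ : ∀ n : ℕ, M.β ((M.κ ^ n) d) = M.β d := by
    intro n
    induction n with
    | zero => rfl
    | succ n ih => rw [pow_succ', Equiv.Perm.mul_apply, M.β_κ, ih]
  have hninj : ¬ Function.Injective fun n : ℕ => (M.κ ^ n) d := fun hinj =>
    Set.infinite_range_of_injective hinj ((M.finite_fiber (M.β d)).subset (by
      rintro _ ⟨n, rfl⟩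
      exact hβ n))
  have key : ∀ m n : ℕ, m < n → (M.κ ^ m) d = (M.κ ^ n) d → ∃ n : ℕ, 0 < n ∧ (M.κ ^ n) d = d := by
    intro m n hlt h
    refine ⟨n - m, by omega, ?_⟩
    apply (M.κ ^ m).injective
    rw [← Equiv.Perm.mul_apply, ← pow_add, Nat.add_sub_cancel' hlt.le, h]
  simp only [Function.Injective, not_forall] at hninj
  obtain ⟨m, n, h, hne⟩ := hninj
  rcases lt_or_gt_of_ne hne with hlt | hlt
  · exact key m n hlt h
  · exact key n m hlt h.symm

theorem sameCycle_swap [DecidableEq E] {e e' : E} (h : M.β e ≠ M.β e') :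
    (Equiv.swap e e' * M.κ).SameCycle e e' := by
  classical
  have hex := M.recurrent e
  set p := Nat.find hex
  obtain ⟨hp, hpe⟩ := Nat.find_spec hex
  have hmin : ∀ i, 0 < i → i < p → (M.κ ^ i) e ≠ e := fun i h0 h1 h2 =>
    Nat.find_min hex h1 ⟨h0, h2⟩
  have hβ : ∀ n : ℕ, M.β ((M.κ ^ n) e) = M.β e := by
    intro n
    induction n with
    | zero => rfl
    | succ n ih => rw [pow_succ', Equiv.Perm.mul_apply, M.β_κ, ih]
  have hne : ∀ n : ℕ, (M.κ ^ n) e ≠ e' := fun n hn => h (by rw [← hn, hβ])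
  have hi : ∀ i, i < p → ((Equiv.swap e e' * M.κ) ^ i) e = (M.κ ^ i) e := by
    intro i hi
    induction i with
    | zero => rfl
    | succ i ih =>
      rw [pow_succ', Equiv.Perm.mul_apply, ih (by omega), Equiv.Perm.mul_apply,
        ← Equiv.Perm.mul_apply M.κ, ← pow_succ']
      exact Equiv.swap_apply_of_ne_of_ne (hmin _ (by omega) hi) (hne _)
  refine ⟨p, ?_⟩
  obtain ⟨q, hq⟩ : ∃ q, p = q + 1 := ⟨p - 1, by omega⟩
  rw [zpow_natCast, hq, pow_succ', Equiv.Perm.mul_apply, hi q (by omega), Equiv.Perm.mul_apply,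
    ← Equiv.Perm.mul_apply M.κ, ← pow_succ', ← hq, hpe, Equiv.swap_apply_left]

theorem sameCycle_swap_of_sameCycle [DecidableEq E] {e e' : E} (h : M.β e ≠ M.β e')
    {x y : E} (hxy : M.κ.SameCycle x y) : (Equiv.swap e e' * M.κ).SameCycle x y := by
  have h1 := M.sameCycle_swap h
  have step : ∀ x, (Equiv.swap e e' * M.κ).SameCycle x (M.κ x) := by
    intro x
    rw [← Equiv.Perm.sameCycle_apply_left, Equiv.Perm.mul_apply]
    by_cases he : M.κ x = e
    · rw [he, Equiv.swap_apply_left]; exact h1.symm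
    by_cases he' : M.κ x = e'
    · rw [he', Equiv.swap_apply_right]; exact h1
    rw [Equiv.swap_apply_of_ne_of_ne he he']
  obtain ⟨p, hp, hpx⟩ := M.recurrent x
  obtain ⟨n, rfl⟩ := exists_pow_eq_of_sameCycle _ hp hpx hxy
  clear hxy
  induction n with
  | zero => exact Equiv.Perm.SameCycle.refl _ _
  | succ n ih => rw [pow_succ', Equiv.Perm.mul_apply]; exact ih.trans (step _)

/-- Contracting one more edge. -/
noncomputable def contract (hα : ∀ d, α (α d) = d) (e : E) (h : M.β e ≠ M.β (α e)) :
    ContractedSystem E Z α := by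
  classical
  exact
  { κ := Equiv.swap e (α e) * M.κ
    β := fun d => if M.β d = M.β (α e) then M.β e else M.β d
    T := {d | d ∈ M.T ∨ d = e ∨ d = α e}
    β_κ := by
      intro d
      rw [Equiv.Perm.mul_apply, ← M.β_κ d]
      by_cases he : M.κ d = e
      · rw [he, Equiv.swap_apply_left, if_pos rfl, if_neg h]
      by_cases he' : M.κ d = α e
      · rw [he', Equiv.swap_apply_right, if_pos rfl, if_neg h]
      rw [Equiv.swap_apply_of_ne_of_ne he he']
    sameCycle := by
      have h0 := M.sameCycle_swap h
      have h1 : ∀ d d', M.β d = M.β d' → _ := fun d d' hd =>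
        M.sameCycle_swap_of_sameCycle h (M.sameCycle d d' hd)
      intro d d' hd
      by_cases hc : M.β d = M.β (α e) <;> by_cases hc' : M.β d' = M.β (α e)
      · exact h1 _ _ (hc.trans hc'.symm)
      · simp only [hc, hc', if_true, if_false] at hd
        exact ((h1 _ _ hc).trans h0.symm).trans (h1 _ _ hd)
      · simp only [hc, hc', if_true, if_false] at hd
        exact ((h1 _ _ hd).trans h0).trans (h1 _ _ hc'.symm)
      · simp only [hc, hc', if_false] at hd
        exact h1 _ _ hd
    finite_fiber := by
      intro z
      refine ((M.finite_fiber z).union (M.finite_fiber (M.β (α e)))).subset ?_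
      intro d hd
      by_cases hc : M.β d = M.β (α e)
      · exact Or.inr hc
      · simp only [Set.mem_ofPred_eq, hc, if_false] at hd
        exact Or.inl hd
    β_T := by
      rintro d (hd | rfl | rfl)
      · rw [M.β_T d hd]
      · rw [if_pos rfl, if_neg h]
      · rw [hα, if_pos rfl, if_neg h]
    planar := by
      intro s c hs hcα hcT hsum
      have hne : α e ≠ e := fun he => h (by rw [he])
      have ce : c e = 0 := hcT _ (Or.inr (Or.inl rfl))
      have ce' : c (α e) = 0 := hcT _ (Or.inr (Or.inr rfl))
      set x : ZMod 2 := ∑ d ∈ s with M.β d = M.β e, c d with hx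
      have two : ∀ x : ZMod 2, x + x = 0 := CharTwo.add_self_eq_zero
      -- the two old vertices have equal defects
      have hx' : ∑ d ∈ s with M.β d = M.β (α e), c d = x := by
        have h1 := hsum (M.β e)
        have h2 : s.filter (fun d => (if M.β d = M.β (α e) then M.β e else M.β d) = M.β e) =
            s.filter (fun d => M.β d = M.β e) ∪ s.filter (fun d => M.β d = M.β (α e)) := by
          ext d
          simp only [Finset.mem_filter, Finset.mem_union]
          by_cases hc : M.β d = M.β (α e)
          · simp +contextual [hc]
          · simp [hc]
        rw [h2, Finset.sum_union] at h1
        · linear_combination h1 - two x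
        · rw [Finset.disjoint_filter]
          intro d _ h3 h4
          exact h (h3.symm.trans h4)
      let c' : E → ZMod 2 := fun d => if d = e ∨ d = α e then x else c d
      have c'e : c' e = x := if_pos (Or.inl rfl)
      have c'e' : c' (α e) = x := if_pos (Or.inr rfl)
      have c'n : ∀ d, d ≠ e → d ≠ α e → c' d = c d := fun d h1 h2 => if_neg (by tauto)
      have he : e ∉ M.T := fun ht => h (M.β_T e ht).symm
      have he' : α e ∉ M.T := fun ht => h (by have := M.β_T _ ht; rwa [hα] at this)
      have hs' : ∀ d ∉ insert e (insert (α e) s), c' d = 0 := by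
        intro d hd
        simp only [Finset.mem_insert, not_or] at hd
        rw [c'n d hd.1 hd.2.1, hs d hd.2.2]
      have hcα' : ∀ d, c' (α d) = c' d := by
        intro d
        by_cases h1 : d = e
        · rw [h1, c'e, c'e']
        by_cases h2 : d = α e
        · rw [h2, hα, c'e, c'e']
        rw [c'n d h1 h2, c'n _ (fun h3 => h2 (by rw [← h3, hα]))
          (fun h3 => h1 (α.injective h3)), hcα]
      have hcT' : ∀ d ∈ M.T, c' d = 0 := by
        intro d hd
        rw [c'n d (fun h3 => he (h3 ▸ hd)) (fun h3 => he' (h3 ▸ hd))]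
        exact hcT d (Or.inl hd)
      have hsum' : ∀ z, ∑ d ∈ insert e (insert (α e) s) with M.β d = z, c' d = 0 := by
        intro z
        have key : ∑ d ∈ insert e (insert (α e) s) with M.β d = z, c' d =
            (∑ d ∈ s with M.β d = z, c d) + (if M.β e = z then x else 0)
              + (if M.β (α e) = z then x else 0) := by
          have e1 : ∀ d, c' d = c d + (if d = e then x else 0) + if d = α e then x else 0 := by
            intro d
            by_cases h1 : d = e
            · rw [h1, c'e, ce, if_pos rfl, if_neg hne.symm]; ring
            by_cases h2 : d = α e
            · rw [h2, c'e', ce', if_pos rfl, if_neg hne]; ring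
            rw [c'n d h1 h2, if_neg h1, if_neg h2]; ring
          rw [Finset.sum_congr rfl fun d _ => e1 d, Finset.sum_add_distrib,
            Finset.sum_add_distrib, Finset.sum_ite_eq', Finset.sum_ite_eq']
          congr 1
          · congr 1
            · symm
              apply Finset.sum_subset
              · intro d hd
                simp only [Finset.mem_filter, Finset.mem_insert] at hd ⊢
                exact ⟨Or.inr (Or.inr hd.1), hd.2⟩
              · intro d hd hd'
                simp only [Finset.mem_filter, Finset.mem_insert] at hd hd'
                exact hs d fun h3 => hd' ⟨h3, hd.2⟩
            · simp
          · simp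
        rw [key]
        by_cases h1 : M.β e = z
        · rw [if_pos h1, if_neg (fun h2 => h (h1.trans h2.symm)), ← h1, ← hx, add_zero]
          exact two x
        by_cases h2 : M.β (α e) = z
        · rw [if_neg h1, if_pos h2, ← h2, hx', add_zero]
          exact two x
        rw [if_neg h1, if_neg h2, add_zero, add_zero]
        have h3 := hsum z
        rw [← h3]
        refine Finset.sum_congr ?_ fun _ _ => rfl
        ext d
        simp only [Finset.mem_filter]
        by_cases hc : M.β d = M.β (α e)
        · simp [hc, h1, h2]
        · simp [hc]
      obtain ⟨w, hw1, hw2⟩ := M.planar (insert e (insert (α e) s)) c' hs' hcα' hcT' hsum'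
      refine ⟨w, ?_, ?_⟩
      · intro d hd
        simp only [Set.mem_ofPred_eq, not_or] at hd
        rw [hw1 d hd.1, c'n d hd.2.1 hd.2.2]
      · intro d
        rw [Equiv.Perm.mul_apply]
        by_cases h1 : M.κ d = e
        · have h2 := hw2 d
          have h3 := hw1 e he
          rw [h1, c'e] at h2
          rw [c'e] at h3
          rw [h1, Equiv.swap_apply_left, h3, h2, ce']
          linear_combination two x
        by_cases hαd : M.κ d = α e
        · have h2 := hw2 d
          have h3 := hw1 _ he'
          rw [hαd, c'e'] at h2
          rw [hα, c'e'] at h3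
          rw [hαd, Equiv.swap_apply_right, h3, h2, ce]
          linear_combination two x
        rw [Equiv.swap_apply_of_ne_of_ne h1 hαd, hw2 d, c'n _ h1 hαd] }

/-- All the edges in a finite set can be contracted. -/
theorem exists_contract (hα : ∀ d, α (α d) = d) (F : Finset E) :
    ∃ M' : ContractedSystem E Z α, (∀ d ∈ F, M'.β (α d) = M'.β d) ∧
      (∀ d d', M.β d = M.β d' → M'.β d = M'.β d') ∧
      (∀ d ∈ M'.T, d ∈ M.T ∨ d ∈ F ∨ α d ∈ F) ∧
      ∀ {X : Type} (l : E → X), (∀ d ∈ F, l (α d) = l d) → (∀ d d', M.β d = M.β d' → l d = l d') →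
        ∀ d d', M'.β d = M'.β d' → l d = l d' := by
  classical
  induction F using Finset.induction_on with
  | empty => exact ⟨M, by simp, fun _ _ h => h, by simp, fun l _ h => h⟩
  | insert e F he ih =>
    obtain ⟨M', h1, h2, h3, h4⟩ := ih
    by_cases h : M'.β e = M'.β (α e)
    · refine ⟨M', ?_, h2, fun d hd => ?_, fun l hl => h4 l fun d hd =>
        hl d (Finset.mem_insert_of_mem hd)⟩
      · intro d hd
        rcases Finset.mem_insert.1 hd with rfl | hd
        · exact h.symm
        · exact h1 d hd
      · rcases h3 d hd with h | h | h
        · exact Or.inl h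
        · exact Or.inr (Or.inl (Finset.mem_insert_of_mem h))
        · exact Or.inr (Or.inr (Finset.mem_insert_of_mem h))
    · refine ⟨M'.contract hα e h, ?_, ?_, ?_, ?_⟩
      · intro d hd
        rcases Finset.mem_insert.1 hd with rfl | hd
        · simp [contract, h]
        · simp [contract, h1 d hd]
      · intro d d' hd
        simp [contract, h2 d d' hd]
      · rintro d (hd | rfl | rfl)
        · rcases h3 d hd with h | h | h
          · exact Or.inl h
          · exact Or.inr (Or.inl (Finset.mem_insert_of_mem h))
          · exact Or.inr (Or.inr (Finset.mem_insert_of_mem h))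
        · exact Or.inr (Or.inl (Finset.mem_insert_self _ _))
        · exact Or.inr (Or.inr (by rw [hα]; exact Finset.mem_insert_self _ _))
      · intro X l hl hl'
        have h5 := h4 l (fun d hd => hl d (Finset.mem_insert_of_mem hd)) hl'
        have h6 := hl e (Finset.mem_insert_self _ _)
        intro d d' hd
        change (if M'.β d = M'.β (α e) then M'.β e else M'.β d) =
          if M'.β d' = M'.β (α e) then M'.β e else M'.β d' at hd
        by_cases hc : M'.β d = M'.β (α e) <;> by_cases hc' : M'.β d' = M'.β (α e)
        · exact h5 _ _ (hc.trans hc'.symm)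
        · rw [if_pos hc, if_neg hc'] at hd
          rw [h5 _ _ hc, h6, h5 _ _ hd]
        · rw [if_neg hc, if_pos hc'] at hd
          rw [h5 _ _ hc', h6, h5 _ _ hd]
        · rw [if_neg hc, if_neg hc'] at hd
          exact h5 _ _ hd

end ContractedSystem

end Contraction

section Grid

/-- The four unit vectors of the square grid, in counterclockwise order. -/
def gridDir : Fin 4 → ℤ × ℤ := ![(1, 0), (0, 1), (-1, 0), (0, -1)]

theorem gridDir_add (i : Fin 4) : gridDir i + gridDir (i + 2) = 0 := by
  fin_cases i <;> simp [gridDir]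

/-- Reversal of darts of the square grid. -/
def gridFlip : Equiv.Perm ((ℤ × ℤ) × Fin 4) :=
  Function.Involutive.toPerm (fun d => (d.1 + gridDir d.2, d.2 + 2)) fun d => by
    have h : d.2 + 2 + 2 = d.2 := by omega
    simp only [add_assoc, gridDir_add, add_zero, h]

theorem gridFlip_apply (d : (ℤ × ℤ) × Fin 4) :
    gridFlip d = (d.1 + gridDir d.2, d.2 + 2) := rfl

theorem gridFlip_flip (d : (ℤ × ℤ) × Fin 4) : gridFlip (gridFlip d) = d :=
  (Equiv.symm_apply_apply gridFlip d :)

/-- Counterclockwise rotation of darts of the square grid. -/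
def gridRot : Equiv.Perm ((ℤ × ℤ) × Fin 4) where
  toFun d := (d.1, d.2 + 1)
  invFun d := (d.1, d.2 - 1)
  left_inv d := by simp
  right_inv d := by simp

theorem exists_primitive (f : ℤ → ZMod 2) (L : ℤ) (hf : ∀ i < L, f i = 0) :
    ∃ F : ℤ → ZMod 2, (∀ i, F i = F (i - 1) + f i) ∧ ∀ i < L, F i = 0 := by
  refine ⟨fun i => ∑ t ∈ Finset.Icc L i, f t, fun i => ?_, fun i hi => ?_⟩
  · dsimp only
    by_cases h : i < L
    · rw [Finset.Icc_eq_empty (by omega), Finset.Icc_eq_empty (by omega), hf i h]; simp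
    · have : Finset.Icc L i = insert i (Finset.Icc L (i - 1)) := by
        ext t; simp only [Finset.mem_Icc, Finset.mem_insert]; omega
      rw [this, Finset.sum_insert (by simp), add_comm]
  · dsimp only
    rw [Finset.Icc_eq_empty (by omega), Finset.sum_empty]

theorem eq_zero_of_constant (f : ℤ → ZMod 2) (L : ℤ) (hf : ∀ i < L, f i = 0)
    (h : ∀ i, f i = f (i - 1)) (i : ℤ) : f i = 0 := by
  by_cases hi : i < L
  · exact hf i hi
  · push Not at hi
    refine Int.leInduction (m := L) (motive := fun n _ => f n = 0) ?_ (fun n _ hn => ?_) i hi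
    · rw [h]; exact hf _ (by omega)
    · rw [h]; simpa using hn

theorem grid_planar (s : Finset ((ℤ × ℤ) × Fin 4)) (c : (ℤ × ℤ) × Fin 4 → ZMod 2)
    (hs : ∀ d ∉ s, c d = 0) (hc : ∀ d, c (gridFlip d) = c d)
    (hsum : ∀ z, c (z, 0) + c (z, 1) + c (z, 2) + c (z, 3) = 0) :
    ∃ w : (ℤ × ℤ) × Fin 4 → ZMod 2, (∀ d, w (gridFlip d) = w d + c d) ∧
      ∀ d, w (gridRot d) = w d + c (gridRot d) := by
  have two : ∀ x : ZMod 2, x + x = 0 := CharTwo.add_self_eq_zero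
  obtain ⟨L, hL⟩ : ∃ L : ℤ, ∀ d : (ℤ × ℤ) × Fin 4, d.1.1 < L → c d = 0 := by
    obtain ⟨L, hL⟩ := (s.image fun d => d.1.1).bddBelow
    refine ⟨L, fun d hd => hs d fun hds => ?_⟩
    have : L ≤ d.1.1 := hL (Finset.mem_coe.2 (Finset.mem_image_of_mem _ hds))
    omega
  choose W hW hW0 using fun j : ℤ => exists_primitive (fun i => c ((i, j), 1)) L
    (fun i hi => hL _ hi)
  have c2 : ∀ i j, c ((i, j), 2) = c ((i - 1, j), 0) := by
    intro i j
    have := hc ((i, j), 2)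
    rw [← this, gridFlip_apply]
    simp [gridDir, sub_eq_add_neg]
  have c3 : ∀ i j, c ((i, j), 3) = c ((i, j - 1), 1) := by
    intro i j
    have := hc ((i, j), 3)
    rw [← this, gridFlip_apply]
    simp [gridDir, sub_eq_add_neg]
  have h0 : ∀ j i, c ((i, j), 0) = W j i + W (j - 1) i := by
    intro j i
    have key := eq_zero_of_constant (fun i => c ((i, j), 0) + W j i + W (j - 1) i) L
      (fun i hi => by simp only [hL ((i, j), 0) hi, hW0 _ _ hi]; simp)
      (fun i => by
        have h1 := hW j i
        have h2 := hW (j - 1) i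
        have h3 := hsum (i, j)
        rw [c2, c3] at h3
        linear_combination h1 + h2 + h3 - two (c ((i - 1, j), 0)))
      i
    linear_combination key - two (W j i) - two (W (j - 1) i)
  have flip0 : ∀ i j, gridFlip ((i, j), 0) = ((i + 1, j), 2) := fun i j => by
    simp [gridFlip_apply, gridDir]
  have flip1 : ∀ i j, gridFlip ((i, j), 1) = ((i, j + 1), 3) := fun i j => by
    simp [gridFlip_apply, gridDir]
  have flip2 : ∀ i j, gridFlip ((i, j), 2) = ((i - 1, j), 0) := fun i j => by
    simp [gridFlip_apply, gridDir, sub_eq_add_neg]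
  have flip3 : ∀ i j, gridFlip ((i, j), 3) = ((i, j - 1), 1) := fun i j => by
    simp [gridFlip_apply, gridDir, sub_eq_add_neg]
  refine ⟨fun d => ![W d.1.2 d.1.1, W d.1.2 (d.1.1 - 1), W (d.1.2 - 1) (d.1.1 - 1),
    W (d.1.2 - 1) d.1.1] d.2, ?_, ?_⟩
  · rintro ⟨⟨i, j⟩, k⟩
    fin_cases k
    · change _ = _ + c ((i, j), 0)
      erw [flip0]
      change W (j - 1) (i + 1 - 1) = W j i + _
      rw [h0]
      simp only [add_sub_cancel_right]
      linear_combination -two (W j i)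
    · change _ = _ + c ((i, j), 1)
      erw [flip1]
      change W (j + 1 - 1) i = W j (i - 1) + _
      simp only [add_sub_cancel_right]
      exact hW j i
    · change _ = _ + c ((i, j), 2)
      erw [flip2]
      change W j (i - 1) = W (j - 1) (i - 1) + _
      rw [c2, h0]
      linear_combination -two (W (j - 1) (i - 1))
    · change _ = _ + c ((i, j), 3)
      erw [flip3]
      change W (j - 1) (i - 1) = W (j - 1) i + _
      rw [c3]
      have := hW (j - 1) i
      linear_combination -this - two (c ((i, j - 1), 1))
  · rintro ⟨⟨i, j⟩, k⟩
    fin_cases k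
    · change W j (i - 1) = W j i + c ((i, j), 1)
      have := hW j i
      linear_combination -this - two (c ((i, j), 1))
    · change W (j - 1) (i - 1) = W j (i - 1) + c ((i, j), 2)
      rw [c2, h0]
      linear_combination - two (W j (i - 1))
    · change W (j - 1) i = W (j - 1) (i - 1) + c ((i, j), 3)
      rw [c3]
      exact hW (j - 1) i
    · change W j i = W (j - 1) i + c ((i, j), 0)
      rw [h0]
      linear_combination - two (W (j - 1) i)

/-- The square grid as a planar rotation system. -/
def gridSystem : ContractedSystem ((ℤ × ℤ) × Fin 4) (ℤ × ℤ) gridFlip where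
  κ := gridRot
  β := Prod.fst
  T := ∅
  β_κ _ := rfl
  sameCycle := by
    rintro ⟨z, i⟩ ⟨z', j⟩ h
    obtain rfl : z = z' := h
    have key : ∀ k : ℕ, (gridRot ^ k) (z, i) = (z, i + (Fin.ofNat 4 k)) := by
      intro k
      induction k with
      | zero => simp
      | succ k ih =>
        rw [pow_succ', Equiv.Perm.mul_apply, ih]
        change (z, i + Fin.ofNat 4 k + 1) = _
        congr 1
        rw [add_assoc]
        congr 1
        ext
        simp [Fin.val_add, Fin.ofNat]
    refine ⟨((j - i : Fin 4) : ℕ), ?_⟩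
    rw [zpow_natCast, key]
    congr 1
    have : Fin.ofNat 4 ((j - i : Fin 4) : ℕ) = j - i := by ext; simp
    rw [this]
    exact add_sub_cancel i j
  finite_fiber z := by
    refine (Set.finite_range fun i : Fin 4 => (z, i)).subset ?_
    rintro ⟨z', i⟩ h
    obtain rfl : z' = z := h
    exact ⟨i, rfl⟩
  β_T _ h := h.elim
  planar s c hs hc _ hsum := by
    have := grid_planar s c hs hc fun z => by
      rw [← hsum z]
      have h1 : ∑ d ∈ s with d.1 = z, c d = ∑ d ∈ Finset.univ.image fun i : Fin 4 => (z, i), c d := by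
        apply Finset.sum_subset
        · rintro ⟨z', i⟩ hd
          obtain rfl := (Finset.mem_filter.1 hd).2
          simp
        · rintro ⟨z', i⟩ hd hd'
          apply hs
          intro h2
          obtain ⟨i', _, hi'⟩ := Finset.mem_image.1 hd
          exact hd' (Finset.mem_filter.2 ⟨h2, (congrArg Prod.fst hi').symm⟩)
      rw [h1, Finset.sum_image (by intro i _ j _ h; exact congrArg Prod.snd h), Fin.sum_univ_four]
    obtain ⟨w, h1, h2⟩ := this
    exact ⟨w, fun d _ => h1 d, h2⟩

end Grid

section Pixels

/-- The grid points of mesh `ε` close to a planar set. -/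
def pixels (ε : ℝ) (S : Set (ℝ × ℝ)) : Set (ℤ × ℤ) :=
  {z | ∃ s ∈ S, |ε * z.1 - s.1| ≤ ε ∧ |ε * z.2 - s.2| ≤ ε}

/-- Connectedness of a set of grid points. -/
def GridConnected (A : Set (ℤ × ℤ)) : Prop :=
  ∀ f : ℤ × ℤ → Prop, (∀ a ∈ A, ∀ i, a + gridDir i ∈ A → (f a ↔ f (a + gridDir i))) →
    ∀ a ∈ A, ∀ b ∈ A, f a → f b

theorem iff_of_near {A : Set (ℤ × ℤ)} {f : ℤ × ℤ → Prop}
    (hf : ∀ a ∈ A, ∀ i, a + gridDir i ∈ A → (f a ↔ f (a + gridDir i))) {a b : ℤ × ℤ}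
    (ha : a ∈ A) (hb : b ∈ A) (hm : (a.1, b.2) ∈ A) (h1 : |a.1 - b.1| ≤ 1) (h2 : |a.2 - b.2| ≤ 1) :
    f a ↔ f b := by
  obtain ⟨a1, a2⟩ := a
  obtain ⟨b1, b2⟩ := b
  simp only [abs_le] at h1 h2 hm
  have e1 : f (a1, a2) ↔ f (a1, b2) := by
    obtain h | h | h : b2 = a2 ∨ b2 = a2 + 1 ∨ b2 = a2 - 1 := by omega
    · rw [h]
    · have h3 : (a1, a2) + gridDir 1 = (a1, b2) := by simp [gridDir, h]
      rw [← h3]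
      exact hf _ ha 1 (h3 ▸ hm)
    · have h3 : (a1, a2) + gridDir 3 = (a1, b2) := by simp [gridDir, h, sub_eq_add_neg]
      rw [← h3]
      exact hf _ ha 3 (h3 ▸ hm)
  have e2 : f (a1, b2) ↔ f (b1, b2) := by
    obtain h | h | h : b1 = a1 ∨ b1 = a1 + 1 ∨ b1 = a1 - 1 := by omega
    · rw [h]
    · have h3 : (a1, b2) + gridDir 0 = (b1, b2) := by simp [gridDir, h]
      rw [← h3]
      exact hf _ hm 0 (h3 ▸ hb)
    · have h3 : (a1, b2) + gridDir 2 = (b1, b2) := by simp [gridDir, h, sub_eq_add_neg]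
      rw [← h3]
      exact hf _ hm 2 (h3 ▸ hb)
  exact e1.trans e2

theorem abs_mul_round_sub_le {ε : ℝ} (hε : 0 < ε) (x : ℝ) : |ε * round (x / ε) - x| ≤ ε / 2 := by
  have h := abs_sub_round (x / ε)
  have : ε * round (x / ε) - x = -(ε * (x / ε - round (x / ε))) := by field_simp; ring
  rw [this, abs_neg, abs_mul, abs_of_pos hε]
  nlinarith

theorem round_mem_pixels {ε : ℝ} (hε : 0 < ε) {S : Set (ℝ × ℝ)} {s : ℝ × ℝ} (hs : s ∈ S) :
    (round (s.1 / ε), round (s.2 / ε)) ∈ pixels ε S :=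
  ⟨s, hs, (abs_mul_round_sub_le hε _).trans (by linarith),
    (abs_mul_round_sub_le hε _).trans (by linarith)⟩

theorem abs_sub_le_one_of_lt {ε : ℝ} (hε : 0 < ε) {a b : ℤ} (h : |ε * a - ε * b| < 2 * ε) :
    |a - b| ≤ 1 := by
  rw [← mul_sub, abs_mul, abs_of_pos hε, mul_comm] at h
  have h1 : |(a : ℝ) - b| < 2 := lt_of_mul_lt_mul_right h hε.le
  have h2 : |a - b| < 2 := by exact_mod_cast h1
  omega

theorem gridConnected_pixels {ε : ℝ} (hε : 0 < ε) {S : Set (ℝ × ℝ)} (hS : IsPreconnected S) :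
    GridConnected (pixels ε S) := by
  classical
  intro f hf
  let g : ℝ × ℝ → ℤ × ℤ := fun s => (round (s.1 / ε), round (s.2 / ε))
  have hg : ∀ s ∈ S, g s ∈ pixels ε S := fun s hs => round_mem_pixels hε hs
  have h1 : ∀ z s, s ∈ S → |ε * (z : ℤ × ℤ).1 - s.1| ≤ ε → |ε * z.2 - s.2| ≤ ε →
      (f z ↔ f (g s)) := by
    intro z s hs hz1 hz2
    have e1 := abs_mul_round_sub_le hε s.1
    have e2 := abs_mul_round_sub_le hε s.2
    have hz1' := abs_le.1 hz1
    have hz2' := abs_le.1 hz2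
    have e1' := abs_le.1 e1
    have e2' := abs_le.1 e2
    refine iff_of_near hf ⟨s, hs, hz1, hz2⟩ (hg s hs) ⟨s, hs, hz1, e2.trans (by linarith)⟩ ?_ ?_
    · refine abs_sub_le_one_of_lt hε (abs_lt.2 ⟨?_, ?_⟩) <;> simp only [g] <;> linarith
    · refine abs_sub_le_one_of_lt hε (abs_lt.2 ⟨?_, ?_⟩) <;> simp only [g] <;> linarith
  have h2 : ∀ p ∈ S, ∀ q ∈ S, |q.1 - p.1| ≤ ε / 2 → |q.2 - p.2| ≤ ε / 2 →
      (f (g q) ↔ f (g p)) := by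
    intro p hp q hq hd1 hd2
    have e1 := abs_mul_round_sub_le hε q.1
    have e2 := abs_mul_round_sub_le hε q.2
    refine h1 (g q) p hp ?_ ?_
    · calc |ε * (g q).1 - p.1| = |(ε * round (q.1 / ε) - q.1) + (q.1 - p.1)| := by
            simp only [g]; ring_nf
        _ ≤ _ := (abs_add_le _ _).trans (by linarith)
    · calc |ε * (g q).2 - p.2| = |(ε * round (q.2 / ε) - q.2) + (q.2 - p.2)| := by
            simp only [g]; ring_nf
        _ ≤ _ := (abs_add_le _ _).trans (by linarith)
  have hcont : ContinuousOn (fun s => decide (f (g s))) S := by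
    intro p hp
    have h0 : ContinuousWithinAt (fun _ => decide (f (g p))) S p := continuousWithinAt_const
    refine h0.congr_of_eventuallyEq ?_ rfl
    have hball : ∀ᶠ q in nhdsWithin p S, q ∈ Metric.ball p (ε / 2) :=
      mem_nhdsWithin_of_mem_nhds (Metric.ball_mem_nhds p (by linarith))
    filter_upwards [hball, self_mem_nhdsWithin] with q hq hqS
    rw [Metric.mem_ball, Prod.dist_eq, max_lt_iff, Real.dist_eq, Real.dist_eq] at hq
    simp only [h2 p hp q hqS hq.1.le hq.2.le]
  rintro a ⟨s, hs, hs1, hs2⟩ b ⟨t, ht, ht1, ht2⟩ hfa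
  have hst := hS.constant hcont hs ht
  simp only [decide_eq_decide] at hst
  exact (h1 b t ht ht1 ht2).2 (hst.1 ((h1 a s hs hs1 hs2).1 hfa))

theorem finite_pixels {ε : ℝ} (hε : 0 < ε) {S : Set (ℝ × ℝ)} (hS : IsCompact S) :
    (pixels ε S).Finite := by
  obtain ⟨R, hR⟩ := hS.isBounded.subset_closedBall 0
  obtain ⟨L, hL⟩ := exists_nat_gt (R / ε + 1)
  refine (Set.finite_Icc ((-L, -L) : ℤ × ℤ) (L, L)).subset ?_
  rintro ⟨x, y⟩ ⟨s, hs, h1, h2⟩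
  have h3 := hR hs
  rw [Metric.mem_closedBall, Prod.dist_eq, max_le_iff, Real.dist_eq, Real.dist_eq] at h3
  simp only [Prod.fst_zero, Prod.snd_zero, sub_zero] at h3
  have key : ∀ (x : ℤ) (t : ℝ), |ε * x - t| ≤ ε → |t| ≤ R → -(L : ℤ) ≤ x ∧ x ≤ L := by
    intro x t h1 h2
    rw [abs_le] at h1 h2
    have h4 : R / ε * ε = R := div_mul_cancel₀ _ hε.ne'
    have h5 : (L : ℝ) * ε > R + ε := by nlinarith
    constructor
    · have : -(L : ℝ) ≤ x := by nlinarith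
      exact_mod_cast this
    · have : (x : ℝ) ≤ L := by nlinarith
      exact_mod_cast this
  have k1 := key x _ h1 h3.1
  have k2 := key y _ h2 h3.2
  exact ⟨⟨k1.1, k2.1⟩, ⟨k1.2, k2.2⟩⟩

open Topology in
theorem eventually_disjoint_pixels {S T : Set (ℝ × ℝ)} (hS : IsCompact S) (hT : IsCompact T)
    (h : Disjoint S T) : ∀ᶠ ε in 𝓝[>] (0 : ℝ), Disjoint (pixels ε S) (pixels ε T) := by
  obtain ⟨δ, hδ, hd⟩ := h.exists_thickenings hS hT.isClosed
  filter_upwards [Ioo_mem_nhdsGT (half_pos hδ)] with ε hε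
  rw [Set.disjoint_left]
  rintro z ⟨s, hs, h1, h2⟩ ⟨t, ht, h3, h4⟩
  have hst : dist s t < δ := by
    rw [Prod.dist_eq, max_lt_iff, Real.dist_eq, Real.dist_eq]
    have := hε.2
    rw [abs_le] at h1 h2 h3 h4
    constructor <;> rw [abs_lt] <;> constructor <;> linarith
  refine Set.disjoint_left.1 hd (Metric.self_subset_thickening hδ _ hs) ?_
  exact Metric.mem_thickening_iff.2 ⟨t, ht, hst⟩

end Pixels

/-- A finite planar rotation system.  Planarity is expressed algebraically: every mod-2 cycle is
the boundary of a set of faces. -/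
structure PlanarMap (N D : Type) [DecidableEq N] [Fintype D] where
  α : D → D
  base : D → N
  r : Equiv.Perm D
  α_α : ∀ d, α (α d) = d
  base_α_ne : ∀ d, base (α d) ≠ base d
  base_r : ∀ d, base (r d) = base d
  sameCycle : ∀ d d', base d = base d' → r.SameCycle d d'
  planar : ∀ c : D → ZMod 2, (∀ d, c (α d) = c d) → (∀ n, ∑ d with base d = n, c d = 0) →
    ∃ w : D → ZMod 2, ∀ d, w (α d) = w d + c d ∧ w (r d) = w d + c (r d)

open Topology in
/-- Disjoint connected sets in the plane joined by disjoint connected sets form a planar map. -/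
theorem exists_planarMap {N D : Type} [DecidableEq N] [Finite N] [Fintype D] (α : D → D)
    (base : D → N) (hα : ∀ d, α (α d) = d) (hbase : ∀ d, base (α d) ≠ base d)
    (K : N → Set (ℝ × ℝ)) (A : D → Set (ℝ × ℝ))
    (hK : ∀ n, IsCompact (K n)) (hA : ∀ d, IsCompact (A d))
    (hKc : ∀ n, IsPreconnected (K n)) (hAc : ∀ d, IsPreconnected (A d))
    (hAα : ∀ d, A (α d) = A d) (hAK : ∀ d, (A d ∩ K (base d)).Nonempty)
    (dKK : ∀ n n', n ≠ n' → Disjoint (K n) (K n'))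
    (dKA : ∀ n d, n ≠ base d → n ≠ base (α d) → Disjoint (K n) (A d))
    (dAA : ∀ d d', d' ≠ d → d' ≠ α d → Disjoint (A d) (A d')) :
    ∃ M : PlanarMap N D, M.α = α ∧ M.base = base := by
  classical
  obtain ⟨P, hP⟩ : ∃ P : D → Prop, ∀ d, P (α d) ↔ ¬ P d := by
    refine ⟨fun d => Fintype.equivFin D d < Fintype.equivFin D (α d), fun d => ?_⟩
    simp only [hα, not_lt]
    have : Fintype.equivFin D (α d) ≠ Fintype.equivFin D d := fun h =>
      hbase d (by rw [(Fintype.equivFin D).injective h])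
    exact ⟨le_of_lt, fun h => lt_of_le_of_ne h this⟩
  have ev : ∀ᶠ ε in 𝓝[>] (0 : ℝ), 0 < ε ∧
      (∀ n n', n ≠ n' → Disjoint (pixels ε (K n)) (pixels ε (K n'))) ∧
      (∀ n d, n ≠ base d → n ≠ base (α d) → Disjoint (pixels ε (K n)) (pixels ε (A d))) ∧
      (∀ d d', d' ≠ d → d' ≠ α d → Disjoint (pixels ε (A d)) (pixels ε (A d'))) := by
    refine Filter.Eventually.and self_mem_nhdsWithin (Filter.Eventually.and ?_
      (Filter.Eventually.and ?_ ?_))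
    · simp only [Filter.eventually_all]
      exact fun n n' h => eventually_disjoint_pixels (hK _) (hK _) (dKK n n' h)
    · simp only [Filter.eventually_all]
      exact fun n d h h' => eventually_disjoint_pixels (hK _) (hA _) (dKA n d h h')
    · simp only [Filter.eventually_all]
      exact fun d d' h h' => eventually_disjoint_pixels (hA _) (hA _) (dAA d d' h h')
  obtain ⟨ε, hε, hKK, hKA, hAA⟩ := ev.exists
  clear ev
  set NK := fun n => pixels ε (K n) with hNK
  set NA := fun d => pixels ε (A d) with hNA
  have hNAα : ∀ d, NA (α d) = NA d := fun d => by simp only [hNA, hAα]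
  have hmeet : ∀ d, ∃ z, z ∈ NA d ∧ z ∈ NK (base d) := fun d =>
    let ⟨_, h1, h2⟩ := hAK d
    ⟨_, round_mem_pixels hε h1, round_mem_pixels hε h2⟩
  -- the part of an arc before it first touches its terminal vertex
  let Q : D → Set (ℤ × ℤ) := fun d => {b | ∃ a ∈ NA d, a ∈ NK (base d) ∧
    Relation.ReflTransGen (fun u v => ∃ i, v = u + gridDir i ∧ v ∈ NA d ∧
      v ∉ NK (base (α d))) a b}
  have hQ : ∀ d, ∀ b ∈ Q d, b ∈ NA d ∧ b ∉ NK (base (α d)) := by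
    rintro d b ⟨a, ha, ha', h⟩
    rcases h.cases_tail with rfl | ⟨u, _, i, _, h1, h2⟩
    · exact ⟨ha, Set.disjoint_left.1 (hKK _ _ (hbase d).symm) ha'⟩
    · exact ⟨h1, h2⟩
  have hQstep : ∀ d, ∀ b ∈ Q d, ∀ i, b + gridDir i ∈ NA d → b + gridDir i ∉ Q d →
      b + gridDir i ∈ NK (base (α d)) := by
    rintro d b ⟨a, ha, ha', h⟩ i h1 h2
    by_contra h3
    exact h2 ⟨a, ha, ha', h.tail ⟨i, rfl, h1, h3⟩⟩
  have hlive : ∀ d, ∃ e : (ℤ × ℤ) × Fin 4, e.1 ∈ Q d ∧ (gridFlip e).1 ∈ NA d ∧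
      (gridFlip e).1 ∈ NK (base (α d)) := by
    intro d
    by_contra! hno
    obtain ⟨z, hz, hz'⟩ := hmeet d
    obtain ⟨y, hy, hy'⟩ := hmeet (α d)
    rw [hNAα] at hy
    have hback : ∀ a i, gridFlip (a + gridDir i, i + 2) = (a, i) := fun a i =>
      gridFlip_flip (a, i)
    have := gridConnected_pixels hε (hAc d) (fun b => b ∈ Q d) ?_ z hz y hy
      ⟨z, hz, hz', Relation.ReflTransGen.refl⟩
    · exact (hQ d y this).2 hy'
    · intro a ha i hai
      constructor
      · intro h1
        by_contra h2
        exact hno (a, i) h1 hai (hQstep d a h1 i hai h2)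
      · intro h1
        by_contra h2
        refine hno (a + gridDir i, i + 2) h1 (by rw [hback]; exact ha) ?_
        have h3 : a + gridDir i + gridDir (i + 2) = a := by
          rw [add_assoc, gridDir_add, add_zero]
        have h4 := hQstep d _ h1 (i + 2)
        rw [h3] at h4
        rw [hback]
        exact h4 ha h2
  choose lv hlv1 hlv2 hlv3 using hlive
  let f : D → (ℤ × ℤ) × Fin 4 := fun d => if P d then lv d else gridFlip (lv (α d))
  have fpos : ∀ d, P d → f d = lv d := fun d h => if_pos h
  have fneg : ∀ d, ¬ P d → f d = gridFlip (lv (α d)) := fun d h => if_neg h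
  have hfα : ∀ d, f (α d) = gridFlip (f d) := by
    intro d
    by_cases h : P d
    · rw [fpos d h, fneg _ (fun h' => (hP d).1 h' h), hα]
    · rw [fneg d h, fpos _ ((hP d).2 h), gridFlip_flip]
  let B : N → Set (ℤ × ℤ) := fun n => NK n ∪ {z | ∃ d, P d ∧ base d = n ∧ z ∈ Q d}
  have hKQ : ∀ n d z, z ∈ NK n → z ∈ Q d → n = base d := by
    intro n d z h1 h2
    obtain ⟨h3, h4⟩ := hQ d z h2
    by_contra hne
    refine Set.disjoint_left.1 (hKA n d hne ?_) h1 h3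
    rintro rfl
    exact h4 h1
  have hB : ∀ n n' z, z ∈ B n → z ∈ B n' → n = n' := by
    rintro n n' z (h1 | ⟨d, h1, rfl, h2⟩) (h3 | ⟨d', h3, rfl, h4⟩)
    · by_contra hne
      exact Set.disjoint_left.1 (hKK _ _ hne) h1 h3
    · exact hKQ _ _ _ h1 h4
    · exact (hKQ _ _ _ h3 h2).symm
    · by_contra hne
      refine Set.disjoint_left.1 (hAA d d' (fun h => hne (by rw [h])) fun h => ?_)
        (hQ d z h2).1 (hQ d' z h4).1
      rw [h] at h3
      exact (hP d).1 h3 h1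
  have hfB : ∀ d, (f d).1 ∈ B (base d) := by
    intro d
    by_cases h : P d
    · rw [fpos d h]
      exact Or.inr ⟨d, h, rfl, hlv1 d⟩
    · rw [fneg d h]
      have := hlv3 (α d)
      rw [hα] at this
      exact Or.inl this
  have hfA : ∀ d, (f d).1 ∈ NA d := by
    intro d
    by_cases h : P d
    · rw [fpos d h]
      exact (hQ d _ (hlv1 d)).1
    · rw [fneg d h, ← hNAα]
      exact hlv2 (α d)
  have hfinj : Function.Injective f := by
    intro d d' h
    by_contra hne
    by_cases h' : d' = α d
    · subst h'
      have h1 := hfB d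
      rw [h] at h1
      exact hbase d (hB _ _ _ (hfB (α d)) h1)
    · refine Set.disjoint_left.1 (hAA d d' (Ne.symm hne) h') (hfA d) ?_
      rw [h]
      exact hfA d'
  have hBfin : (⋃ n, B n).Finite := by
    refine Set.finite_iUnion fun n => (finite_pixels hε (hK n)).union ?_
    refine (Set.finite_iUnion fun d => finite_pixels hε (hA d)).subset ?_
    rintro z ⟨d, _, _, hd⟩
    exact Set.mem_iUnion.2 ⟨d, (hQ d z hd).1⟩
  obtain ⟨F, hF⟩ : ∃ F : Finset ((ℤ × ℤ) × Fin 4), ∀ e, e ∈ F ↔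
      ∃ n, e.1 ∈ B n ∧ (gridFlip e).1 ∈ B n := by
    have : {e : (ℤ × ℤ) × Fin 4 | ∃ n, e.1 ∈ B n ∧ (gridFlip e).1 ∈ B n}.Finite := by
      refine (hBfin.prod (Set.finite_univ (α := Fin 4))).subset ?_
      rintro e ⟨n, h, _⟩
      exact ⟨Set.mem_iUnion.2 ⟨n, h⟩, trivial⟩
    exact ⟨this.toFinset, fun e => by simp⟩
  obtain ⟨M, m1, m2, m3, m4⟩ := gridSystem.exists_contract gridFlip_flip F
  have hβ : ∀ e z i, e.1 = z → M.β e = M.β (z, i) := fun e z i h => m2 _ _ h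
  have hstep : ∀ n z i, z ∈ B n → z + gridDir i ∈ B n →
      M.β (z + gridDir i, 0) = M.β (z, 0) := by
    intro n z i h1 h2
    have := m1 (z, i) ((hF _).2 ⟨n, h1, h2⟩)
    rw [hβ _ (z + gridDir i) 0 rfl, hβ (z, i) z 0 rfl] at this
    exact this
  have hconstK : ∀ n, ∀ z ∈ NK n, ∀ y ∈ NK n, M.β (y, 0) = M.β (z, 0) := by
    intro n z hz y hy
    refine gridConnected_pixels hε (hKc n) (fun y => M.β (y, 0) = M.β (z, 0)) ?_ z hz y hy rfl
    intro a ha i hai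
    rw [hstep n a i (Or.inl ha) (Or.inl hai)]
  have hconst : ∀ n, ∀ z ∈ NK n, ∀ y ∈ B n, M.β (y, 0) = M.β (z, 0) := by
    rintro n z hz y (hy | ⟨d, hd, rfl, a, ha, ha', hay⟩)
    · exact hconstK n z hz y hy
    · induction hay with
      | refl => exact hconstK _ z hz a ha'
      | @tail u v huv hv ih =>
        obtain ⟨i, rfl, hv1, hv2⟩ := hv
        rw [hstep (base d) u i (Or.inr ⟨d, hd, rfl, a, ha, ha', huv⟩)
          (Or.inr ⟨d, hd, rfl, a, ha, ha', huv.tail ⟨i, rfl, hv1, hv2⟩⟩)]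
        exact ih
  have hβbase : ∀ d d', M.β (f d) = M.β (f d') ↔ base d = base d' := by
    intro d d'
    constructor
    · intro h
      have h1 := m4 (fun e => {n | e.1 ∈ B n}) ?_ ?_ _ _ h
      · have h2 : base d ∈ {n | (f d).1 ∈ B n} := hfB d
        rw [h1] at h2
        exact hB _ _ _ h2 (hfB d')
      · intro e he
        obtain ⟨n, h1, h2⟩ := (hF e).1 he
        ext n'
        exact ⟨fun h3 => hB _ _ _ h3 h2 ▸ h1, fun h3 => hB _ _ _ h3 h1 ▸ h2⟩
      · intro e e' he
        have : e.1 = e'.1 := he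
        simp only [this]
    · intro h
      obtain ⟨z, _, hz⟩ := hmeet d
      rw [hβ (f d) _ 0 rfl, hβ (f d') _ 0 rfl, hconst _ z hz _ (hfB d),
        hconst (base d) z hz (f d').1 (by rw [h]; exact hfB d')]
  obtain ⟨ρ, hρ1, hρ2⟩ := exists_firstReturn M.κ f hfinj fun d => M.recurrent (f d)
  have hpow : ∀ (k : ℕ) e, M.β ((M.κ ^ k) e) = M.β e := by
    intro k e
    induction k with
    | zero => rfl
    | succ k ih => rw [pow_succ', Equiv.Perm.mul_apply, M.β_κ, ih]
  have hT : ∀ d, f d ∉ M.T := by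
    intro d hd
    have h1 := hfB d
    have h2 := hfB (α d)
    rw [hfα] at h2
    rcases m3 _ hd with h | h | h
    · exact h
    · obtain ⟨n, h3, h4⟩ := (hF _).1 h
      exact hbase d ((hB _ _ _ h2 h4).trans (hB _ _ _ h3 h1))
    · obtain ⟨n, h3, h4⟩ := (hF _).1 h
      rw [gridFlip_flip] at h4
      exact hbase d ((hB _ _ _ h2 h3).trans (hB _ _ _ h4 h1))
  refine ⟨⟨α, base, ρ, hα, hbase, fun d => ?_, fun d d' h => ?_, fun c hc hsum => ?_⟩, rfl, rfl⟩
  · obtain ⟨k, _, hk, _⟩ := hρ1 d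
    rw [← hβbase, ← hk, hpow]
  · exact hρ2 d d' (M.sameCycle _ _ ((hβbase d d').2 h))
  · let c' : (ℤ × ℤ) × Fin 4 → ZMod 2 := Function.extend f c (fun _ => 0)
    have c'f : ∀ d, c' (f d) = c d := fun d => hfinj.extend_apply c _ d
    have c'n : ∀ e, e ∉ Set.range f → c' e = 0 := fun e he =>
      Function.extend_apply' c _ e (fun ⟨d, hd⟩ => he ⟨d, hd⟩)
    have k1 : ∀ e ∉ Finset.univ.image f, c' e = 0 := fun e he => c'n e (by simpa using he)
    have k2 : ∀ e, c' (gridFlip e) = c' e := by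
      intro e
      by_cases he : e ∈ Set.range f
      · obtain ⟨d, rfl⟩ := he
        rw [← hfα, c'f, c'f, hc]
      · rw [c'n e he, c'n]
        rintro ⟨d, hd⟩
        exact he ⟨α d, by rw [hfα, hd, gridFlip_flip]⟩
    have k3 : ∀ e ∈ M.T, c' e = 0 := by
      intro e he
      refine c'n e ?_
      rintro ⟨d, rfl⟩
      exact hT d he
    have k4 : ∀ z, ∑ e ∈ Finset.univ.image f with M.β e = z, c' e = 0 := by
      intro z
      rw [Finset.filter_image, Finset.sum_image hfinj.injOn]
      simp only [c'f]
      by_cases hz : ∃ d, M.β (f d) = z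
      · obtain ⟨d, rfl⟩ := hz
        rw [← hsum (base d)]
        exact Finset.sum_congr (Finset.filter_congr fun d' _ => hβbase d' d) fun _ _ => rfl
      · rw [Finset.filter_false_of_mem, Finset.sum_empty]
        exact fun d _ hd => hz ⟨d, hd⟩
    obtain ⟨w, hw1, hw2⟩ := M.planar _ c' k1 k2 k3 k4
    refine ⟨fun d => w (f d), fun d => ⟨?_, ?_⟩⟩
    · dsimp only
      rw [hfα, hw1 _ (hT d), c'f]
    · obtain ⟨k, hk0, hk, hkmin⟩ := hρ1 d
      have hi : ∀ i, i < k → w ((M.κ ^ i) (f d)) = w (f d) := by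
        intro i hi
        induction i with
        | zero => rfl
        | succ i ih =>
          have h1 := hkmin (i + 1) (by omega) hi
          rw [pow_succ', Equiv.Perm.mul_apply] at h1 ⊢
          rw [hw2, c'n _ h1, ih (by omega), add_zero]
      obtain ⟨j, rfl⟩ : ∃ j, k = j + 1 := ⟨k - 1, by omega⟩
      have h1 := hi j (by omega)
      dsimp only
      rw [← c'f, ← hk, pow_succ', Equiv.Perm.mul_apply, hw2, h1]

open Relation

/-- A planar map with a set of terminals (the image of `ν`), all other nodes having degree four,
together with a fixed-point-free pairing `τ` of the darts at each of these other nodes. -/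
structure Routing (N D V : Type) [DecidableEq N] [Fintype D] extends PlanarMap N D where
  ν : V → N
  ν_inj : Function.Injective ν
  r_four : ∀ d, base d ∉ Set.range ν → r (r (r (r d))) = d
  r_two_ne : ∀ d, base d ∉ Set.range ν → r (r d) ≠ d
  τ : D → D
  τ_τ : ∀ d, τ (τ d) = d
  base_τ : ∀ d, base (τ d) = base d
  τ_ne : ∀ d, base d ∉ Set.range ν → τ d ≠ d

namespace Routing

variable {N D V : Type} [DecidableEq N] [Fintype D] (R : Routing N D V)

/-- One step along a trail, through a non-terminal node. -/
def Step (a b : D) : Prop := b = R.τ (R.α a) ∧ R.base (R.α a) ∉ Set.range R.ν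

/-- `R.Seg a b`: the trail through the dart `a` later traverses the dart `b`. -/
def Seg : D → D → Prop := ReflTransGen R.Step

variable {R}

theorem Step.left_unique {a b c : D} (h : R.Step a c) (h' : R.Step b c) : a = b := by
  have h1 : R.α a = R.α b := by
    rw [← R.τ_τ (R.α a), ← h.1, h'.1, R.τ_τ]
  rw [← R.α_α a, h1, R.α_α]

theorem Step.right_unique {a b c : D} (h : R.Step a b) (h' : R.Step a c) : b = c :=
  h.1.trans h'.1.symm

theorem Step.base_notMem {a b : D} (h : R.Step a b) : R.base b ∉ Set.range R.ν := by
  rw [h.1, R.base_τ]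
  exact h.2

theorem Step.reverse {a b : D} (h : R.Step a b) : R.Step (R.α b) (R.α a) := by
  refine ⟨?_, ?_⟩
  · rw [R.α_α, h.1, R.τ_τ]
  · rw [R.α_α]
    exact h.base_notMem

theorem step_of_notMem {a : D} (h : R.base (R.α a) ∉ Set.range R.ν) :
    R.Step a (R.τ (R.α a)) := ⟨rfl, h⟩

/-- The step which arrives at a dart leaving a non-terminal node. -/
theorem step_into {a : D} (h : R.base a ∉ Set.range R.ν) : R.Step (R.α (R.τ a)) a := by
  refine ⟨?_, ?_⟩
  · rw [R.α_α, R.τ_τ]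
  · rw [R.α_α, R.base_τ]
    exact h

theorem Seg.reverse {a b : D} (h : R.Seg a b) : R.Seg (R.α b) (R.α a) := by
  induction h with
  | refl => exact ReflTransGen.refl
  | tail _ h ih => exact ReflTransGen.head h.reverse ih

theorem Seg.eq_of_mem {a b : D} (h : R.Seg a b) (hb : R.base b ∈ Set.range R.ν) : a = b := by
  rcases ReflTransGen.cases_tail h with h | ⟨c, _, h⟩
  · exact h.symm
  · exact absurd hb h.base_notMem

theorem Seg.eq_of_mem_right {a b : D} (h : R.Seg a b)
    (ha : R.base (R.α a) ∈ Set.range R.ν) : b = a := by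
  rcases ReflTransGen.cases_head h with h | ⟨c, h, _⟩
  · exact h.symm
  · exact absurd ha h.2

theorem Seg.total_right {a b c : D} (h : R.Seg a b) (h' : R.Seg a c) : R.Seg b c ∨ R.Seg c b :=
  ReflTransGen.total_of_right_unique (fun _ _ _ h h' => h.right_unique h') h h'

theorem Seg.total_left {a b c : D} (h : R.Seg a c) (h' : R.Seg b c) : R.Seg a b ∨ R.Seg b a := by
  induction h with
  | refl => exact Or.inr h'
  | @tail x y hx hy ih =>
    rcases ReflTransGen.cases_tail h' with rfl | ⟨z, hz, hz'⟩
    · exact Or.inl (hx.tail hy)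
    · exact ih (hz'.left_unique hy ▸ hz)

theorem Seg.eq_of_common {a b c : D} (h : R.Seg a c) (h' : R.Seg b c)
    (ha : R.base a ∈ Set.range R.ν) (hb : R.base b ∈ Set.range R.ν) : a = b := by
  rcases h.total_left h' with h | h
  · exact h.eq_of_mem hb
  · exact (h.eq_of_mem ha).symm

theorem Seg.acyclic {a b c : D} (h : R.Seg a b) (ha : R.base a ∈ Set.range R.ν)
    (hs : R.Step b c) (h' : R.Seg c b) : False := by
  induction h generalizing c with
  | refl =>
    obtain rfl := h'.eq_of_mem ha
    exact hs.base_notMem ha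
  | @tail x y _ hy ih =>
    rcases ReflTransGen.cases_tail h' with rfl | ⟨z, hz, hz'⟩
    · obtain rfl := hs.left_unique hy
      exact ih hs ReflTransGen.refl
    · obtain rfl := hz'.left_unique hy
      exact ih hy (ReflTransGen.head hs hz)

theorem Seg.mono_of {R' : Routing N D V} {a b : D} (h : R.Seg a b)
    (H : ∀ z w, R.Seg a z → R.Step z w → R.Seg w b → R'.Step z w) : R'.Seg a b := by
  induction h using ReflTransGen.head_induction_on with
  | refl => exact ReflTransGen.refl
  | head h h' ih =>
    refine ReflTransGen.head (H _ _ ReflTransGen.refl h h') (ih fun z w hz => H z w ?_)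
    exact ReflTransGen.head h hz

theorem fiber {d e : D} (hd : R.base d ∉ Set.range R.ν) (h : R.base e = R.base d) :
    e = d ∨ e = R.r d ∨ e = R.r (R.r d) ∨ e = R.r (R.r (R.r d)) := by
  obtain ⟨n, rfl⟩ := exists_pow_eq_of_sameCycle R.r (p := 4) (by norm_num)
    (by simpa [pow_succ] using R.r_four d hd) (R.sameCycle d e h.symm)
  clear h
  induction n with
  | zero => simp
  | succ n ih =>
    rw [pow_succ', Equiv.Perm.mul_apply]
    rcases ih with h | h | h | h <;> rw [h]
    · simp
    · simp
    · simp
    · simp [R.r_four d hd]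

theorem r_ne {d : D} (hd : R.base d ∉ Set.range R.ν) : R.r d ≠ d := fun h =>
  R.r_two_ne d hd (by rw [h, h])

theorem r_three_ne {d : D} (hd : R.base d ∉ Set.range R.ν) : R.r (R.r (R.r d)) ≠ d := fun h => by
  have h1 := R.r_four d hd
  rw [h] at h1
  exact r_ne hd h1

theorem base_r_notMem {d : D} (hd : R.base d ∉ Set.range R.ν) :
    R.base (R.r d) ∉ Set.range R.ν := by
  rwa [R.base_r]

/-- If one pair of opposite darts is matched then so is the other one. -/
theorem τ_r_of_opposite {d : D} (hd : R.base d ∉ Set.range R.ν) (h : R.τ d = R.r (R.r d)) :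
    R.τ (R.r d) = R.r (R.r (R.r d)) := by
  have hr := base_r_notMem hd
  rcases fiber (e := R.τ (R.r d)) hd (by rw [R.base_τ, R.base_r]) with h1 | h1 | h1 | h1
  · exfalso
    have := R.τ_τ (R.r d)
    rw [h1, h] at this
    exact r_ne hr this
  · exact absurd h1 (R.τ_ne _ hr)
  · exfalso
    rw [← h] at h1
    have := R.τ_τ (R.r d)
    rw [h1, R.τ_τ] at this
    exact r_ne hd this.symm
  · exact h1

variable (R)

/-- The nodes at which two trails cross. -/
def crossing : Set N := {x | x ∉ Set.range R.ν ∧ ∀ a, R.base a = x → R.τ a = R.r (R.r a)}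

/-- `s u v` is the first dart of a trail from `u` to `v`, for every edge `uv` of `G`. -/
structure Carries (s : V → V → D) (G : SimpleGraph V) : Prop where
  base_s : ∀ u v, G.Adj u v → R.base (s u v) = R.ν u
  seg : ∀ u v, G.Adj u v → R.Seg (s u v) (R.α (s v u))

variable {R} {s : V → V → D} {G : SimpleGraph V}

namespace Carries

theorem mono {G' : SimpleGraph V} (C : R.Carries s G) (h : G' ≤ G) : R.Carries s G' :=
  ⟨fun u v h' => C.base_s u v (h h'), fun u v h' => C.seg u v (h h')⟩

theorem mem (C : R.Carries s G) {u v : V} (h : G.Adj u v) : R.base (s u v) ∈ Set.range R.ν :=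
  ⟨u, (C.base_s u v h).symm⟩

theorem s_inj (C : R.Carries s G)
    {u v x y : V} (h : G.Adj u v) (h' : G.Adj x y) (e : s u v = s x y) :
    u = x ∧ v = y := by
  have h1 : u = x := R.ν_inj (by rw [← C.base_s u v h, ← C.base_s x y h', e])
  have key : ∀ a b c, R.Seg a b → R.Seg a c → R.base (R.α b) ∈ Set.range R.ν →
      R.base (R.α c) ∈ Set.range R.ν → b = c := by
    intro a b c h1 h2 h3 h4
    rcases h1.total_right h2 with h | h
    · exact (h.eq_of_mem_right h3).symm
    · exact h.eq_of_mem_right h4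
  have h2 := key _ _ _ (C.seg u v h) (e ▸ C.seg x y h')
    (by rw [R.α_α]; exact C.mem h.symm) (by rw [R.α_α]; exact C.mem h'.symm)
  have h3 : s v u = s y x := by rw [← R.α_α (s v u), h2, R.α_α]
  exact ⟨h1, R.ν_inj (by rw [← C.base_s v u h.symm, ← C.base_s y x h'.symm, h3])⟩

theorem unique (C : R.Carries s G) {u v x y : V} (h : G.Adj u v) (h' : G.Adj x y) {d : D}
    (hd : R.Seg (s u v) d) (hd' : R.Seg (s x y) d) : u = x ∧ v = y :=
  C.s_inj h h' (hd.eq_of_common hd' (C.mem h) (C.mem h'))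

theorem seg_end (C : R.Carries s G) {u v : V} (h : G.Adj u v) {d : D} (hd : R.Seg (s u v) d) :
    R.Seg d (R.α (s v u)) := by
  rcases hd.total_right (C.seg u v h) with h1 | h1
  · exact h1
  · rw [h1.eq_of_mem_right (by rw [R.α_α]; exact C.mem h.symm)]
    exact ReflTransGen.refl

theorem reverse (C : R.Carries s G) {u v : V} (h : G.Adj u v) {d : D} (hd : R.Seg (s u v) d) :
    R.Seg (s v u) (R.α d) := by
  have := (C.seg_end h hd).reverse
  rwa [R.α_α] at this

/-- Arriving at a node on one dart is leaving it, on the reversed trail, by the matched dart. -/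
theorem opposite (C : R.Carries s G)
    {u v : V} (h : G.Adj u v) {a : D} (ha : R.base a ∉ Set.range R.ν)
    (hd : R.Seg (s u v) (R.α a)) : R.Seg (s v u) (R.α (R.τ a)) := by
  refine C.reverse h (hd.tail ?_)
  have := step_of_notMem (R := R) (a := R.α a) (by rwa [R.α_α])
  rwa [R.α_α] at this

end Carries

end Routing

namespace Routing

variable {N D V : Type} [DecidableEq N] [Fintype D] {R : Routing N D V}

open Classical in
/-- Repair the matching at a node: the partners of `b` and `d` are exchanged. -/
noncomputable def smooth (R : Routing N D V) (b d : D) (h : R.base b = R.base d) :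
    Routing N D V :=
  have hbase : ∀ x, R.base (Equiv.swap b d x) = R.base x := fun x => by
    rw [Equiv.swap_apply_def]
    split_ifs with h1 h2
    · rw [h1, h]
    · rw [h2, h]
    · rfl
  { R with
    τ := fun x => Equiv.swap b d (R.τ (Equiv.swap b d x))
    τ_τ := fun x => by simp only [Equiv.swap_apply_self, R.τ_τ]
    base_τ := fun x => by rw [hbase, R.base_τ, hbase]
    τ_ne := fun x hx e => by
      refine R.τ_ne (Equiv.swap b d x) (by rwa [hbase]) ?_
      rw [← Equiv.swap_apply_self b d (R.τ _), e] }

theorem smooth_τ_of_ne {b d x : D} (h : R.base b = R.base d) (h1 : x ≠ b) (h2 : x ≠ d)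
    (h3 : x ≠ R.τ b) (h4 : x ≠ R.τ d) : (R.smooth b d h).τ x = R.τ x := by
  have e1 : R.τ x ≠ b := fun e => h3 (by rw [← e, R.τ_τ])
  have e2 : R.τ x ≠ d := fun e => h4 (by rw [← e, R.τ_τ])
  classical
  simp only [smooth]
  rw [Equiv.swap_apply_of_ne_of_ne h1 h2, Equiv.swap_apply_of_ne_of_ne e1 e2]

theorem smooth_τ_left {b d : D} (h : R.base b = R.base d) (h1 : R.τ b ≠ b) (h2 : R.τ b ≠ d) :
    (R.smooth b d h).τ (R.τ b) = d := by
  classical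
  simp only [smooth]
  rw [Equiv.swap_apply_of_ne_of_ne h1 h2, R.τ_τ, Equiv.swap_apply_left]

theorem smooth_τ_right {b d : D} (h : R.base b = R.base d) (h1 : R.τ d ≠ b) (h2 : R.τ d ≠ d) :
    (R.smooth b d h).τ (R.τ d) = b := by
  classical
  simp only [smooth]
  rw [Equiv.swap_apply_of_ne_of_ne h1 h2, R.τ_τ, Equiv.swap_apply_right]

variable {s : V → V → D} {G : SimpleGraph V}

theorem smooth_crossing_ssubset {b d : D} (h : R.base b = R.base d) (h1 : R.τ b ≠ b)
    (h2 : R.τ b ≠ d) (hbd : b ≠ d) (hx : R.base b ∈ R.crossing) :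
    (R.smooth b d h).crossing ⊂ R.crossing := by
  refine Set.ssubset_iff_subset_ne.2 ⟨fun y hy => ⟨hy.1, fun a ha => ?_⟩, fun e => ?_⟩
  · by_cases hay : R.base a = R.base b
    · exact hx.2 a hay
    · have hτ := smooth_τ_of_ne (x := a) h (fun e => hay (by rw [e]))
        (fun e => hay (by rw [e, h])) (fun e => hay (by rw [e, R.base_τ]))
        (fun e => hay (by rw [e, R.base_τ, h]))
      rw [← hτ]
      exact hy.2 a ha
  · rw [← e] at hx
    have e1 := hx.2 (R.τ b) (R.base_τ b)
    rw [smooth_τ_left h h1 h2] at e1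
    rw [e] at hx
    have e2 := hx.2 (R.τ b) (R.base_τ b)
    rw [R.τ_τ] at e2
    exact hbd (e2.trans e1.symm)

/-- A crossing between two trails starting at the same terminal can be removed. -/
theorem Carries.exists_smooth (C : R.Carries s G) {a c : D} (hac : R.base c = R.base a)
    (hx : R.base a ∈ R.crossing) (h1 : c ≠ a) (h2 : c ≠ R.τ a) {u v v' : V} (hv : G.Adj u v)
    (hv' : G.Adj u v') (ha : R.Seg (s u v) (R.α a)) (hc : R.Seg (s u v') (R.α c)) :
    ∃ (R' : Routing N D V) (s' : V → V → D), R'.Carries s' G ∧ R'.crossing ⊂ R.crossing := by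
  classical
  have hna : R.base a ∉ Set.range R.ν := hx.1
  have hnc : R.base c ∉ Set.range R.ν := hac ▸ hna
  have hb := C.opposite hv hna ha
  have hd := C.opposite hv' hnc hc
  have hbase : R.base (R.τ a) = R.base (R.τ c) := by rw [R.base_τ, R.base_τ, hac]
  set R' := R.smooth (R.τ a) (R.τ c) hbase with hR'
  have n1 : R.τ a ≠ a := R.τ_ne a hna
  have n2 : R.τ c ≠ c := R.τ_ne c hnc
  have n3 : R.τ c ≠ a := fun e => h2 (by rw [← e, R.τ_τ])
  have n4 : R.τ a ≠ R.τ c := fun e => h1 (by rw [← R.τ_τ c, ← e, R.τ_τ])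
  have stepa : R'.Step (R.α a) (R.τ c) := by
    refine ⟨?_, ?_⟩
    · change R.τ c = R'.τ (R.α (R.α a))
      have := smooth_τ_left hbase (by rw [R.τ_τ]; exact n1.symm) (by rw [R.τ_τ]; exact n3.symm)
      rw [R.τ_τ] at this
      rw [R.α_α, hR', this]
    · change R.base (R.α (R.α a)) ∉ _
      rwa [R.α_α]
  have stepc : R'.Step (R.α c) (R.τ a) := by
    refine ⟨?_, ?_⟩
    · change R.τ a = R'.τ (R.α (R.α c))
      have := smooth_τ_right hbase (by rw [R.τ_τ]; exact h2) (by rw [R.τ_τ]; exact n2.symm)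
      rw [R.τ_τ] at this
      rw [R.α_α, hR', this]
    · change R.base (R.α (R.α c)) ∉ _
      rwa [R.α_α]
  have olda : R.Step (R.α a) (R.τ a) := by
    have := step_of_notMem (R := R) (a := R.α a) (by rwa [R.α_α])
    rwa [R.α_α] at this
  have oldc : R.Step (R.α c) (R.τ c) := by
    have := step_of_notMem (R := R) (a := R.α c) (by rwa [R.α_α])
    rwa [R.α_α] at this
  have step : ∀ z w, R.Step z w → z ≠ R.α a → z ≠ R.α c → z ≠ R.α (R.τ a) →
      z ≠ R.α (R.τ c) → R'.Step z w := by
    intro z w h e1 e2 e3 e4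
    have hne : ∀ y, z ≠ R.α y → R.α z ≠ y := fun y hy e => hy (by rw [← e, R.α_α])
    refine ⟨?_, h.2⟩
    change w = R'.τ (R.α z)
    rw [hR', smooth_τ_of_ne hbase (hne _ e3) (hne _ e4) (by rw [R.τ_τ]; exact hne _ e1)
      (by rw [R.τ_τ]; exact hne _ e2)]
    exact h.1
  have eb : R.Seg (R.τ a) (R.α (s v u)) := C.seg_end hv (ha.tail olda)
  have ed : R.Seg (R.τ c) (R.α (s v' u)) := C.seg_end hv' (hc.tail oldc)
  have suv : ∀ z, R.Seg (s u v) z → z ≠ R.α (R.τ a) ∧ z ≠ R.α (R.τ c) := fun z hz =>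
    ⟨fun e => hv.ne (C.unique hv hv.symm (e ▸ hz) hb).1,
      fun e => hv'.ne (C.unique hv hv'.symm (e ▸ hz) hd).1⟩
  have suv' : ∀ z, R.Seg (s u v') z → z ≠ R.α (R.τ a) ∧ z ≠ R.α (R.τ c) := fun z hz =>
    ⟨fun e => hv.ne (C.unique hv' hv.symm (e ▸ hz) hb).1,
      fun e => hv'.ne (C.unique hv' hv'.symm (e ▸ hz) hd).1⟩
  have key : R'.Seg (s u v') (R.α (s v u)) ∧ R'.Seg (s u v) (R.α (s v' u)) := by
    by_cases hvv : v = v'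
    · subst hvv
      rcases ha.total_right hc with h | h
      · rcases ReflTransGen.cases_head h with e | ⟨w, e1, e2⟩
        · exact absurd (by rw [← R.α_α a, e, R.α_α]) h1
        · obtain rfl := olda.right_unique e1
          have k : R'.Seg (s u v) (R.α (s v u)) := by
            refine (ReflTransGen.tail (Seg.mono_of ha ?_) stepa).trans (Seg.mono_of ed ?_)
            · intro z w hz hzw hw
              refine step z w hzw ?_ ?_ (suv z hz).1 (suv z hz).2
              · rintro rfl
                exact ha.acyclic (C.mem hv) hzw hw
              · rintro rfl
                exact hc.acyclic (C.mem hv) hzw (hw.trans h)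
            · intro z w hz hzw hw
              have hz' : R.Seg (R.τ a) z := (e2.tail oldc).trans hz
              refine step z w hzw ?_ ?_ (suv z ((ha.tail olda).trans hz')).1
                (suv z ((ha.tail olda).trans hz')).2
              · rintro rfl
                exact ha.acyclic (C.mem hv) olda hz'
              · rintro rfl
                exact hc.acyclic (C.mem hv) oldc hz
          exact ⟨k, k⟩
      · rcases ReflTransGen.cases_head h with e | ⟨w, e1, e2⟩
        · exact absurd (by rw [← R.α_α c, e, R.α_α]) h1
        · obtain rfl := oldc.right_unique e1
          have k : R'.Seg (s u v) (R.α (s v u)) := by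
            refine (ReflTransGen.tail (Seg.mono_of hc ?_) stepc).trans (Seg.mono_of eb ?_)
            · intro z w hz hzw hw
              refine step z w hzw ?_ ?_ (suv z hz).1 (suv z hz).2
              · rintro rfl
                exact ha.acyclic (C.mem hv) hzw (hw.trans h)
              · rintro rfl
                exact hc.acyclic (C.mem hv) hzw hw
            · intro z w hz hzw hw
              have hz' : R.Seg (R.τ c) z := (e2.tail olda).trans hz
              refine step z w hzw ?_ ?_ (suv z ((hc.tail oldc).trans hz')).1
                (suv z ((hc.tail oldc).trans hz')).2
              · rintro rfl
                exact ha.acyclic (C.mem hv) olda hz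
              · rintro rfl
                exact hc.acyclic (C.mem hv) oldc hz'
          exact ⟨k, k⟩
    · have sc : ∀ z, R.Seg (s u v) z → z ≠ R.α c := fun z hz e =>
        hvv (C.unique hv hv' (e ▸ hz) hc).2
      have sa : ∀ z, R.Seg (s u v') z → z ≠ R.α a := fun z hz e =>
        hvv (C.unique hv hv' ha (e ▸ hz)).2
      constructor
      · refine (ReflTransGen.tail (Seg.mono_of hc ?_) stepc).trans (Seg.mono_of eb ?_)
        · intro z w hz hzw hw
          refine step z w hzw (sa z hz) ?_ (suv' z hz).1 (suv' z hz).2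
          rintro rfl
          exact hc.acyclic (C.mem hv') hzw hw
        · intro z w hz hzw hw
          have hz' := (ha.tail olda).trans hz
          refine step z w hzw ?_ (sc z hz') (suv z hz').1 (suv z hz').2
          rintro rfl
          exact ha.acyclic (C.mem hv) olda hz
      · refine (ReflTransGen.tail (Seg.mono_of ha ?_) stepa).trans (Seg.mono_of ed ?_)
        · intro z w hz hzw hw
          refine step z w hzw ?_ (sc z hz) (suv z hz).1 (suv z hz).2
          rintro rfl
          exact ha.acyclic (C.mem hv) hzw hw
        · intro z w hz hzw hw
          have hz' := (hc.tail oldc).trans hz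
          refine step z w hzw (sa z hz') ?_ (suv' z hz').1 (suv' z hz').2
          rintro rfl
          exact hc.acyclic (C.mem hv') oldc hz
  refine ⟨R', fun x y => if x = u ∧ y = v then s u v' else if x = u ∧ y = v' then s u v
    else s x y, ⟨?_, ?_⟩, ?_⟩
  · intro x y hxy
    change R.base _ = R.ν x
    split_ifs with e1 e2
    · rw [e1.1, C.base_s u v' hv']
    · rw [e2.1, C.base_s u v hv]
    · exact C.base_s x y hxy
  · intro x y hxy
    have r1 := key.1.reverse
    have r2 := key.2.reverse
    change R'.Seg (R.α (R.α _)) (R.α _) at r1 r2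
    rw [R.α_α] at r1 r2
    change R'.Seg _ (R.α _)
    by_cases q1 : x = u ∧ y = v
    · obtain ⟨rfl, rfl⟩ := q1
      simpa [hv.ne'] using key.1
    by_cases q2 : x = u ∧ y = v'
    · obtain ⟨rfl, rfl⟩ := q2
      have : y ≠ v := fun e => q1 ⟨rfl, e⟩
      simpa [hv'.ne', this] using key.2
    by_cases q3 : y = u ∧ x = v
    · obtain ⟨rfl, rfl⟩ := q3
      simpa [hv.ne'] using r1
    by_cases q4 : y = u ∧ x = v'
    · obtain ⟨rfl, rfl⟩ := q4
      have : x ≠ v := fun e => q3 ⟨rfl, e⟩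
      simpa [hv'.ne', this] using r2
    rw [if_neg q1, if_neg q2, if_neg q3, if_neg q4]
    refine Seg.mono_of (C.seg x y hxy) fun z w hz hzw _ => step z w hzw ?_ ?_ ?_ ?_
    · rintro rfl
      exact q1 (C.unique hxy hv hz ha)
    · rintro rfl
      exact q2 (C.unique hxy hv' hz hc)
    · rintro rfl
      exact q3 (C.unique hxy hv.symm hz hb).symm
    · rintro rfl
      exact q4 (C.unique hxy hv'.symm hz hd).symm
  · refine smooth_crossing_ssubset hbase ?_ ?_ n4 ?_
    · rw [R.τ_τ]; exact n1.symm
    · rw [R.τ_τ]; exact n3.symm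
    · rwa [R.base_τ]

variable (R) in
/-- Trails of edges sharing an endpoint do not cross. -/
def Proper (s : V → V → D) (G : SimpleGraph V) : Prop :=
  ∀ a c, R.base c = R.base a → R.base a ∈ R.crossing → c ≠ a → c ≠ R.τ a →
    ∀ u v u' v', G.Adj u v → G.Adj u' v' → R.Seg (s u v) (R.α a) → R.Seg (s u' v') (R.α c) →
      u ≠ u'

theorem Carries.exists_proper [Finite N] (C : R.Carries s G) :
    ∃ (R' : Routing N D V) (s' : V → V → D), R'.Carries s' G ∧ R'.Proper s' G ∧
      R'.crossing.ncard ≤ R.crossing.ncard := by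
  induction hn : R.crossing.ncard using Nat.strong_induction_on generalizing R s with
  | _ n ih =>
    by_cases hP : R.Proper s G
    · exact ⟨R, s, C, hP, hn.le⟩
    · simp only [Proper, not_forall, not_not] at hP
      obtain ⟨a, c, h1, h2, h3, h4, u, v, u', v', h5, h6, h7, h8, rfl⟩ := hP
      obtain ⟨R', s', C', hlt⟩ := C.exists_smooth h1 h2 h3 h4 h5 h6 h7 h8
      have hlt' := Set.ncard_lt_ncard hlt (Set.toFinite _)
      obtain ⟨R'', s'', C'', hP, hle⟩ := ih _ (hn ▸ hlt') C' rfl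
      exact ⟨R'', s'', C'', hP, hle.trans (hn ▸ hlt'.le)⟩

end Routing

namespace Routing

variable {N D V : Type} [DecidableEq N] [Fintype D] (R : Routing N D V) (s : V → V → D)
  (G : SimpleGraph V)

/-- The nodes at which two trails of edges of `G` cross. -/
def usedCrossing : Set N :=
  {x | x ∈ R.crossing ∧ ∀ a, R.base a = x → ∃ u v, G.Adj u v ∧ R.Seg (s u v) (R.α a)}

variable {G}

/-- The trail of the dart `g` arrives at a crossing from the side of the dart `a`. -/
def Arrives (g : G.Dart) (a : D) : Prop :=
  R.base a ∈ R.usedCrossing s G ∧ R.Seg (s g.fst g.snd) (R.α a)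

/-- `d` is on the trail of `g`, not after the crossing of `g`, if any. -/
def FirstHalf (g : G.Dart) (d : D) : Prop :=
  R.Seg (s g.fst g.snd) d ∧ ∀ a, R.Arrives s g a → R.Seg d (R.α a)

open Classical in
/-- The chain on the darts of the planar map induced by a chain on the darts of `G`. -/
noncomputable def extend (c : G.Dart → ZMod 2) (d : D) : ZMod 2 :=
  if h : ∃ g : G.Dart, R.FirstHalf s g d ∨ R.FirstHalf s g (R.α d) then c h.choose else 0

variable {R s}

theorem usedCrossing_mono {G' : SimpleGraph V} (h : G' ≤ G) :
    R.usedCrossing s G' ⊆ R.usedCrossing s G := fun _ hx =>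
  ⟨hx.1, fun a ha => let ⟨u, v, h1, h2⟩ := hx.2 a ha; ⟨u, v, h h1, h2⟩⟩

theorem Arrives.notMem {g : G.Dart} {a : D} (h : R.Arrives s g a) :
    R.base a ∉ Set.range R.ν := h.1.1.1

theorem Arrives.τ_eq {g : G.Dart} {a : D} (h : R.Arrives s g a) : R.τ a = R.r (R.r a) :=
  h.1.1.2 a rfl

theorem Arrives.step {g : G.Dart} {a : D} (h : R.Arrives s g a) :
    R.Step (R.α a) (R.τ a) := by
  have := step_of_notMem (R := R) (a := R.α a) (by rw [R.α_α]; exact h.notMem)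
  rwa [R.α_α] at this

theorem exists_arrives {a : D} (h : R.base a ∈ R.usedCrossing s G) :
    ∃ g : G.Dart, R.Arrives s g a :=
  let ⟨u, v, h1, h2⟩ := h.2 a rfl
  ⟨⟨(u, v), h1⟩, h, h2⟩

theorem Carries.mem_dart (C : R.Carries s G) (g : G.Dart) :
    R.base (s g.fst g.snd) ∈ Set.range R.ν := C.mem g.adj

theorem Carries.unique_dart (C : R.Carries s G) {g h : G.Dart} {d : D}
    (hd : R.Seg (s g.fst g.snd) d) (hd' : R.Seg (s h.fst h.snd) d) : g = h :=
  let ⟨h1, h2⟩ := C.unique g.adj h.adj hd hd'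
  SimpleGraph.Dart.ext _ _ (Prod.ext h1 h2)

theorem firstHalf_start (g : G.Dart) : R.FirstHalf s g (s g.fst g.snd) :=
  ⟨ReflTransGen.refl, fun _ h => h.2⟩

theorem extend_of_not {c : G.Dart → ZMod 2} {d : D}
    (h : ¬ ∃ g : G.Dart, R.FirstHalf s g d ∨ R.FirstHalf s g (R.α d)) : R.extend s c d = 0 :=
  dif_neg h

theorem Carries.arrives_symm (C : R.Carries s G) {g : G.Dart} {a : D} (h : R.Arrives s g a) :
    R.Arrives s g.symm (R.τ a) :=
  ⟨by rw [R.base_τ]; exact h.1, C.opposite g.adj h.notMem h.2⟩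

theorem Carries.reverse_dart (C : R.Carries s G)
    {g : G.Dart} {d : D} (h : R.Seg (s g.fst g.snd) d) :
    R.Seg (s g.symm.fst g.symm.snd) (R.α d) := C.reverse g.adj h

theorem Carries.firstHalf_α (C : R.Carries s G) {g h : G.Dart} {d : D} (hg : R.FirstHalf s g d)
    (hh : R.FirstHalf s h (R.α d)) : h = g.symm ∧ ∀ a, ¬ R.Arrives s g a := by
  have e : h = g.symm := C.unique_dart hh.1 (C.reverse_dart hg.1)
  subst e
  refine ⟨rfl, fun a ha => ?_⟩
  have h1 := hg.2 a ha
  have h2 := (hh.2 _ (C.arrives_symm ha)).reverse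
  rw [R.α_α, R.α_α] at h2
  exact ha.2.acyclic (C.mem_dart g) ha.step (h2.trans h1)

section Extend

variable {c : G.Dart → ZMod 2}

theorem Carries.extend_eq (C : R.Carries s G) (hc : ∀ g, (∀ a, ¬ R.Arrives s g a) → c g.symm = c g)
    {g : G.Dart} {d : D}
    (h : R.FirstHalf s g d ∨ R.FirstHalf s g (R.α d)) : R.extend s c d = c g := by
  have hex : ∃ g : G.Dart, R.FirstHalf s g d ∨ R.FirstHalf s g (R.α d) := ⟨g, h⟩
  rw [extend, dif_pos hex]
  rcases h with h | h <;> rcases hex.choose_spec with h' | h'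
  · rw [C.unique_dart h.1 h'.1]
  · obtain ⟨h1, h2⟩ := C.firstHalf_α h h'
    rw [h1, hc g h2]
  · obtain ⟨h1, h2⟩ := C.firstHalf_α h' h
    have h3 := hc _ h2
    rw [← h1] at h3
    exact h3.symm
  · rw [C.unique_dart h.1 h'.1]

theorem Carries.extend_α (C : R.Carries s G) (hc : ∀ g, (∀ a, ¬ R.Arrives s g a) → c g.symm = c g)
    (d : D) : R.extend s c (R.α d) = R.extend s c d := by
  by_cases h : ∃ g : G.Dart, R.FirstHalf s g d ∨ R.FirstHalf s g (R.α d)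
  · obtain ⟨g, h⟩ := h
    rw [C.extend_eq hc h, C.extend_eq hc (by rw [R.α_α]; exact h.symm)]
  · rw [extend_of_not h, extend_of_not]
    rintro ⟨g, h'⟩
    rw [R.α_α] at h'
    exact h ⟨g, h'.symm⟩

theorem Carries.extend_start (C : R.Carries s G) (hc : ∀ g, (∀ a, ¬ R.Arrives s g a) → c g.symm = c g)
    (g : G.Dart) : R.extend s c (s g.fst g.snd) = c g :=
  C.extend_eq hc (Or.inl (firstHalf_start g))

theorem Carries.extend_terminal (C : R.Carries s G) {d : D} (hd : R.base d ∈ Set.range R.ν)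
    (h : ∀ g : G.Dart, d ≠ s g.fst g.snd) : R.extend s c d = 0 := by
  refine extend_of_not ?_
  rintro ⟨g, h' | h'⟩
  · exact h g (h'.1.eq_of_mem hd).symm
  · have := C.reverse_dart h'.1
    rw [R.α_α] at this
    exact h g.symm (this.eq_of_mem hd).symm

theorem Carries.extend_arrives (C : R.Carries s G) (hc : ∀ g, (∀ a, ¬ R.Arrives s g a) → c g.symm = c g)
    {g : G.Dart} {a : D} (h : R.Arrives s g a)
    (huniq : ∀ g : G.Dart, ∀ a b, R.Arrives s g a → R.Arrives s g b → a = b) :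
    R.extend s c a = c g := by
  refine C.extend_eq hc (Or.inr ⟨h.2, fun b hb => ?_⟩)
  rw [huniq g a b h hb]
  exact ReflTransGen.refl

theorem Carries.extend_τ (C : R.Carries s G) (hc : ∀ g, (∀ a, ¬ R.Arrives s g a) → c g.symm = c g)
    {d : D} (hd : R.base d ∉ Set.range R.ν)
    (hx : R.base d ∉ R.usedCrossing s G) : R.extend s c (R.τ d) = R.extend s c d := by
  have key : ∀ e, R.base e ∉ Set.range R.ν → R.base e ∉ R.usedCrossing s G → ∀ g : G.Dart,
      (R.FirstHalf s g e ∨ R.FirstHalf s g (R.α e)) →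
      (R.FirstHalf s g (R.τ e) ∨ R.FirstHalf s g (R.α (R.τ e))) := by
    rintro e he hxe g (h | h)
    · right
      refine ⟨?_, fun a ha => ReflTransGen.head (step_into he) (h.2 a ha)⟩
      rcases ReflTransGen.cases_tail h.1 with h1 | ⟨z, h1, h2⟩
      · exact absurd (h1 ▸ C.mem_dart g) he
      · exact (h2.left_unique (step_into he)) ▸ h1
    · left
      have hstep : R.Step (R.α e) (R.τ e) := by
        have := step_of_notMem (R := R) (a := R.α e) (by rwa [R.α_α])
        rwa [R.α_α] at this
      refine ⟨h.1.tail hstep, fun a ha => ?_⟩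
      rcases ReflTransGen.cases_head (h.2 a ha) with h1 | ⟨z, h1, h2⟩
      · exact absurd ((by rw [← R.α_α e, h1, R.α_α] : e = a) ▸ ha.1) hxe
      · exact hstep.right_unique h1 ▸ h2
  by_cases h : ∃ g : G.Dart, R.FirstHalf s g d ∨ R.FirstHalf s g (R.α d)
  · obtain ⟨g, h⟩ := h
    rw [C.extend_eq hc h, C.extend_eq hc (key d hd hx g h)]
  · rw [extend_of_not h, extend_of_not]
    rintro ⟨g, h'⟩
    have := key (R.τ d) (by rwa [R.base_τ]) (by rwa [R.base_τ]) g h'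
    rw [R.τ_τ] at this
    exact h ⟨g, this⟩

end Extend

end Routing

namespace Routing

variable {N D V : Type} [DecidableEq N] [Fintype D] {R : Routing N D V} {s : V → V → D}
  {G : SimpleGraph V}

theorem sum_fiber {d : D} (hd : R.base d ∉ Set.range R.ν) (c : D → ZMod 2) :
    ∑ e with R.base e = R.base d, c e =
      c d + c (R.r d) + c (R.r (R.r d)) + c (R.r (R.r (R.r d))) := by
  classical
  have hr := base_r_notMem hd
  have hrr := base_r_notMem hr
  have : (Finset.univ.filter fun e => R.base e = R.base d) =
      {d, R.r d, R.r (R.r d), R.r (R.r (R.r d))} := by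
    ext e
    simp only [Finset.mem_filter, Finset.mem_univ, true_and, Finset.mem_insert,
      Finset.mem_singleton]
    refine ⟨fiber hd, ?_⟩
    rintro (rfl | rfl | rfl | rfl) <;> simp only [R.base_r]
  have h1 : d ∉ ({R.r d, R.r (R.r d), R.r (R.r (R.r d))} : Finset D) := by
    simpa using ⟨(r_ne hd).symm, (R.r_two_ne _ hd).symm, (r_three_ne hd).symm⟩
  have h2 : R.r d ∉ ({R.r (R.r d), R.r (R.r (R.r d))} : Finset D) := by
    simpa [-EmbeddingLike.apply_eq_iff_eq] using ⟨(r_ne hr).symm, (R.r_two_ne _ hr).symm⟩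
  have h3 : R.r (R.r d) ∉ ({R.r (R.r (R.r d))} : Finset D) := by
    simpa [-EmbeddingLike.apply_eq_iff_eq] using (r_ne hrr).symm
  rw [this, Finset.sum_insert h1, Finset.sum_insert h2, Finset.sum_insert h3,
    Finset.sum_singleton, add_assoc, add_assoc]

theorem Carries.extend_potential_τ (C : R.Carries s G) {c : G.Dart → ZMod 2}
    (hc : ∀ g, (∀ a, ¬ R.Arrives s g a) → c g.symm = c g) {w : D → ZMod 2}
    (hwα : ∀ d, w (R.α d) = w d + R.extend s c d)
    (hwr : ∀ d, w (R.r d) = w d + R.extend s c (R.r d)) {d : D} {g : G.Dart}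
    (hg : R.Seg (s g.fst g.snd) d) (hn : R.base (R.α d) ∉ Set.range R.ν)
    (hx : R.base (R.α d) ∉ R.usedCrossing s G) : w (R.τ (R.α d)) = w d := by
  have two : ∀ x y : ZMod 2, x + y + y = x := fun x y => by
    rw [add_assoc, CharTwo.add_self_eq_zero, add_zero]
  set e := R.α d with he
  have h1 : R.extend s c (R.τ e) = R.extend s c d := by
    rw [C.extend_τ hc hn hx, he, C.extend_α hc]
  have h2 : R.extend s c e = R.extend s c d := by rw [he, C.extend_α hc]
  rcases fiber (e := R.τ e) hn (R.base_τ e) with h | h | h | h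
  · exact absurd h (R.τ_ne e hn)
  · rw [h] at h1 ⊢
    rw [hwr, h1, he, hwα, two]
  · have hr := base_r_notMem hn
    have k1 := τ_r_of_opposite hn h
    have k2 : R.extend s c (R.r e) = 0 := by
      refine extend_of_not fun hex => hx ?_
      have hex' : ∃ h : G.Dart, R.Seg (s h.fst h.snd) (R.α (R.r e)) := by
        obtain ⟨h, h' | h'⟩ := hex
        · exact ⟨h.symm, C.reverse_dart h'.1⟩
        · exact ⟨h, h'.1⟩
      obtain ⟨h', hh'⟩ := hex'
      have ge : R.Seg (s g.fst g.snd) (R.α e) := by rw [he, R.α_α]; exact hg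
      refine ⟨⟨hn, fun a ha => ?_⟩, fun a ha => ?_⟩
      · rcases fiber hn ha with rfl | rfl | rfl | rfl
        · exact h
        · exact k1
        · rw [← h, R.τ_τ, h, R.r_four _ hn]
        · rw [← k1, R.τ_τ, k1, R.r_four _ hr]
      · rcases fiber hn ha with rfl | rfl | rfl | rfl
        · exact ⟨_, _, g.adj, ge⟩
        · exact ⟨_, _, h'.adj, hh'⟩
        · exact ⟨_, _, g.symm.adj, h ▸ C.opposite g.adj hn ge⟩
        · exact ⟨_, _, h'.symm.adj, k1 ▸ C.opposite h'.adj hr hh'⟩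
    rw [h] at h1 ⊢
    rw [hwr, h1, hwr, k2, add_zero, he, hwα, two]
  · have h3 : R.r (R.τ e) = e := by rw [h, R.r_four _ hn]
    have h4 := hwr (R.τ e)
    rw [h3, h2] at h4
    have h5 := hwα d
    rw [← he, h4] at h5
    exact add_right_cancel h5

theorem Carries.exists_potential [Fintype V] [DecidableEq V] [DecidableRel G.Adj]
    (C : R.Carries s G)
    (huniq : ∀ g : G.Dart, ∀ a b, R.Arrives s g a → R.Arrives s g b → a = b)
    {θ ρ : G.Dart → G.Dart} (hθu : ∀ g, (∀ a, ¬ R.Arrives s g a) → θ g = g.symm)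
    (hθ : ∀ g a, R.Arrives s g a → R.Arrives s (θ g) (R.r a))
    (hρ : ∀ g, ∃ k : ℕ, 0 < k ∧ (R.r ^ k) (s g.fst g.snd) = s (ρ g).fst (ρ g).snd ∧
      ∀ i, 0 < i → i < k →
        (R.r ^ i) (s g.fst g.snd) ∉ Set.range fun g : G.Dart => s g.fst g.snd)
    (c : G.Dart → ZMod 2) (hsum : ∀ v, ∑ g : G.Dart with g.fst = v, c g = 0)
    (h2 : ∀ g, (∀ a, ¬ R.Arrives s g a) → c g + c (θ g) = 0)
    (h4 : ∀ g a, R.Arrives s g a → c g + c (θ g) + c (θ (θ g)) + c (θ (θ (θ g))) = 0) :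
    ∃ w : G.Dart → ZMod 2, ∀ g, w (θ g) = w g + c g ∧ w (ρ g) = w g + c (ρ g) := by
  classical
  have hc : ∀ g, (∀ a, ¬ R.Arrives s g a) → c g.symm = c g := fun g hg => by
    have := h2 g hg
    rw [hθu g hg] at this
    exact (CharTwo.add_eq_zero.1 this).symm
  obtain ⟨w, hw⟩ := R.planar (R.extend s c) (C.extend_α hc) (by
    intro n
    by_cases hn : n ∈ Set.range R.ν
    · obtain ⟨v, rfl⟩ := hn
      rw [← hsum v]
      symm
      have hinj : Set.InjOn (fun g : G.Dart => s g.fst g.snd)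
          (Finset.univ.filter fun g : G.Dart => g.fst = v : Finset G.Dart) :=
        fun g _ h _ e => C.unique_dart (d := s g.fst g.snd) ReflTransGen.refl
          (by simp only at e; rw [e]; exact ReflTransGen.refl)
      rw [← Finset.sum_congr rfl fun g _ => C.extend_start hc g,
        ← Finset.sum_image (f := R.extend s c) hinj]
      refine Finset.sum_subset ?_ ?_
      · intro d hd
        obtain ⟨g, hg, rfl⟩ := Finset.mem_image.1 hd
        simp only [Finset.mem_filter, Finset.mem_univ, true_and] at hg ⊢
        rw [C.base_s _ _ g.adj, hg]
      · intro d hd hd'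
        simp only [Finset.mem_filter, Finset.mem_univ, true_and] at hd
        refine C.extend_terminal (by rw [hd]; exact ⟨v, rfl⟩) ?_
        rintro g rfl
        refine hd' (Finset.mem_image.2 ⟨g, ?_, rfl⟩)
        rw [C.base_s _ _ g.adj] at hd
        simpa using R.ν_inj hd
    by_cases hx : n ∈ R.usedCrossing s G
    · by_cases hd : ∃ d, R.base d = n
      · obtain ⟨d, rfl⟩ := hd
        obtain ⟨g, hg⟩ := exists_arrives hx
        rw [sum_fiber hn, ← h4 g d hg, C.extend_arrives hc hg huniq,
          C.extend_arrives hc (hθ _ _ hg) huniq, C.extend_arrives hc (hθ _ _ (hθ _ _ hg)) huniq,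
          C.extend_arrives hc (hθ _ _ (hθ _ _ (hθ _ _ hg))) huniq]
      · rw [Finset.filter_false_of_mem, Finset.sum_empty]
        exact fun d _ h => hd ⟨d, h⟩
    · refine Finset.sum_involution (fun d _ => R.τ d) ?_ ?_ ?_ ?_
      · intro d hd
        simp only [Finset.mem_filter, Finset.mem_univ, true_and] at hd
        subst hd
        rw [C.extend_τ hc hn hx, CharTwo.add_self_eq_zero]
      · intro d hd _
        simp only [Finset.mem_filter, Finset.mem_univ, true_and] at hd
        subst hd
        exact R.τ_ne d hn
      · intro d hd
        simp only [Finset.mem_filter, Finset.mem_univ, true_and] at hd ⊢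
        rw [R.base_τ, hd]
      · intro d _
        exact R.τ_τ d)
  have hwα := fun d => (hw d).1
  have hwr := fun d => (hw d).2
  have along : ∀ (g : G.Dart) (d : D), R.Seg (s g.fst g.snd) d → (∀ a, R.Arrives s g a → R.Seg d (R.α a)) →
      w d = w (s g.fst g.snd) := by
    intro g d hd
    induction hd with
    | refl => exact fun _ => rfl
    | @tail x y hx hxy ih =>
      intro hF
      rw [← ih fun a ha => ReflTransGen.head hxy (hF a ha), hxy.1]
      refine C.extend_potential_τ hc hwα hwr hx hxy.2 fun hX => ?_
      have ha : R.Arrives s g (R.α x) := ⟨hX, by rw [R.α_α]; exact hx⟩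
      have h := hF _ ha
      rw [R.α_α] at h
      exact Seg.acyclic hx (C.mem_dart g) hxy h
  refine ⟨fun g => w (s g.fst g.snd), fun g => ⟨?_, ?_⟩⟩
  · by_cases hg : ∃ a, R.Arrives s g a
    · obtain ⟨a, ha⟩ := hg
      have arr : ∀ h b, R.Arrives s h b → w b = w (s h.fst h.snd) + c h := by
        intro h b hb
        have h1 := hwα (R.α b)
        rw [R.α_α, C.extend_α hc, C.extend_arrives hc hb huniq, along h _ hb.2] at h1
        · exact h1
        · intro b' hb'
          rw [huniq h b b' hb hb']
          exact ReflTransGen.refl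
      have h1 := arr _ _ (hθ _ _ ha)
      rw [hwr, C.extend_arrives hc (hθ _ _ ha) huniq, arr _ _ ha] at h1
      exact (add_right_cancel h1).symm
    · have hg' : ∀ a, ¬ R.Arrives s g a := fun a ha => hg ⟨a, ha⟩
      have h1 := along g _ (C.seg g.fst g.snd g.adj) fun a ha => (hg' a ha).elim
      have h3 := hwα (R.α (s g.snd g.fst))
      rw [R.α_α, C.extend_α hc, h1] at h3
      have h5 := C.extend_start hc g.symm
      change R.extend s c (s g.snd g.fst) = _ at h5
      rw [h5, hc g hg'] at h3
      dsimp only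
      rw [hθu g hg']
      exact h3
  · obtain ⟨k, hk0, hk, hkmin⟩ := hρ g
    have hmem : ∀ i : ℕ, R.base ((R.r ^ i) (s g.fst g.snd)) ∈ Set.range R.ν := by
      intro i
      induction i with
      | zero => exact C.mem_dart g
      | succ i ih => rwa [pow_succ', Equiv.Perm.mul_apply, R.base_r]
    have hi : ∀ i, i < k → w ((R.r ^ i) (s g.fst g.snd)) = w (s g.fst g.snd) := by
      intro i hi
      induction i with
      | zero => rfl
      | succ i ih =>
        have h1 := hkmin (i + 1) (by omega) hi
        have h2 := hmem (i + 1)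
        rw [pow_succ', Equiv.Perm.mul_apply] at h1 h2 ⊢
        rw [hwr, C.extend_terminal h2 fun h e => h1 ⟨h, e.symm⟩, ih (by omega), add_zero]
    obtain ⟨j, rfl⟩ : ∃ j, k = j + 1 := ⟨k - 1, by omega⟩
    have h1 := hi j (by omega)
    dsimp only
    rw [← hk, pow_succ', Equiv.Perm.mul_apply, hwr, h1, ← Equiv.Perm.mul_apply, ← pow_succ', hk,
      C.extend_start hc]

end Routing

theorem three_le_of_sameCycle {D : Type*} [Fintype D] [DecidableEq D] (ρ : Equiv.Perm D) (g : D)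
    (P : D → Prop) [DecidablePred P] (hP : ∀ h, P h → ρ.SameCycle g h)
    (hcard : 3 ≤ (Finset.univ.filter P).card) : ρ g ≠ g ∧ ρ (ρ g) ≠ g := by
  have key : ρ (ρ g) ≠ g := by
    intro h2
    have hsub : Finset.univ.filter P ⊆ {g, ρ g} := by
      intro h hh
      obtain ⟨n, rfl⟩ := exists_pow_eq_of_sameCycle ρ (p := 2) (by norm_num)
        (by simpa [pow_succ] using h2) (hP h (by simpa using hh))
      clear hh
      induction n with
      | zero => simp
      | succ n ih =>
        rw [pow_succ', Equiv.Perm.mul_apply]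
        simp only [Finset.mem_insert, Finset.mem_singleton] at ih ⊢
        rcases ih with h | h <;> rw [h]
        · simp
        · simp [h2]
    have := (hcard.trans (Finset.card_le_card hsub)).trans Finset.card_le_two
    omega
  exact ⟨fun h => key (by rw [h, h]), key⟩

namespace Routing

variable {N D V : Type} [DecidableEq N] [Fintype D] {R : Routing N D V} {s : V → V → D}
  {G : SimpleGraph V}

theorem Carries.arrives_unique (C : R.Carries s G) (P : R.Proper s G)
    (hone : ∀ (g : G.Dart) (a c : D), R.Arrives s g a → R.Arrives s g c → R.base a = R.base c)
    (g : G.Dart) (a c : D) (ha : R.Arrives s g a) (hc : R.Arrives s g c) : a = c := by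
  by_contra hne
  have hb := hone g a c ha hc
  by_cases h : c = R.τ a
  · subst h
    have := C.unique_dart (C.arrives_symm ha).2 hc.2
    exact g.symm_ne this
  · exact P a c hb.symm ha.1.1 (Ne.symm hne) h _ _ _ _ g.adj g.adj ha.2 hc.2 rfl

theorem exists_theta (s : V → V → D) (g : G.Dart) : ∃ h : G.Dart,
    ((∀ a, ¬ R.Arrives s g a) → h = g.symm) ∧ ∀ a, R.Arrives s g a →
      (∀ b, R.Arrives s g b → a = b) → R.Arrives s h (R.r a) := by
  by_cases hg : ∃ a, R.Arrives s g a
  · obtain ⟨a, ha⟩ := hg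
    obtain ⟨h, hh⟩ := exists_arrives (R := R) (s := s) (a := R.r a) (by rw [R.base_r]; exact ha.1)
    refine ⟨h, fun h' => absurd ha (h' a), fun b _ hb' => ?_⟩
    rw [hb' a ha]
    exact hh
  · exact ⟨g.symm, fun _ => rfl, fun a ha => absurd ⟨a, ha⟩ hg⟩

theorem Carries.exists_onePlaneMap [Fintype V] [DecidableEq V] [DecidableRel G.Adj]
    (C : R.Carries s G) (P : R.Proper s G)
    (hone : ∀ (g : G.Dart) (a c : D), R.Arrives s g a → R.Arrives s g c → R.base a = R.base c)
    (hdeg : ∀ g : G.Dart, 3 ≤ G.degree g.fst) :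
    ∃ M : OnePlaneMap G, ∀ g, M.crossed g ↔ ∃ a, R.Arrives s g a := by
  classical
  have huniq := C.arrives_unique P hone
  choose θ hθu hθ using exists_theta (R := R) (G := G) s
  replace hθ : ∀ g a, R.Arrives s g a → R.Arrives s (θ g) (R.r a) := fun g a ha =>
    hθ g a ha fun b hb => huniq g a b ha hb
  have htwo : ∀ g, (∃ a, R.Arrives s g a) → θ (θ g) = g.symm := by
    rintro g ⟨a, ha⟩
    refine C.unique_dart (hθ _ _ (hθ _ _ ha)).2 ?_
    rw [← ha.τ_eq]
    exact (C.arrives_symm ha).2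
  have hsymm : ∀ g : G.Dart, (∃ a, R.Arrives s g a) → ∃ a, R.Arrives s g.symm a :=
    fun g ⟨a, ha⟩ => ⟨_, C.arrives_symm ha⟩
  have hsymm' : ∀ g : G.Dart, (∃ a, R.Arrives s g.symm a) → ∃ a, R.Arrives s g a := by
    intro g hg
    have := hsymm _ hg
    rwa [SimpleGraph.Dart.symm_symm] at this
  have hcr : ∀ g, (∃ a, R.Arrives s (θ g) a) ↔ ∃ a, R.Arrives s g a := by
    intro g
    refine ⟨fun h => ?_, fun ⟨a, ha⟩ => ⟨_, hθ _ _ ha⟩⟩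
    by_contra hg
    rw [hθu g fun a ha => hg ⟨a, ha⟩] at h
    exact hg (hsymm' g h)
  have hinj : Function.Injective θ := by
    intro g h e
    by_cases hg : ∃ a, R.Arrives s g a
    · have hh : ∃ a, R.Arrives s h a := by rw [← hcr, ← e, hcr]; exact hg
      have := congrArg θ e
      rw [htwo g hg, htwo h hh] at this
      exact SimpleGraph.Dart.symm_involutive.injective this
    · have hh : ¬ ∃ a, R.Arrives s h a := by rw [← hcr, ← e, hcr]; exact hg
      rw [hθu g fun a ha => hg ⟨a, ha⟩, hθu h fun a ha => hh ⟨a, ha⟩] at e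
      exact SimpleGraph.Dart.symm_involutive.injective e
  have hsinj : Function.Injective fun g : G.Dart => s g.fst g.snd := fun g h e =>
    C.unique_dart (d := s g.fst g.snd) ReflTransGen.refl
      (by dsimp only at e; rw [e]; exact ReflTransGen.refl)
  obtain ⟨ρ, hρ, hρc⟩ := exists_firstReturn R.r (fun g : G.Dart => s g.fst g.snd) hsinj
    fun g => ⟨orderOf R.r, orderOf_pos _, by rw [pow_orderOf_eq_one]; rfl⟩
  have hpow : ∀ (k : ℕ) d, R.base ((R.r ^ k) d) = R.base d := by
    intro k d
    induction k with
    | zero => rfl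
    | succ k ih => rw [pow_succ', Equiv.Perm.mul_apply, R.base_r, ih]
  have hfst : ∀ g, (ρ g).fst = g.fst := by
    intro g
    obtain ⟨k, _, hk, _⟩ := hρ g
    apply R.ν_inj
    rw [← C.base_s _ _ (ρ g).adj, ← C.base_s _ _ g.adj, ← hk, hpow]
  have hthree : ∀ g, ρ g ≠ g ∧ ρ (ρ g) ≠ g := by
    intro g
    refine three_le_of_sameCycle ρ g (fun h => h.fst = g.fst) (fun h hh => hρc _ _ ?_) ?_
    · apply R.sameCycle
      rw [C.base_s _ _ g.adj, C.base_s _ _ h.adj, hh]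
    · rw [G.dart_fst_fiber_card_eq_degree]
      exact hdeg g
  have hprop : ∀ g, (∃ a, R.Arrives s g a) → (θ g).fst ≠ g.fst ∧ (θ g).fst ≠ g.snd := by
    rintro g ⟨a, ha⟩
    have h1 := hθ g a ha
    have hn := ha.notMem
    have hr := base_r_notMem hn
    constructor
    · refine (P a (R.r a) (R.base_r a) ha.1.1 (r_ne hn) ?_ _ _ _ _ g.adj (θ g).adj
        ha.2 h1.2).symm
      rw [ha.τ_eq]
      exact (r_ne hr).symm
    · have h2 := C.arrives_symm ha
      refine (P (R.τ a) (R.r a) (by rw [R.base_r, R.base_τ]) h2.1.1 ?_ ?_ _ _ _ _ g.symm.adj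
        (θ g).adj h2.2 h1.2).symm
      · rw [ha.τ_eq]
        exact (r_ne hr).symm
      · rw [R.τ_τ]
        exact r_ne hn
  refine ⟨{
    ρ := ρ
    θ := Equiv.ofBijective θ (Finite.injective_iff_bijective.1 hinj)
    crossed := fun g => ∃ a, R.Arrives s g a
    fst_ρ := hfst
    ρ_ne := fun g => (hthree g).1
    ρ_ρ_ne := fun g => (hthree g).2
    θ_uncrossed := fun g hg => hθu g fun a ha => hg ⟨a, ha⟩
    θ_crossed := htwo
    crossed_θ := hcr
    fst_θ_ne := hprop
    planar := ?_ }, fun _ => Iff.rfl⟩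
  intro c h1 h2 h4
  exact C.exists_potential huniq hθu hθ hρ c h1
    (fun g hg => h2 g fun ⟨a, ha⟩ => hg a ha) (fun g a ha => h4 g ⟨a, ha⟩)

end Routing

open Classical in
/-- The ordered pairs of adjacent vertices. -/
noncomputable def adjPairs {V : Type} [Fintype V] (G : SimpleGraph V) : Finset (V × V) :=
  Finset.univ.filter fun p => G.Adj p.1 p.2

/-- The spanning subgraph of the edges with both ends in `W`. -/
def restrict {V : Type} (G : SimpleGraph V) (W : Finset V) : SimpleGraph V where
  Adj a b := G.Adj a b ∧ a ∈ W ∧ b ∈ W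
  symm := ⟨fun _ _ h => ⟨h.1.symm, h.2.2, h.2.1⟩⟩
  loopless := ⟨fun _ h => h.1.ne rfl⟩

theorem restrict_le {V : Type} (G : SimpleGraph V) (W : Finset V) : restrict G W ≤ G :=
  fun _ _ h => h.1

theorem card_adjPairs {V : Type} [Fintype V] [DecidableEq V] (G : SimpleGraph V)
    [DecidableRel G.Adj] : (adjPairs G).card = Fintype.card G.Dart := by
  classical
  rw [← Finset.card_univ, ← Finset.card_image_of_injective _ SimpleGraph.Dart.toProd_injective]
  congr 1
  ext p
  simp only [adjPairs, Finset.mem_filter, Finset.mem_univ, true_and, Finset.mem_image]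
  exact ⟨fun h => ⟨⟨p, h⟩, rfl⟩, by rintro ⟨g, rfl⟩; exact g.adj⟩

theorem _root_.NoFourCycle.mono {V : Type} {G G' : SimpleGraph V} (h : NoFourCycle G) (hle : G' ≤ G) :
    NoFourCycle G' := fun a b c d h1 h2 k1 k2 k3 k4 =>
  h a b c d h1 h2 (hle k1) (hle k2) (hle k3) (hle k4)

theorem card_adjPairs_restrict_erase {V : Type} [Fintype V] [DecidableEq V] (G : SimpleGraph V)
    [DecidableRel G.Adj] {W : Finset V} (hW : ∀ u v, G.Adj u v → u ∈ W) (w : V) :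
    (adjPairs G).card ≤ (adjPairs (restrict G (W.erase w))).card + 2 * G.degree w := by
  have hsub : adjPairs G ⊆ adjPairs (restrict G (W.erase w)) ∪
      ((G.neighborFinset w).image (fun v => (w, v)) ∪
        (G.neighborFinset w).image (fun v => (v, w))) := by
    rintro ⟨a, b⟩ h
    simp only [adjPairs, Finset.mem_filter, Finset.mem_univ, true_and, restrict, Finset.mem_union,
      Finset.mem_image, SimpleGraph.mem_neighborFinset, Finset.mem_erase, Prod.mk.injEq] at h ⊢
    by_cases ha : a = w
    · subst ha
      exact Or.inr (Or.inl ⟨b, h, rfl, rfl⟩)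
    by_cases hb : b = w
    · subst hb
      exact Or.inr (Or.inr ⟨a, h.symm, rfl, rfl⟩)
    exact Or.inl ⟨h, ⟨ha, hW _ _ h⟩, hb, hW _ _ h.symm⟩
  have h1 := (Finset.card_le_card hsub).trans (Finset.card_union_le _ _)
  have h2 := Finset.card_union_le ((G.neighborFinset w).image (fun v => (w, v)))
    ((G.neighborFinset w).image (fun v => (v, w)))
  have h3 := Finset.card_image_le (s := G.neighborFinset w) (f := fun v => (w, v))
  have h4 := Finset.card_image_le (s := G.neighborFinset w) (f := fun v => (v, w))
  rw [G.card_neighborFinset_eq_degree] at h3 h4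
  omega

theorem adjPairs_mono {V : Type} [Fintype V] {G G' : SimpleGraph V} (h : G' ≤ G) :
    adjPairs G' ⊆ adjPairs G := by
  intro p hp
  simp only [adjPairs, Finset.mem_filter, Finset.mem_univ, true_and] at hp ⊢
  exact h hp

theorem card_adjPairs_deleteEdges {V : Type} [Fintype V] [DecidableEq V] (G : SimpleGraph V)
    (u v : V) : (adjPairs G).card ≤ (adjPairs (G.deleteEdges {s(u, v)})).card + 2 := by
  have hsub : adjPairs G ⊆ adjPairs (G.deleteEdges {s(u, v)}) ∪ {(u, v), (v, u)} := by
    rintro ⟨a, b⟩ h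
    simp only [adjPairs, Finset.mem_filter, Finset.mem_univ, true_and, Finset.mem_union,
      SimpleGraph.deleteEdges_adj, Set.mem_singleton_iff, Sym2.eq_iff, Finset.mem_insert,
      Finset.mem_singleton, Prod.mk.injEq] at h ⊢
    tauto
  have h1 := (Finset.card_le_card hsub).trans (Finset.card_union_le _ _)
  have h2 : ({(u, v), (v, u)} : Finset (V × V)).card ≤ 2 := Finset.card_le_two
  omega

namespace Routing

variable {N D V : Type} [DecidableEq N] [Fintype D] {R : Routing N D V} {s : V → V → D}
  {G : SimpleGraph V}

theorem Proper.mono {G' : SimpleGraph V} (P : R.Proper s G) (h : G' ≤ G) : R.Proper s G' :=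
  fun a c h1 h2 h3 h4 u v u' v' h5 h6 h7 h8 =>
    P a c h1 h2 h3 h4 u v u' v' (h h5) (h h6) h7 h8

theorem Carries.card_crossed_le [Finite N] [Fintype V] [DecidableEq V] [DecidableRel G.Adj]
    (C : R.Carries s G) (F : Finset G.Dart) (hF : ∀ g ∈ F, ∃ a, R.Arrives s g a) :
    F.card ≤ 4 * (R.usedCrossing s G ∩ Set.range R.base).ncard := by
  classical
  rcases F.eq_empty_or_nonempty with rfl | ⟨g₀, hg₀⟩
  · simp
  have : Nonempty D := ⟨(hF g₀ hg₀).choose⟩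
  choose! a ha using hF
  have := Fintype.ofFinite N
  rw [Set.ncard_eq_toFinset_card', ← Finset.card_image_of_injOn (f := a)]
  · refine Finset.card_le_mul_card_image_of_maps_to (f := R.base) ?_ 4 ?_
    · intro d hd
      obtain ⟨g, hg, rfl⟩ := Finset.mem_image.1 hd
      exact Set.mem_toFinset.2 ⟨(ha g hg).1, a g, rfl⟩
    · intro n hn
      by_cases hex : ∃ d, R.base d = n
      · obtain ⟨d, rfl⟩ := hex
        have hd : R.base d ∉ Set.range R.ν := (Set.mem_toFinset.1 hn).1.1.1
        refine (Finset.card_le_card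
          (t := {d, R.r d, R.r (R.r d), R.r (R.r (R.r d))}) ?_).trans Finset.card_le_four
        intro e he
        simpa using fiber hd (Finset.mem_filter.1 he).2
      · rw [Finset.filter_false_of_mem]
        · simp
        · exact fun d _ h => hex ⟨d, h⟩
  · intro g hg h hh e
    exact C.unique_dart (ha g hg).2 (e ▸ (ha h hh).2)

theorem Carries.usedCrossing_deleteEdges [Finite N] (C : R.Carries s G) {g : G.Dart} {a c : D}
    (ha : R.Arrives s g a) (hc : R.Arrives s g c) (hne : R.base a ≠ R.base c) :
    (R.usedCrossing s (G.deleteEdges {s(g.fst, g.snd)}) ∩ Set.range R.base).ncard + 2 ≤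
      (R.usedCrossing s G ∩ Set.range R.base).ncard := by
  have hle : G.deleteEdges {s(g.fst, g.snd)} ≤ G := G.deleteEdges_le _
  have key : ∀ b, R.Arrives s g b →
      R.base b ∉ R.usedCrossing s (G.deleteEdges {s(g.fst, g.snd)}) := by
    intro b hb h
    obtain ⟨u, v, h1, h2⟩ := h.2 b rfl
    obtain ⟨rfl, rfl⟩ := C.unique (hle h1) g.adj h2 hb.2
    simp [SimpleGraph.deleteEdges_adj] at h1
  have hsub : R.usedCrossing s (G.deleteEdges {s(g.fst, g.snd)}) ∩ Set.range R.base ∪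
      {R.base a, R.base c} ⊆ R.usedCrossing s G ∩ Set.range R.base := by
    refine Set.union_subset (Set.inter_subset_inter_left _ (usedCrossing_mono hle)) ?_
    rintro x (rfl | rfl)
    · exact ⟨ha.1, a, rfl⟩
    · exact ⟨hc.1, c, rfl⟩
  have h1 := Set.ncard_le_ncard hsub (Set.toFinite _)
  rw [Set.ncard_union_eq ?_ (Set.toFinite _) (Set.toFinite _), Set.ncard_pair hne] at h1
  · exact h1
  · rw [Set.disjoint_right]
    rintro x (rfl | rfl)
    · exact fun h => key _ ha h.1
    · exact fun h => key _ hc h.1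

/-- The linear lower bound on the number of crossings. -/
theorem Carries.linear_bound [Finite N] [Fintype V] (C : R.Carries s G) (P : R.Proper s G)
    (hG : NoFourCycle G) (W : Finset V) (hW : ∀ u v, G.Adj u v → u ∈ W) :
    14 * (adjPairs G).card ≤ 65 * W.card + 14 * (R.usedCrossing s G ∩ Set.range R.base).ncard := by
  classical
  induction hn : (adjPairs G).card + W.card using Nat.strong_induction_on generalizing G W with
  | _ n ih =>
    by_cases hdeg : ∃ w ∈ W, G.degree w ≤ 2
    · obtain ⟨w, hw, hd⟩ := hdeg
      have hle := restrict_le G (W.erase w)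
      have h1 := card_adjPairs_restrict_erase G hW w
      have h2 := Finset.card_le_card (adjPairs_mono hle)
      have h3 := Finset.card_erase_add_one hw
      have h4 := ih _ (by omega) (C.mono hle) (P.mono hle) (hG.mono hle) (W.erase w)
        (fun u v h => h.2.1) rfl
      have h5 := Set.ncard_le_ncard (Set.inter_subset_inter_left (Set.range R.base)
        (usedCrossing_mono (R := R) (s := s) hle)) (Set.toFinite _)
      omega
    by_cases hone : ∀ (g : G.Dart) (a c : D), R.Arrives s g a → R.Arrives s g c →
        R.base a = R.base c
    · obtain ⟨M, hM⟩ := C.exists_onePlaneMap P hone fun g => by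
        by_contra h
        exact hdeg ⟨g.fst, hW _ _ g.adj, by omega⟩
      have h1 := M.card_dart_bound hG W fun g => hW _ _ g.adj
      have h2 := C.card_crossed_le (Finset.univ.filter fun g => M.crossed g)
        fun g hg => (hM g).1 (by simpa using hg)
      have h3 : ∑ g, OnePlaneMap.ind (M.crossed g) =
          ((Finset.univ.filter fun g => M.crossed g).card : ℚ) := by
        rw [Finset.card_filter, Nat.cast_sum]
        refine Finset.sum_congr rfl fun g _ => ?_
        by_cases h : M.crossed g
        · rw [OnePlaneMap.ind_pos h, if_pos h, Nat.cast_one]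
        · rw [OnePlaneMap.ind_neg h, if_neg h, Nat.cast_zero]
      rw [h3, ← card_adjPairs] at h1
      have h4 : 28 * (adjPairs G).card ≤
          130 * W.card + 7 * (Finset.univ.filter fun g => M.crossed g).card := by
        exact_mod_cast h1
      omega
    · push Not at hone
      obtain ⟨g, a, c, ha, hc, hne⟩ := hone
      have hle : G.deleteEdges {s(g.fst, g.snd)} ≤ G := G.deleteEdges_le _
      have h1 := card_adjPairs_deleteEdges G g.fst g.snd
      have h2 : (adjPairs (G.deleteEdges {s(g.fst, g.snd)})).card < (adjPairs G).card := by
        refine Finset.card_lt_card (Finset.ssubset_iff_subset_ne.2 ⟨adjPairs_mono hle, ?_⟩)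
        intro e
        have h3 : (g.fst, g.snd) ∈ adjPairs G := by simp [adjPairs]
        rw [← e] at h3
        simp [adjPairs, SimpleGraph.deleteEdges_adj] at h3
      have h3 := C.usedCrossing_deleteEdges ha hc hne
      have h4 := ih _ (by omega) (C.mono hle) (P.mono hle) (hG.mono hle) W
        (fun u v h => hW u v (hle h)) rfl
      omega

end Routing

section Sampling

variable {V : Type} [Fintype V] [DecidableEq V]

/-- The probability that a random set is `W`. -/
noncomputable def weight (p : ℝ) (W : Finset V) : ℝ :=
  p ^ W.card * (1 - p) ^ (Finset.univ \ W).card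

theorem weight_nonneg {p : ℝ} (hp0 : 0 ≤ p) (hp1 : p ≤ 1) (W : Finset V) : 0 ≤ weight p W :=
  mul_nonneg (pow_nonneg hp0 _) (pow_nonneg (by linarith) _)

theorem sum_weight (p : ℝ) (S : Finset V) :
    ∑ W : Finset V, (if S ⊆ W then weight p W else 0) = p ^ S.card := by
  have h := Finset.prod_add (fun _ : V => p) (fun i => if i ∈ S then 0 else 1 - p) Finset.univ
  rw [Finset.powerset_univ] at h
  rw [← Finset.sum_congr rfl fun W _ => ?_, ← h]
  · rw [← Finset.prod_subset (Finset.subset_univ S)]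
    · rw [Finset.prod_congr rfl fun i hi => by rw [if_pos hi, add_zero], Finset.prod_const]
    · intro i _ hi
      rw [if_neg hi]
      ring
  · rw [Finset.prod_const]
    split_ifs with hS
    · rw [weight, Finset.prod_congr rfl fun i hi => if_neg fun h =>
        (Finset.mem_sdiff.1 hi).2 (hS h), Finset.prod_const]
    · obtain ⟨i, hi, hiW⟩ := Finset.not_subset.1 hS
      have : ∏ i ∈ Finset.univ \ W, (if i ∈ S then 0 else 1 - p) = 0 :=
        Finset.prod_eq_zero (i := i) (by simp [hiW]) (if_pos hi)
      rw [this, mul_zero]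

theorem sum_weight_card {ι : Type*} (p : ℝ) (T : Finset ι) (S : ι → Finset V) {k : ℕ}
    (hS : ∀ i ∈ T, (S i).card = k) :
    ∑ W : Finset V, weight p W * ((T.filter fun i => S i ⊆ W).card : ℝ) = T.card * p ^ k := by
  have : ∀ W : Finset V, weight p W * ((T.filter fun i => S i ⊆ W).card : ℝ) =
      ∑ i ∈ T, if S i ⊆ W then weight p W else 0 := by
    intro W
    rw [← Finset.sum_filter, Finset.sum_const, nsmul_eq_mul, mul_comm]
  rw [Finset.sum_congr rfl fun W _ => this W, Finset.sum_comm,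
    Finset.sum_congr rfl fun i hi => (sum_weight p (S i)).trans (by rw [hS i hi]),
    Finset.sum_const, nsmul_eq_mul]

end Sampling

namespace Routing

variable {N D V : Type} [DecidableEq N] [Fintype D] {R : Routing N D V} {s : V → V → D}
  {G : SimpleGraph V}

theorem Carries.exists_ends [DecidableEq V] (C : R.Carries s G) (P : R.Proper s G) {x : N}
    (hx : x ∈ R.usedCrossing s G ∩ Set.range R.base) : ∃ S : Finset V, S.card = 4 ∧
      ∀ W : Finset V, x ∈ R.usedCrossing s (restrict G W) → S ⊆ W := by
  obtain ⟨hx, a, rfl⟩ := hx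
  have hn := hx.1.1
  have hr := base_r_notMem hn
  obtain ⟨g, hg⟩ := exists_arrives hx
  obtain ⟨h, hh⟩ := exists_arrives (R := R) (s := s) (a := R.r a) (by rw [R.base_r]; exact hx)
  have hg' := C.arrives_symm hg
  have hh' := C.arrives_symm hh
  have e1 := hg.τ_eq
  have e2 := hh.τ_eq
  have n1 := r_ne hn
  have n2 := R.r_two_ne a hn
  have n3 := r_three_ne hn
  have n4 : R.r (R.r a) ≠ R.r a := r_ne hr
  have n5 : R.r (R.r (R.r a)) ≠ R.r a := R.r_two_ne _ hr
  have key : ∀ {g h : G.Dart} {a c : D}, R.Arrives s g a → R.Arrives s h c →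
      R.base c = R.base a → c ≠ a → c ≠ R.τ a → g.fst ≠ h.fst := fun ha hc h1 h2 h3 =>
    P _ _ h1 ha.1.1 h2 h3 _ _ _ _ (SimpleGraph.Dart.adj _) (SimpleGraph.Dart.adj _) ha.2 hc.2
  refine ⟨{g.fst, g.snd, h.fst, h.snd}, ?_, fun W hW => ?_⟩
  · have k1 : g.fst ≠ g.snd := g.adj.ne
    have k2 : h.fst ≠ h.snd := h.adj.ne
    have k3 : g.fst ≠ h.fst := key hg hh (R.base_r a) n1 (by rw [e1]; exact n4.symm)
    have k4 : g.fst ≠ h.snd := key hg hh' (by rw [R.base_τ, R.base_r]) (by rw [e2]; exact n3)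
      (by rw [e1, e2]; exact r_ne (base_r_notMem hr))
    have k5 : g.snd ≠ h.fst := key hg' hh (by rw [R.base_τ, R.base_r])
      (by rw [e1]; exact n4.symm) (by rw [R.τ_τ]; exact n1)
    have k6 : g.snd ≠ h.snd := key hg' hh' (by rw [R.base_τ, R.base_τ, R.base_r])
      (by rw [e1, e2]; exact r_ne (base_r_notMem hr)) (by rw [R.τ_τ, e2]; exact n3)
    rw [Finset.card_insert_of_notMem, Finset.card_insert_of_notMem, Finset.card_pair k2] <;>
      simp [*]
  · have mem : ∀ {g : G.Dart} {c : D}, R.base c = R.base a → R.Arrives s g c → g.fst ∈ W ∧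
        g.snd ∈ W := by
      intro g c hc hgc
      obtain ⟨u, v, h1, h2⟩ := hW.2 c hc
      obtain ⟨rfl, rfl⟩ := C.unique h1.1 g.adj h2 hgc.2
      exact h1.2
    obtain ⟨m1, m2⟩ := mem rfl hg
    obtain ⟨m3, m4⟩ := mem (R.base_r a) hh
    intro v hv
    simp only [Finset.mem_insert, Finset.mem_singleton] at hv
    rcases hv with rfl | rfl | rfl | rfl <;> assumption

theorem Carries.sampling_bound [Finite N] [Fintype V] (C : R.Carries s G) (P : R.Proper s G)
    (hG : NoFourCycle G) {p : ℝ} (hp0 : 0 ≤ p) (hp1 : p ≤ 1) :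
    14 * ((adjPairs G).card * p ^ 2) ≤ 65 * (Fintype.card V * p) +
      14 * (R.crossing.ncard * p ^ 4) := by
  classical
  have := Fintype.ofFinite N
  choose! S hS hSW using fun (x : N) (hx : x ∈ R.usedCrossing s G ∩ Set.range R.base) =>
    C.exists_ends P hx
  set X := (R.usedCrossing s G ∩ Set.range R.base).toFinset with hX
  have h1 := sum_weight_card p (adjPairs G) (fun e : V × V => ({e.1, e.2} : Finset V)) (k := 2)
    (by
      intro e he
      simp only [adjPairs, Finset.mem_filter] at he
      exact Finset.card_pair he.2.ne)
  have h2 := sum_weight_card p (Finset.univ : Finset V) (fun v => ({v} : Finset V)) (k := 1)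
    (fun _ _ => rfl)
  have h3 := sum_weight_card p X S (k := 4) (fun x hx => hS x (Set.mem_toFinset.1 hx))
  rw [pow_one, Finset.card_univ] at h2
  have h4 : (X.card : ℝ) ≤ R.crossing.ncard := by
    rw [hX, ← Set.ncard_eq_toFinset_card']
    exact_mod_cast Set.ncard_le_ncard (s := R.usedCrossing s G ∩ Set.range R.base)
      (fun x hx => hx.1.1) (Set.toFinite _)
  have h5 : (X.card : ℝ) * p ^ 4 ≤ R.crossing.ncard * p ^ 4 :=
    mul_le_mul_of_nonneg_right h4 (by positivity)
  refine le_trans ?_ (add_le_add_right (mul_le_mul_of_nonneg_left h5 (by norm_num)) _)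
  rw [← h1, ← h2, ← h3, Finset.mul_sum, Finset.mul_sum, Finset.mul_sum, ← Finset.sum_add_distrib]
  refine Finset.sum_le_sum fun W _ => ?_
  have hle := restrict_le G W
  have h6 := (C.mono hle).linear_bound (P.mono hle) (hG.mono hle) W fun u v h => h.2.1
  have h7 : adjPairs (restrict G W) =
      (adjPairs G).filter fun e : V × V => ({e.1, e.2} : Finset V) ⊆ W := by
    ext e
    rw [Finset.mem_filter, adjPairs, adjPairs, Finset.mem_filter, Finset.mem_filter]
    simp [restrict, Finset.insert_subset_iff]
  have h8 : (Finset.univ.filter fun v => ({v} : Finset V) ⊆ W) = W := by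
    ext v
    simp
  have h9 : (R.usedCrossing s (restrict G W) ∩ Set.range R.base).ncard ≤
      (X.filter fun x => S x ⊆ W).card := by
    rw [Set.ncard_eq_toFinset_card']
    refine Finset.card_le_card fun x hx => ?_
    rw [Set.mem_toFinset] at hx
    have hx' : x ∈ R.usedCrossing s G ∩ Set.range R.base := ⟨usedCrossing_mono hle hx.1, hx.2⟩
    exact Finset.mem_filter.2 ⟨Set.mem_toFinset.2 hx', hSW x hx' W hx.1⟩
  rw [h7] at h6
  rw [h8]
  have h10 : 14 * (((adjPairs G).filter fun e : V × V => ({e.1, e.2} : Finset V) ⊆ W).card : ℝ) ≤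
      65 * W.card + 14 * (X.filter fun x => S x ⊆ W).card := by
    exact_mod_cast h6.trans (by omega)
  have := mul_le_mul_of_nonneg_left h10 (weight_nonneg hp0 hp1 W)
  linarith

end Routing

/-- The crossing lemma, in terms of the number of ordered pairs of adjacent vertices. -/
theorem crossing_lemma_arith {n m x : ℝ} (hn : 0 < n) (hm : 3.483 * n ≤ m)
    (h : ∀ p : ℝ, 0 ≤ p → p ≤ 1 → 14 * (2 * m * p ^ 2) ≤ 65 * (n * p) + 14 * (x * p ^ 4)) :
    6272 * m ^ 3 ≤ 114075 * n ^ 2 * x := by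
  have hm0 : 0 < m := by linarith
  set p := 195 * n / (56 * m) with hp
  have hp0 : 0 < p := by positivity
  have hmp : m * p = 195 * n / 56 := by
    rw [hp]
    field_simp
  have h1 := h p hp0.le (by
    rw [hp, div_le_one (by positivity)]
    linarith)
  have h2 : 65 / 2 * n ≤ 14 * x * p ^ 3 := by
    refine le_of_mul_le_mul_right ?_ hp0
    have : 14 * (2 * m * p ^ 2) = 195 / 2 * n * p := by
      rw [show 14 * (2 * m * p ^ 2) = 28 * (m * p) * p by ring, hmp]
      ring
    nlinarith
  have h3 := mul_le_mul_of_nonneg_right h2 (pow_pos hm0 3).le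
  have h4 : 14 * x * p ^ 3 * m ^ 3 = 14 * x * (195 * n / 56) ^ 3 := by
    rw [← hmp]
    ring
  rw [h4] at h3
  refine le_of_mul_le_mul_right ?_ hn
  nlinarith

end PlanarHypermap

namespace PlanarHypermap

open Set

/-- A finite family of simple arcs in the plane, closed under reversal, whose arcs
meet only in a finite set `S` of points. -/
structure ArcSystem (E : Type) where
  S : Set (ℝ × ℝ)
  finite_S : S.Finite
  f : E → ℝ → ℝ × ℝ
  continuous_f : ∀ e, Continuous (f e)
  injOn_f : ∀ e, InjOn (f e) (Icc 0 1)
  symm : E → E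
  symm_symm : ∀ e, symm (symm e) = e
  symm_ne : ∀ e, symm e ≠ e
  f_symm : ∀ e t, f (symm e) t = f e (1 - t)
  zero_mem : ∀ e, f e 0 ∈ S
  eq_or_eq : ∀ e h s t, s ∈ Icc (0 : ℝ) 1 → t ∈ Icc (0 : ℝ) 1 → f e s ∉ S → f h t = f e s →
    h = e ∨ h = symm e

namespace ArcSystem

variable {E : Type} (A : ArcSystem E)

/-- The times at which an arc visits `S`. -/
def times (e : E) : Set ℝ := {t | t ∈ Icc 0 1 ∧ A.f e t ∈ A.S}

theorem finite_times (e : E) : (A.times e).Finite := by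
  refine Set.Finite.of_finite_image (f := A.f e) (A.finite_S.subset ?_)
    ((A.injOn_f e).mono fun t ht => ht.1)
  rintro _ ⟨t, ht, rfl⟩
  exact ht.2

theorem one_sub_mem_times {e : E} {t : ℝ} (h : t ∈ A.times e) : 1 - t ∈ A.times (A.symm e) := by
  refine ⟨⟨by linarith [h.1.2], by linarith [h.1.1]⟩, ?_⟩
  rw [A.f_symm, sub_sub_cancel]
  exact h.2

theorem one_sub_mem_times' {e : E} {t : ℝ} (h : t ∈ A.times (A.symm e)) :
    1 - t ∈ A.times e := by
  have := A.one_sub_mem_times h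
  rwa [A.symm_symm] at this

theorem zero_mem_times (e : E) : 0 ∈ A.times e := ⟨by simp, A.zero_mem e⟩

theorem one_mem_times (e : E) : 1 ∈ A.times e := by
  have := A.one_sub_mem_times' (A.zero_mem_times (A.symm e))
  rwa [sub_zero] at this

/-- `t` and `t'` are consecutive visits of `S`. -/
def IsNext (e : E) (t t' : ℝ) : Prop :=
  t ∈ A.times e ∧ t' ∈ A.times e ∧ t < t' ∧ ∀ u ∈ A.times e, t < u → t' ≤ u

variable {A}

theorem IsNext.symm {e : E} {t t' : ℝ} (h : A.IsNext e t t') :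
    A.IsNext (A.symm e) (1 - t') (1 - t) := by
  refine ⟨A.one_sub_mem_times h.2.1, A.one_sub_mem_times h.1, by linarith [h.2.2.1], ?_⟩
  intro u hu hlt
  by_contra hlt'
  have := h.2.2.2 _ (A.one_sub_mem_times' hu) (by linarith)
  linarith

theorem IsNext.unique {e : E} {t t' t'' : ℝ} (h : A.IsNext e t t') (h' : A.IsNext e t t'') :
    t' = t'' :=
  le_antisymm (h.2.2.2 _ h'.2.1 h'.2.2.1) (h'.2.2.2 _ h.2.1 h.2.2.1)

theorem IsNext.overlap {e : E} {t t' s s' u : ℝ} (h : A.IsNext e t t') (h' : A.IsNext e s s')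
    (hu : u ∈ Ioo t t') (hu' : u ∈ Ioo s s') : s = t ∧ s' = t' := by
  have : s = t := by
    rcases lt_trichotomy s t with h1 | h1 | h1
    · linarith [h'.2.2.2 _ h.1 h1, hu.1, hu'.2]
    · exact h1
    · linarith [h.2.2.2 _ h'.1 h1, hu.2, hu'.1]
  subst this
  exact ⟨rfl, h'.unique h⟩

theorem IsNext.Icc_subset {e : E} {t t' : ℝ} (h : A.IsNext e t t') : Icc t t' ⊆ Icc 0 1 :=
  Icc_subset_Icc h.1.1.1 h.2.1.1.2

theorem IsNext.notMem {e : E} {t t' u : ℝ} (h : A.IsNext e t t') (hu : u ∈ Ioo t t') :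
    A.f e u ∉ A.S := fun hS => by
  have := h.2.2.2 u ⟨h.Icc_subset (Ioo_subset_Icc_self hu), hS⟩ hu.1
  linarith [hu.2]

variable (A)

theorem exists_isNext {e : E} {t : ℝ} (ht : t ∈ A.times e) (h1 : t < 1) :
    ∃ t', A.IsNext e t t' := by
  obtain ⟨t', h2, h3⟩ := Set.exists_min_image (A.times e ∩ Ioi t) id
    ((A.finite_times e).inter_of_left _) ⟨1, A.one_mem_times e, h1⟩
  exact ⟨t', ht, h2.1, h2.2, fun u hu hlt => h3 u ⟨hu, hlt⟩⟩

theorem exists_isPrev {e : E} {t : ℝ} (ht : t ∈ A.times e) (h0 : 0 < t) :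
    ∃ t', A.IsNext e t' t := by
  obtain ⟨t', h⟩ := A.exists_isNext (A.one_sub_mem_times ht) (by linarith)
  have := h.symm
  rw [A.symm_symm, sub_sub_cancel] at this
  exact ⟨_, this⟩

/-- The segments of the arcs between consecutive visits of `S`. -/
def Piece : Type := {x : E × ℝ × ℝ // A.IsNext x.1 x.2.1 x.2.2}

instance [Finite E] : Finite A.Piece := by
  have := fun e => (A.finite_times e).to_subtype
  refine Finite.of_injective (β := Σ e : E, A.times e × A.times e)
    (fun d => ⟨d.1.1, ⟨_, d.2.1⟩, ⟨_, d.2.2.1⟩⟩) ?_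
  rintro ⟨⟨e, t, t'⟩, h⟩ ⟨⟨e', s, s'⟩, h'⟩ heq
  obtain ⟨rfl, h2⟩ := Sigma.mk.inj_iff.1 heq
  have h3 := eq_of_heq h2
  simp only [Prod.mk.injEq, Subtype.mk.injEq] at h3
  obtain ⟨rfl, rfl⟩ := h3
  rfl

variable {A}

theorem Piece.ext_of {d d' : A.Piece} (h : d'.1.1 = d.1.1) (h' : d'.1.2.1 = d.1.2.1) :
    d' = d := by
  obtain ⟨⟨e, t, t'⟩, hd⟩ := d
  obtain ⟨⟨e', s, s'⟩, hd'⟩ := d'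
  dsimp only at h h' hd hd'
  subst h h'
  obtain rfl := hd.unique hd'
  rfl

/-- The reversal of a piece. -/
def Piece.α (d : A.Piece) : A.Piece :=
  ⟨(A.symm d.1.1, 1 - d.1.2.2, 1 - d.1.2.1), d.2.symm⟩

theorem Piece.α_α (d : A.Piece) : d.α.α = d := by
  refine Piece.ext_of (A.symm_symm _) ?_
  simp [Piece.α]

/-- The initial point of a piece. -/
def Piece.base (d : A.Piece) : A.S := ⟨A.f d.1.1 d.1.2.1, d.2.1.2⟩

theorem Piece.base_α (d : A.Piece) : (d.α.base : ℝ × ℝ) = A.f d.1.1 d.1.2.2 := by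
  simp [Piece.α, Piece.base, A.f_symm]

theorem Piece.base_α_ne (d : A.Piece) : d.α.base ≠ d.base := fun h => by
  have h1 := congrArg Subtype.val h
  rw [Piece.base_α] at h1
  have := A.injOn_f _ d.2.2.1.1 d.2.1.1 h1
  exact d.2.2.2.1.ne' this

/-- The first third of a piece. -/
def Piece.first (d : A.Piece) : Set (ℝ × ℝ) :=
  A.f d.1.1 '' Icc d.1.2.1 (d.1.2.1 + (d.1.2.2 - d.1.2.1) / 3)

/-- The middle third of a piece. -/
def Piece.middle (d : A.Piece) : Set (ℝ × ℝ) :=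
  A.f d.1.1 '' Icc (d.1.2.1 + (d.1.2.2 - d.1.2.1) / 3) (d.1.2.2 - (d.1.2.2 - d.1.2.1) / 3)

theorem Piece.middle_α (d : A.Piece) : d.α.middle = d.middle := by
  have key : ∀ d : A.Piece, d.α.middle ⊆ d.middle := by
    rintro d _ ⟨u, hu, rfl⟩
    refine ⟨1 - u, ?_, (A.f_symm _ _).symm⟩
    simp only [Piece.α] at hu
    constructor <;> linarith [hu.1, hu.2]
  refine (key d).antisymm ?_
  have := key d.α
  rwa [d.α_α] at this

theorem Piece.meet {d d' : A.Piece} {u v : ℝ} (hu : u ∈ Ioo d.1.2.1 d.1.2.2)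
    (hv : v ∈ Icc d'.1.2.1 d'.1.2.2) (h : A.f d'.1.1 v = A.f d.1.1 u) :
    (d' = d ∧ v = u) ∨ (d' = d.α ∧ v = 1 - u) := by
  have hS := d.2.notMem hu
  have hu1 := d.2.Icc_subset (Ioo_subset_Icc_self hu)
  have hv1 := d'.2.Icc_subset hv
  have hv' : v ∈ Ioo d'.1.2.1 d'.1.2.2 := by
    refine ⟨lt_of_le_of_ne hv.1 ?_, lt_of_le_of_ne hv.2 ?_⟩
    · rintro rfl
      exact hS (h ▸ d'.2.1.2)
    · rintro rfl
      exact hS (h ▸ d'.2.2.1.2)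
  have h2 := d'.2
  rcases A.eq_or_eq _ _ _ _ hu1 hv1 hS h with h1 | h1
  · rw [h1] at h h2
    obtain rfl := A.injOn_f _ hv1 hu1 h
    exact Or.inl ⟨Piece.ext_of h1 (d.2.overlap h2 hu hv').1, rfl⟩
  · rw [h1] at h h2
    rw [A.f_symm] at h
    have h3 := A.injOn_f _ (by constructor <;> linarith [hv1.1, hv1.2]) hu1 h
    have h4 : v = 1 - u := by linarith
    subst h4
    refine Or.inr ⟨Piece.ext_of h1 (d.2.symm.overlap h2 ?_ hv').1, rfl⟩
    constructor <;> linarith [hu.1, hu.2]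

variable (A)

/-- A point of `S` together with the first thirds of the pieces which leave it. -/
def star (n : A.S) : Set (ℝ × ℝ) := {n.1} ∪ ⋃ d ∈ {d : A.Piece | d.base = n}, d.first

theorem isPreconnected_star (n : A.S) : IsPreconnected (A.star n) := by
  have : A.star n = ⋃₀ insert {n.1} (Piece.first '' {d : A.Piece | d.base = n}) := by
    rw [sUnion_insert, sUnion_image, star]
  rw [this]
  refine isPreconnected_sUnion n.1 _ ?_ ?_
  · rintro _ (rfl | ⟨d, rfl, rfl⟩)
    · rfl
    · exact ⟨d.1.2.1, ⟨le_rfl, by linarith [d.2.2.2.1]⟩, rfl⟩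
  · rintro _ (rfl | ⟨d, rfl, rfl⟩)
    · exact isPreconnected_singleton
    · exact isPreconnected_Icc.image _ (A.continuous_f _).continuousOn

theorem exists_planarMap [Finite E] [Fintype A.Piece] [DecidableEq A.S] :
    ∃ M : PlanarMap A.S A.Piece, M.α = Piece.α ∧ M.base = Piece.base := by
  have := A.finite_S.to_subtype
  refine PlanarHypermap.exists_planarMap Piece.α Piece.base Piece.α_α Piece.base_α_ne A.star
    Piece.middle ?_ ?_ A.isPreconnected_star ?_ Piece.middle_α ?_ ?_ ?_ ?_
  · intro n
    refine isCompact_singleton.union ((Set.toFinite _).isCompact_biUnion fun d _ => ?_)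
    exact isCompact_Icc.image (A.continuous_f _)
  · exact fun d => isCompact_Icc.image (A.continuous_f _)
  · exact fun d => isPreconnected_Icc.image _ (A.continuous_f _).continuousOn
  · intro d
    have := d.2.2.2.1
    refine ⟨A.f d.1.1 (d.1.2.1 + (d.1.2.2 - d.1.2.1) / 3), ⟨_, ⟨le_rfl, by linarith⟩, rfl⟩, ?_⟩
    exact Or.inr (mem_biUnion (x := d) rfl ⟨_, ⟨by linarith, le_rfl⟩, rfl⟩)
  · have key : ∀ (n : A.S) (d : A.Piece), n.1 ∈ d.first → n = d.base := by
      rintro n d ⟨u, hu, h⟩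
      have h1 := d.2.2.2.1
      rcases hu.1.eq_or_lt with rfl | hlt
      · exact Subtype.ext h.symm
      · exact absurd (h ▸ n.2) (d.2.notMem ⟨hlt, by linarith [hu.2]⟩)
    intro n n' hne
    rw [Set.disjoint_left]
    rintro x (hx | hx) (hx' | hx')
    · exact hne (Subtype.ext (hx.symm.trans hx'))
    · obtain ⟨d, hd, hx'⟩ := mem_iUnion₂.1 hx'
      obtain rfl := hx
      exact hne ((key n d hx').trans hd)
    · obtain ⟨d, hd, hx⟩ := mem_iUnion₂.1 hx
      obtain rfl := hx'
      exact hne ((key n' d hx).trans hd).symm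
    · obtain ⟨d, rfl, u, hu, rfl⟩ := mem_iUnion₂.1 hx
      obtain ⟨d', hd', hx₂⟩ := mem_iUnion₂.1 hx'
      obtain rfl := hd'
      have h1 := d.2.2.2.1
      rcases hu.1.eq_or_lt with rfl | hlt
      · exact hne (key d.base d' hx₂)
      · obtain ⟨v, hv, h⟩ := hx₂
        have h2 := d'.2.2.2.1
        rcases Piece.meet ⟨hlt, by linarith [hu.2]⟩ ⟨hv.1, by linarith [hv.2]⟩ h with h3 | h3
        · exact hne (congrArg Piece.base h3.1.symm)
        · obtain ⟨rfl, h4⟩ := h3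
          simp only [Piece.α] at hv
          linarith [hu.2, hv.2]
  · intro n d h1 h2
    rw [Set.disjoint_right]
    rintro x ⟨u, hu, rfl⟩ hx
    have h3 := d.2.2.2.1
    have hu' : u ∈ Ioo d.1.2.1 d.1.2.2 := ⟨by linarith [hu.1], by linarith [hu.2]⟩
    rcases hx with hx | hx
    · exact d.2.notMem hu' (hx ▸ n.2)
    · obtain ⟨d', rfl, v, hv, h⟩ := mem_iUnion₂.1 hx
      have h4 := d'.2.2.2.1
      rcases Piece.meet hu' ⟨hv.1, by linarith [hv.2]⟩ h with h5 | h5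
      · exact h1 (congrArg Piece.base h5.1)
      · exact h2 (congrArg Piece.base h5.1)
  · intro d d' h1 h2
    rw [Set.disjoint_left]
    rintro x ⟨u, hu, rfl⟩ ⟨v, hv, h⟩
    have h3 := d.2.2.2.1
    have h4 := d'.2.2.2.1
    rcases Piece.meet ⟨by linarith [hu.1], by linarith [hu.2]⟩
      ⟨by linarith [hv.1], by linarith [hv.2]⟩ h with h5 | h5
    · exact h1 h5.1
    · exact h2 h5.1

end ArcSystem

end PlanarHypermap

namespace PlanarHypermap

open Set Relation

theorem pow_four_of_sameCycle {D : Type*} [Fintype D] [DecidableEq D] (ρ : Equiv.Perm D) (g : D)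
    (P : D → Prop) [DecidablePred P] (hP : ∀ h, P h ↔ ρ.SameCycle g h)
    (hcard : (Finset.univ.filter P).card = 4) : ρ (ρ (ρ (ρ g))) = g ∧ ρ (ρ g) ≠ g := by
  obtain ⟨h1, h2⟩ := three_le_of_sameCycle ρ g P (fun h => (hP h).1) (by omega)
  refine ⟨?_, h2⟩
  by_contra h4
  have h3 : ρ (ρ (ρ g)) ≠ g := by
    intro h3
    have hsub : Finset.univ.filter P ⊆ {g, ρ g, ρ (ρ g)} := by
      intro h hh
      obtain ⟨n, rfl⟩ := exists_pow_eq_of_sameCycle ρ (p := 3) (by norm_num)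
        (by simpa [pow_succ] using h3) ((hP h).1 (by simpa using hh))
      clear hh
      induction n with
      | zero => simp
      | succ n ih =>
        rw [pow_succ', Equiv.Perm.mul_apply]
        simp only [Finset.mem_insert, Finset.mem_singleton] at ih ⊢
        rcases ih with h | h | h <;> rw [h]
        · simp
        · simp
        · simp [h3]
    have := (Finset.card_le_card hsub).trans Finset.card_le_three
    omega
  have hinj := injOn_pow_apply ρ g 5 (by
    intro i h0 h5
    interval_cases i
    · simpa using h1
    · simpa [pow_succ] using h2
    · simpa [pow_succ] using h3
    · simpa [pow_succ] using h4)
  have hle := Finset.card_le_card_of_injOn (t := Finset.univ.filter P) _ (fun i _ => by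
    simp only [Finset.coe_filter, Finset.mem_univ, true_and]
    exact (hP _).2 ((Equiv.Perm.sameCycle_pow_right).2 (Equiv.Perm.SameCycle.refl _ _))) hinj
  rw [Finset.card_range, hcard] at hle
  omega

/-- An arc system whose arcs join terminals, such that exactly two arcs pass through each
other point of `S`. -/
structure TerminalSystem (E V : Type) extends ArcSystem E where
  pos : V → ℝ × ℝ
  pos_inj : Function.Injective pos
  pos_mem : ∀ v, pos v ∈ S
  src : E → V
  f_zero : ∀ e, f e 0 = pos (src e)
  f_ne_pos : ∀ e, ∀ t ∈ Ioo (0 : ℝ) 1, ∀ v, f e t ≠ pos v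
  exists_two : ∀ n ∈ S, n ∉ range pos → ∃ (e h : E) (t u : ℝ), t ∈ Icc 0 1 ∧ u ∈ Icc 0 1 ∧
    h ≠ e ∧ h ≠ symm e ∧ f e t = n ∧ f h u = n ∧
    ∀ g, ∀ v ∈ Icc (0 : ℝ) 1, f g v = n → g = e ∨ g = symm e ∨ g = h ∨ g = symm h

namespace TerminalSystem

variable {E V : Type} (A : TerminalSystem E V)

/-- The terminals, as elements of `S`. -/
def ν (v : V) : A.S := ⟨A.pos v, A.pos_mem v⟩

theorem ν_inj : Function.Injective A.ν := fun _ _ h => A.pos_inj (congrArg Subtype.val h)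

variable {A}

theorem base_mem_iff (d : A.Piece) : d.base ∈ range A.ν ↔ d.1.2.1 = 0 := by
  constructor
  · rintro ⟨v, hv⟩
    by_contra h0
    have h1 := d.2.1.1
    refine A.f_ne_pos d.1.1 d.1.2.1 ⟨lt_of_le_of_ne h1.1 (Ne.symm h0), ?_⟩ v
      (congrArg Subtype.val hv).symm
    exact d.2.2.2.1.trans_le d.2.2.1.1.2
  · intro h0
    refine ⟨A.src d.1.1, Subtype.ext ?_⟩
    change A.pos _ = A.f d.1.1 d.1.2.1
    rw [h0, A.f_zero]

theorem mem_Ioo_of_notMem {e : E} {t : ℝ} (ht : t ∈ Icc (0 : ℝ) 1) (h : A.f e t ∉ range A.pos) :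
    t ∈ Ioo (0 : ℝ) 1 := by
  refine ⟨lt_of_le_of_ne ht.1 ?_, lt_of_le_of_ne ht.2 ?_⟩
  · rintro rfl
    exact h ⟨_, (A.f_zero e).symm⟩
  · rintro rfl
    refine h ⟨A.src (A.symm e), ?_⟩
    rw [← A.f_zero, A.f_symm, sub_zero]

theorem exists_piece {e : E} {t : ℝ} (h : t ∈ A.times e) (h1 : t < 1) :
    ∃ d : A.Piece, d.1.1 = e ∧ d.1.2.1 = t :=
  let ⟨t', h⟩ := A.exists_isNext h h1
  ⟨⟨(e, t, t'), h⟩, rfl, rfl⟩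

theorem card_fiber [Fintype A.Piece] [DecidableEq A.S] {n : A.S} (hn : n ∉ range A.ν) :
    (Finset.univ.filter fun d : A.Piece => d.base = n).card = 4 := by
  classical
  have hn' : n.1 ∉ range A.pos := fun ⟨v, hv⟩ => hn ⟨v, Subtype.ext hv⟩
  obtain ⟨e, h, t, u, ht, hu, h1, h2, h3, h4, h5⟩ := A.exists_two n n.2 hn'
  have ht' := mem_Ioo_of_notMem ht (h3 ▸ hn')
  have hu' := mem_Ioo_of_notMem hu (h4 ▸ hn')
  have ht1 : t ∈ A.times e := ⟨ht, h3 ▸ n.2⟩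
  have hu1 : u ∈ A.times h := ⟨hu, h4 ▸ n.2⟩
  obtain ⟨d1, a1, b1⟩ := exists_piece ht1 ht'.2
  obtain ⟨d2, a2, b2⟩ := exists_piece (A.one_sub_mem_times ht1) (by linarith [ht'.1])
  obtain ⟨d3, a3, b3⟩ := exists_piece hu1 hu'.2
  obtain ⟨d4, a4, b4⟩ := exists_piece (A.one_sub_mem_times hu1) (by linarith [hu'.1])
  have c1 : d1.base = n := Subtype.ext (by change A.f _ _ = _; rw [a1, b1, h3])
  have c2 : d2.base = n := Subtype.ext (by
    change A.f _ _ = _; rw [a2, b2, A.f_symm, sub_sub_cancel, h3])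
  have c3 : d3.base = n := Subtype.ext (by change A.f _ _ = _; rw [a3, b3, h4])
  have c4 : d4.base = n := Subtype.ext (by
    change A.f _ _ = _; rw [a4, b4, A.f_symm, sub_sub_cancel, h4])
  have key : ∀ d d' : A.Piece, d.base = n → d'.base = n → d'.1.1 = d.1.1 → d' = d := by
    intro d d' hd hd' he
    refine ArcSystem.Piece.ext_of he ?_
    have h6 : A.f d'.1.1 d'.1.2.1 = A.f d.1.1 d.1.2.1 := congrArg Subtype.val (hd'.trans hd.symm)
    rw [he] at h6
    exact A.injOn_f _ d'.2.1.1 d.2.1.1 h6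
  have : (Finset.univ.filter fun d : A.Piece => d.base = n) = {d1, d2, d3, d4} := by
    ext d
    simp only [Finset.mem_filter, Finset.mem_univ, true_and, Finset.mem_insert,
      Finset.mem_singleton]
    constructor
    · intro hd
      rcases h5 d.1.1 d.1.2.1 d.2.1.1 (congrArg Subtype.val hd) with h6 | h6 | h6 | h6
      · exact Or.inl (key _ _ c1 hd (h6.trans a1.symm))
      · exact Or.inr (Or.inl (key _ _ c2 hd (h6.trans a2.symm)))
      · exact Or.inr (Or.inr (Or.inl (key _ _ c3 hd (h6.trans a3.symm))))
      · exact Or.inr (Or.inr (Or.inr (key _ _ c4 hd (h6.trans a4.symm))))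
    · rintro (rfl | rfl | rfl | rfl) <;> assumption
  have ne : ∀ {d d' : A.Piece} {e e' : E}, d.1.1 = e → d'.1.1 = e' → e ≠ e' → d ≠ d' := by
    rintro d d' _ _ rfl rfl h rfl
    exact h rfl
  have i1 : h ≠ A.symm h := (A.symm_ne h).symm
  have i2 : e ≠ A.symm e := (A.symm_ne e).symm
  have i3 : e ≠ A.symm h := fun h6 => h2 (by rw [h6, A.symm_symm])
  have i4 : A.symm e ≠ A.symm h := fun h6 => h1 (by rw [← A.symm_symm h, ← h6, A.symm_symm])
  have j1 := ne a1 a2 i2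
  have j2 := ne a1 a3 h1.symm
  have j3 := ne a1 a4 i3
  have j4 := ne a2 a3 h2.symm
  have j5 := ne a2 a4 i4
  have j6 := ne a3 a4 i1
  rw [this, Finset.card_insert_of_notMem, Finset.card_insert_of_notMem, Finset.card_pair j6] <;>
    simp [*]

theorem exists_straight (d : A.Piece) : ∃ d' : A.Piece, (d.1.2.1 = 0 → d' = d) ∧
    (d.1.2.1 ≠ 0 → d'.1.1 = A.symm d.1.1 ∧ d'.1.2.1 = 1 - d.1.2.1) := by
  by_cases h0 : d.1.2.1 = 0
  · exact ⟨d, fun _ => rfl, fun h => absurd h0 h⟩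
  · have h1 : 0 < d.1.2.1 := lt_of_le_of_ne d.2.1.1.1 (Ne.symm h0)
    obtain ⟨d', h2, h3⟩ := exists_piece (A.one_sub_mem_times d.2.1) (by linarith)
    exact ⟨d', fun h => absurd h h0, fun _ => ⟨h2, h3⟩⟩

theorem exists_routing [Finite E] [Fintype A.Piece] [DecidableEq A.S] :
    ∃ R : Routing A.S A.Piece V, R.ν = A.ν ∧ R.base = ArcSystem.Piece.base ∧
      R.α = ArcSystem.Piece.α ∧ ∀ d : A.Piece, d.1.2.1 ≠ 0 →
        (R.τ d).1.1 = A.symm d.1.1 ∧ (R.τ d).1.2.1 = 1 - d.1.2.1 := by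
  classical
  obtain ⟨M, hα, hb⟩ := A.toArcSystem.exists_planarMap
  choose τ hτ0 hτ using exists_straight (A := A)
  have hcycle : ∀ d, M.base d ∉ range A.ν → M.r (M.r (M.r (M.r d))) = d ∧ M.r (M.r d) ≠ d := by
    intro d hd
    refine pow_four_of_sameCycle M.r d (fun d' => d'.base = d.base) (fun d' => ⟨fun h => ?_, ?_⟩)
      (card_fiber (hb ▸ hd))
    · exact M.sameCycle _ _ (by rw [hb, h])
    · rintro h
      obtain ⟨k, -, -, rfl⟩ := h.exists_pow_eq
      rw [← hb]
      clear h
      induction k with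
      | zero => rfl
      | succ k ih => rw [pow_succ', Equiv.Perm.mul_apply, M.base_r, ih]
  have hττ : ∀ d, τ (τ d) = d := by
    intro d
    by_cases h0 : d.1.2.1 = 0
    · rw [hτ0 d h0, hτ0 d h0]
    · obtain ⟨h1, h2⟩ := hτ d h0
      have h3 := d.2.2.2.1.trans_le d.2.2.1.1.2
      obtain ⟨h4, h5⟩ := hτ (τ d) (by rw [h2]; linarith)
      refine ArcSystem.Piece.ext_of ?_ ?_
      · rw [h4, h1, A.symm_symm]
      · rw [h5, h2, sub_sub_cancel]
  refine ⟨{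
    toPlanarMap := M
    ν := A.ν
    ν_inj := A.ν_inj
    r_four := fun d hd => (hcycle d hd).1
    r_two_ne := fun d hd => (hcycle d hd).2
    τ := τ
    τ_τ := hττ
    base_τ := ?_
    τ_ne := ?_ }, rfl, hb, hα, hτ⟩
  · intro d
    rw [hb]
    by_cases h0 : d.1.2.1 = 0
    · rw [hτ0 d h0]
    · obtain ⟨h1, h2⟩ := hτ d h0
      refine Subtype.ext ?_
      change A.f _ _ = A.f _ _
      rw [h1, h2, A.f_symm, sub_sub_cancel]
  · intro d hd h
    rw [hb, base_mem_iff] at hd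
    have h1 := (hτ d hd).1
    rw [h] at h1
    exact A.symm_ne _ h1.symm

theorem seg_of_start [Fintype A.Piece] [DecidableEq A.S] {R : Routing A.S A.Piece V} (hν : R.ν = A.ν)
    (hb : R.base = ArcSystem.Piece.base) (hα : R.α = ArcSystem.Piece.α)
    (hτ : ∀ d : A.Piece, d.1.2.1 ≠ 0 →
        (R.τ d).1.1 = A.symm d.1.1 ∧ (R.τ d).1.2.1 = 1 - d.1.2.1) {a : A.Piece}
    (ha : a.1.2.1 = 0) (d : A.Piece) (hd : d.1.1 = a.1.1) : R.Seg a d := by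
  induction hn : (A.times a.1.1 ∩ Iio d.1.2.1).ncard using Nat.strong_induction_on
    generalizing d with
  | _ n ih =>
    by_cases h0 : d.1.2.1 = 0
    · rw [ArcSystem.Piece.ext_of hd (h0.trans ha.symm)]
      exact ReflTransGen.refl
    · obtain ⟨t, ht⟩ := A.exists_isPrev d.2.1 (lt_of_le_of_ne d.2.1.1.1 (Ne.symm h0))
      have hlt := ht.2.2.1
      set d' : A.Piece := ⟨(d.1.1, t, d.1.2.1), ht⟩ with hd'
      have hmem : R.base (R.α d') ∉ range R.ν := by
        rw [hν, hb, hα, base_mem_iff]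
        have := d.2.2.2.1.trans_le d.2.2.1.1.2
        change 1 - d.1.2.1 ≠ 0
        linarith
      refine (ih _ ?_ d' hd rfl).tail ⟨?_, hmem⟩
      · rw [← hn]
        refine Set.ncard_lt_ncard ?_ ((A.finite_times _).inter_of_left _)
        refine (Set.ssubset_iff_of_subset ?_).2 ⟨t, ⟨hd ▸ ht.1, hlt⟩, fun h => absurd h.2 (lt_irrefl t)⟩
        exact fun x hx => ⟨hx.1, hx.2.trans hlt⟩
      · rw [hν, hb, base_mem_iff] at hmem
        obtain ⟨h1, h2⟩ := hτ _ hmem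
        refine ArcSystem.Piece.ext_of ?_ ?_
        · rw [h1, hα]
          exact (A.symm_symm _).symm
        · rw [h2, hα]
          exact (sub_sub_cancel _ _).symm

theorem exists_start (e : E) : ∃ d : A.Piece, d.1.1 = e ∧ d.1.2.1 = 0 :=
  exists_piece (A.zero_mem_times e) zero_lt_one

theorem exists_carries [Finite E] [Fintype A.Piece] [DecidableEq A.S] [Nonempty E]
    {G : SimpleGraph V} (dart : ∀ {u v}, G.Adj u v → E)
    (hsrc : ∀ {u v} (h : G.Adj u v), A.src (dart h) = u)
    (hsymm : ∀ {u v} (h : G.Adj u v), dart h.symm = A.symm (dart h)) :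
    ∃ (R : Routing A.S A.Piece V) (s : V → V → A.Piece), R.Carries s G ∧ R.ν = A.ν := by
  classical
  obtain ⟨R, hν, hb, hα, hτ⟩ := exists_routing (A := A)
  choose st hst1 hst2 using exists_start (A := A)
  obtain ⟨e₀⟩ := ‹Nonempty E›
  set s : V → V → A.Piece := fun u v => if h : G.Adj u v then st (dart h) else st e₀ with hs
  have hs' : ∀ {u v} (h : G.Adj u v), s u v = st (dart h) := fun h => dif_pos h
  refine ⟨R, s, ⟨fun u v h => ?_, fun u v h => ?_⟩, hν⟩
  · rw [hb, hν, hs' h]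
    refine Subtype.ext ?_
    change A.f _ _ = A.pos u
    rw [hst1, hst2, A.f_zero, hsrc]
  · rw [hs' h, hs' h.symm]
    refine seg_of_start hν hb hα hτ (hst2 _) _ ?_
    rw [hα, hst1]
    change A.symm (st _).1.1 = _
    rw [hst1, hsymm, A.symm_symm]

end TerminalSystem

end PlanarHypermap

namespace PlaneDrawing

open Set PlanarHypermap

variable {V : Type} {G : SimpleGraph V} (D : PlaneDrawing G)

/-- The arc of a dart, parametrized by the real line. -/
noncomputable def dartArc (g : G.Dart) : ℝ → ℝ × ℝ := (D.arc g.adj).extend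

theorem dartArc_of_mem (g : G.Dart) {t : ℝ} (ht : t ∈ Icc (0 : ℝ) 1) :
    D.dartArc g t = D.arc g.adj ⟨t, ht⟩ :=
  (D.arc g.adj).extend_apply ht

theorem dartArc_symm (g : G.Dart) (t : ℝ) : D.dartArc g.symm t = D.dartArc g (1 - t) := by
  change (D.arc g.adj.symm).extend t = _
  rw [D.arc_symm, Path.extend_symm_apply]
  rfl

theorem dartArc_zero (g : G.Dart) : D.dartArc g 0 = D.pos g.fst := Path.extend_zero _

theorem dartArc_one (g : G.Dart) : D.dartArc g 1 = D.pos g.snd := Path.extend_one _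

theorem injOn_dartArc (g : G.Dart) : InjOn (D.dartArc g) (Icc 0 1) := by
  intro s hs t ht h
  rw [D.dartArc_of_mem g hs, D.dartArc_of_mem g ht] at h
  exact congrArg Subtype.val (D.arc_inj _ h)

theorem dartArc_ne_pos (g : G.Dart) {t : ℝ} (ht : t ∈ Ioo (0 : ℝ) 1) (v : V) :
    D.dartArc g t ≠ D.pos v := by
  have ht' := Ioo_subset_Icc_self ht
  intro h
  rcases D.no_vertex_mem g.adj v ⟨t, ht'⟩ (by rw [← D.dartArc_of_mem g ht', h]) with rfl | rfl
  · rw [← D.dartArc_zero] at h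
    exact ht.1.ne' (D.injOn_dartArc g ht' ⟨le_rfl, zero_le_one⟩ h)
  · rw [← D.dartArc_one] at h
    exact ht.2.ne (D.injOn_dartArc g ht' ⟨zero_le_one, le_rfl⟩ h)

theorem mem_Ioo_of_dartArc_notMem {g : G.Dart} {t : ℝ} (ht : t ∈ Icc (0 : ℝ) 1)
    (h : D.dartArc g t ∉ range D.pos) : t ∈ Ioo (0 : ℝ) 1 := by
  refine ⟨ht.1.lt_of_ne ?_, ht.2.lt_of_ne ?_⟩
  · rintro rfl
    exact h ⟨_, (D.dartArc_zero g).symm⟩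
  · rintro rfl
    exact h ⟨_, (D.dartArc_one g).symm⟩

theorem isInteriorPoint_iff {g : G.Dart} {p : ℝ × ℝ} :
    D.IsInteriorPoint g.adj p ↔ ∃ t ∈ Ioo (0 : ℝ) 1, D.dartArc g t = p := by
  constructor
  · rintro ⟨t, h0, h1, rfl⟩
    refine ⟨t, ⟨unitInterval.pos_iff_ne_zero.2 h0, unitInterval.lt_one_iff_ne_one.2 h1⟩, ?_⟩
    exact D.dartArc_of_mem g t.2
  · rintro ⟨t, ht, rfl⟩
    refine ⟨⟨t, Ioo_subset_Icc_self ht⟩, ?_, ?_, (D.dartArc_of_mem g _).symm⟩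
    · exact fun h => ht.1.ne' (congrArg Subtype.val h)
    · exact fun h => ht.2.ne (congrArg Subtype.val h)

theorem mem_crossings_iff {p : ℝ × ℝ} : p ∈ D.crossings ↔ ∃ g h : G.Dart,
    g.edge ≠ h.edge ∧ D.IsInteriorPoint g.adj p ∧ D.IsInteriorPoint h.adj p := by
  constructor
  · rintro ⟨u, v, x, y, h₁, h₂, hne, hp₁, hp₂⟩
    exact ⟨⟨(u, v), h₁⟩, ⟨(x, y), h₂⟩, hne, hp₁, hp₂⟩
  · rintro ⟨g, h, hne, hp₁, hp₂⟩
    exact ⟨_, _, _, _, g.adj, h.adj, hne, hp₁, hp₂⟩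

theorem finite_crossings [Fintype V] : D.crossings.Finite := by
  classical
  refine (finite_iUnion fun q : {q : G.Dart × G.Dart // q.1.edge ≠ q.2.edge} =>
    D.finite_inter q.1.1.adj q.1.2.adj q.2).subset fun p hp => ?_
  obtain ⟨g, h, hne, ⟨t, -, -, ht⟩, ⟨u, -, -, hu⟩⟩ := D.mem_crossings_iff.1 hp
  exact mem_iUnion.2 ⟨⟨(g, h), hne⟩, ⟨t, ht⟩, ⟨u, hu⟩⟩

theorem eq_of_isInteriorPoint {g₁ g₂ g₃ : G.Dart} {p : ℝ × ℝ} (h₁ : D.IsInteriorPoint g₁.adj p)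
    (h₂ : D.IsInteriorPoint g₂.adj p) (h₃ : D.IsInteriorPoint g₃.adj p)
    (h : g₁.edge ≠ g₂.edge) : g₃.edge = g₁.edge ∨ g₃.edge = g₂.edge := by
  by_contra! hne
  obtain ⟨t₁, h10, h11, rfl⟩ := h₁
  obtain ⟨t₂, h20, h21, e2⟩ := h₂
  obtain ⟨t₃, h30, h31, e3⟩ := h₃
  exact D.no_triple_point g₁.adj g₂.adj g₃.adj h hne.1.symm hne.2.symm t₁ t₂ t₃ h10 h11 h20 h21
    h30 h31 e2.symm (e2.trans e3.symm)

/-- The arcs of a drawing, with its vertices and crossings as the special points. -/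
noncomputable def terminalSystem [Fintype V] : TerminalSystem G.Dart V where
  S := range D.pos ∪ D.crossings
  finite_S := (finite_range _).union D.finite_crossings
  f := D.dartArc
  continuous_f g := (D.arc g.adj).continuous_extend
  injOn_f := D.injOn_dartArc
  symm := SimpleGraph.Dart.symm
  symm_symm := SimpleGraph.Dart.symm_symm
  symm_ne := SimpleGraph.Dart.symm_ne
  f_symm := D.dartArc_symm
  zero_mem g := Or.inl ⟨_, (D.dartArc_zero g).symm⟩
  eq_or_eq g h s t hs ht hS hst := by
    by_contra hne
    refine hS (Or.inr (D.mem_crossings_iff.2 ⟨g, h, fun he => hne ?_, ?_, ?_⟩))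
    · exact (SimpleGraph.dart_edge_eq_iff _ _).1 he.symm
    · exact D.isInteriorPoint_iff.2
        ⟨s, D.mem_Ioo_of_dartArc_notMem hs fun h => hS (Or.inl h), rfl⟩
    · exact D.isInteriorPoint_iff.2
        ⟨t, D.mem_Ioo_of_dartArc_notMem ht fun h => hS (Or.inl (hst ▸ h)), hst⟩
  pos := D.pos
  pos_inj := D.pos_inj
  pos_mem v := Or.inl ⟨v, rfl⟩
  src g := g.fst
  f_zero := D.dartArc_zero
  f_ne_pos g _ ht := D.dartArc_ne_pos g ht
  exists_two n hn hv := by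
    obtain ⟨g, h, hne, hg, hh⟩ := D.mem_crossings_iff.1 (hn.resolve_left hv)
    obtain ⟨t, ht, hgt⟩ := D.isInteriorPoint_iff.1 hg
    obtain ⟨u, hu, hhu⟩ := D.isInteriorPoint_iff.1 hh
    have hne' : ¬(h = g ∨ h = g.symm) := fun e =>
      hne ((SimpleGraph.dart_edge_eq_iff _ _).2 e).symm
    refine ⟨g, h, t, u, Ioo_subset_Icc_self ht, Ioo_subset_Icc_self hu,
      fun e => hne' (Or.inl e), fun e => hne' (Or.inr e), hgt, hhu, fun g' v hv' hn' => ?_⟩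
    have hg' : D.IsInteriorPoint g'.adj n :=
      D.isInteriorPoint_iff.2 ⟨v, D.mem_Ioo_of_dartArc_notMem hv' (hn' ▸ hv), hn'⟩
    rw [← or_assoc]
    exact (D.eq_of_isInteriorPoint hg hh hg' hne).imp (SimpleGraph.dart_edge_eq_iff _ _).1
      (SimpleGraph.dart_edge_eq_iff _ _).1

theorem edgeCrossings_subset (g : G.Dart) : D.edgeCrossings g.adj ⊆ D.crossings := by
  rintro p ⟨hp, x, y, h, hne, hp'⟩
  exact ⟨_, _, x, y, g.adj, h, hne, hp, hp'⟩

theorem four_le_card_darts [Fintype V] [DecidableEq G.Dart] [Fintype G.Dart] {p : ℝ × ℝ}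
    [DecidablePred fun g : G.Dart => p ∈ D.edgeCrossings g.adj] (hp : p ∈ D.crossings) :
    4 ≤ (Finset.univ.filter fun g : G.Dart => p ∈ D.edgeCrossings g.adj).card := by
  obtain ⟨g, h, hne, hg, hh⟩ := D.mem_crossings_iff.1 hp
  have key : ∀ g h : G.Dart, g.edge ≠ h.edge → D.IsInteriorPoint g.adj p →
      D.IsInteriorPoint h.adj p → p ∈ D.edgeCrossings g.adj := fun g h hne hg hh =>
    ⟨hg, _, _, h.adj, hne, hh⟩
  have hsymm : ∀ g : G.Dart, D.IsInteriorPoint g.adj p → D.IsInteriorPoint g.symm.adj p := by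
    intro g hg
    obtain ⟨t, ht, rfl⟩ := D.isInteriorPoint_iff.1 hg
    refine D.isInteriorPoint_iff.2 ⟨1 - t, ⟨by linarith [ht.2], by linarith [ht.1]⟩, ?_⟩
    rw [D.dartArc_symm, sub_sub_cancel]
  have hcard : ({g, g.symm, h, h.symm} : Finset G.Dart).card = 4 := by
    have hne' : ¬(g = h ∨ g = h.symm) := fun e => hne ((SimpleGraph.dart_edge_eq_iff _ _).2 e)
    rw [Finset.card_eq_succ]
    refine ⟨g, {g.symm, h, h.symm}, ?_, rfl, Finset.card_eq_three.2
      ⟨_, _, _, ?_, ?_, h.symm_ne.symm, rfl⟩⟩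
    · simp only [Finset.mem_insert, Finset.mem_singleton]
      push Not at hne' ⊢
      exact ⟨g.symm_ne.symm, hne'⟩
    · intro e
      exact hne' (Or.inr (by rw [← e, SimpleGraph.Dart.symm_symm]))
    · intro e
      exact hne' (Or.inl (SimpleGraph.Dart.symm_involutive.injective e))
  rw [← hcard]
  refine Finset.card_le_card fun d hd => ?_
  simp only [Finset.mem_insert, Finset.mem_singleton] at hd
  refine Finset.mem_filter.2 ⟨Finset.mem_univ _, ?_⟩
  rcases hd with rfl | rfl | rfl | rfl
  · exact key _ h hne hg hh
  · exact key _ h (by rwa [SimpleGraph.Dart.edge_symm]) (hsymm _ hg) hh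
  · exact key _ g hne.symm hh hg
  · exact key _ g (by rw [SimpleGraph.Dart.edge_symm]; exact hne.symm) (hsymm _ hh) hg

theorem four_mul_ncard_crossings_le [Fintype V] [Fintype G.Dart] {k : ℕ} (hD : D.IsKPlane k) :
    4 * D.crossings.ncard ≤ Fintype.card G.Dart * k := by
  classical
  have hfin := D.finite_crossings
  rw [ncard_eq_toFinset_card _ hfin, mul_comm]
  calc hfin.toFinset.card * 4
      ≤ ∑ p ∈ hfin.toFinset,
          (Finset.univ.filter fun g : G.Dart => p ∈ D.edgeCrossings g.adj).card := by
        rw [← smul_eq_mul]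
        exact Finset.card_nsmul_le_sum _ _ _ fun p hp =>
          D.four_le_card_darts (hfin.mem_toFinset.1 hp)
    _ = ∑ g : G.Dart, (hfin.toFinset.filter fun p => p ∈ D.edgeCrossings g.adj).card :=
        Finset.sum_card_bipartiteAbove_eq_sum_card_bipartiteBelow _
    _ ≤ ∑ _g : G.Dart, k := by
        refine Finset.sum_le_sum fun g _ => le_trans (le_of_eq ?_) (hD g.adj)
        rw [← ncard_coe_finset]
        congr 1
        ext p
        simpa using fun h => D.edgeCrossings_subset g h
    _ = Fintype.card G.Dart * k := by simp

end PlaneDrawing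

theorem HasNoCycleOfLength.noFourCycle {V : Type*} {G : SimpleGraph V}
    (h : HasNoCycleOfLength G 4) : NoFourCycle G := by
  intro a b c d hac hbd hab hbc hcd hda
  refine h a (.cons hab (.cons hbc (.cons hcd (.cons hda .nil)))) ?_ rfl
  rw [SimpleGraph.Walk.cons_isCycle_iff]
  have := hab.ne
  have := hbc.ne
  have := hcd.ne
  have := hda.ne
  simp only [SimpleGraph.Walk.cons_isPath_iff, SimpleGraph.Walk.support_cons,
    SimpleGraph.Walk.support_nil, SimpleGraph.Walk.edges_cons, SimpleGraph.Walk.edges_nil,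
    List.mem_cons, List.not_mem_nil, Sym2.eq_iff, SimpleGraph.Walk.isPath_iff_nil]
  grind

namespace PlaneDrawing

open PlanarHypermap

theorem edges_pow_three_le {V : Type} [Fintype V] {G : SimpleGraph V} (D : PlaneDrawing G)
    (hC : NoFourCycle G) (hn : 0 < Fintype.card V)
    (hm : (3.483 : ℝ) * Fintype.card V ≤ G.edgeSet.ncard) :
    6272 * (G.edgeSet.ncard : ℝ) ^ 3 ≤
      114075 * (Fintype.card V : ℝ) ^ 2 * D.crossings.ncard := by
  classical
  have hn' : (0 : ℝ) < Fintype.card V := by exact_mod_cast hn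
  have hdart : Fintype.card G.Dart = 2 * G.edgeSet.ncard := by
    rw [G.dart_card_eq_twice_card_edges, ← SimpleGraph.coe_edgeFinset, Set.ncard_coe_finset]
  have : Nonempty G.Dart := by
    rw [← Fintype.card_pos_iff, hdart]
    have : (0 : ℝ) < G.edgeSet.ncard := by linarith
    have : 0 < G.edgeSet.ncard := by exact_mod_cast this
    omega
  let A := D.terminalSystem
  have : Finite A.S := A.finite_S
  let _ : Fintype A.Piece := Fintype.ofFinite _
  obtain ⟨R, s, C, hν⟩ := A.exists_carries (G := G) (fun {u v} h => (⟨(u, v), h⟩ : G.Dart))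
    (fun _ => rfl) (fun _ => rfl)
  obtain ⟨R', s', C', P, hle⟩ := C.exists_proper
  have hR : R.crossing.ncard ≤ D.crossings.ncard := by
    refine Set.ncard_le_ncard_of_injOn Subtype.val (fun x hx => ?_) Subtype.val_injective.injOn
      D.finite_crossings
    refine (x.2 : (x : ℝ × ℝ) ∈ Set.range D.pos ∪ D.crossings).resolve_left ?_
    rintro ⟨v, hv⟩
    exact hx.1 ⟨v, by rw [hν]; exact Subtype.ext hv⟩
  have hx : (R'.crossing.ncard : ℝ) ≤ D.crossings.ncard := by exact_mod_cast hle.trans hR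
  refine crossing_lemma_arith hn' hm fun p hp0 hp1 => ?_
  have h := C'.sampling_bound P hC hp0 hp1
  rw [card_adjPairs, hdart] at h
  push_cast at h
  have : (R'.crossing.ncard : ℝ) * p ^ 4 ≤ D.crossings.ncard * p ^ 4 := by gcongr
  linarith

end PlaneDrawing

theorem stmt_11 (k : ℕ) (hk : 1 ≤ k) {V : Type} [Fintype V]
    (G : SimpleGraph V) (hC4 : HasNoCycleOfLength G 4) (hG : KPlanar G k)
    (hn : 2 ≤ Fintype.card V)
    (hm : (3.483 : ℝ) * Fintype.card V ≤ G.edgeSet.ncard) :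
    (G.edgeSet.ncard : ℝ) ≤ Real.sqrt (114075 * k / 12544) * Fintype.card V ∧
      (G.edgeSet.ncard : ℝ) < 3.016 * Real.sqrt k * Fintype.card V := by
  classical
  obtain ⟨D, hD⟩ := hG
  have hcube := D.edges_pow_three_le hC4.noFourCycle (by omega) hm
  have hcross := D.four_mul_ncard_crossings_le hD
  rw [G.dart_card_eq_twice_card_edges, ← Set.ncard_coe_finset, SimpleGraph.coe_edgeFinset]
    at hcross
  have hcross' : 4 * (D.crossings.ncard : ℝ) ≤ 2 * G.edgeSet.ncard * k := by exact_mod_cast hcross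
  have hn0 : (0 : ℝ) < Fintype.card V := by exact_mod_cast (by omega : 0 < Fintype.card V)
  have hk0 : (0 : ℝ) < k := by exact_mod_cast hk
  generalize (Fintype.card V : ℝ) = n at *
  generalize (G.edgeSet.ncard : ℝ) = m at *
  generalize (D.crossings.ncard : ℝ) = x at *
  have hm0 : 0 < m := by linarith
  have hsq : m ^ 2 ≤ 114075 * k / 12544 * n ^ 2 := by
    have h : 114075 * n ^ 2 * (4 * x) ≤ 114075 * n ^ 2 * (2 * m * k) := by gcongr
    have h' : m * (12544 * m ^ 2) ≤ m * (114075 * k * n ^ 2) := by linarith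
    have := le_of_mul_le_mul_left h' hm0
    linarith
  have hle : m ≤ Real.sqrt (114075 * k / 12544) * n := by
    refine le_of_sq_le_sq ?_ (by positivity)
    rwa [mul_pow, Real.sq_sqrt (by positivity)]
  refine ⟨hle, hle.trans_lt ?_⟩
  gcongr
  rw [Real.sqrt_lt' (by positivity), mul_pow, Real.sq_sqrt hk0.le]
  nlinarith
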